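/- Let n_0 be a positive Borel measure on (0,∞) with ∫ x n_0(dx) = ∫ x² n_0(dx) = 1 and μ_3 = ∫ x³ n_0(dx) < ∞. Suppose (n(t,·))_{t∈[0,∞)} is a weak solution of Smoluchowski's coagulation equation with additive kernel K(x,y) = x + y and n(0,·) = n_0, and for each t ≥ 0 let F(t, x̂) = ∫_{(0, e^{2t} x̂]} y n(t,dy) and F_*(x̂) = ∫_0^{x̂} (2π)^{−1/2} ŷ^{−1/2} e^{−ŷ/2} dŷ. Then there is a constant C depending only on μ_3 such that for all t ∈ [0,∞), sup_{x̂>0} |F(t, x̂) − F_*(x̂)| ≤ C(μ_3)(1 + t) e^{−t}. -/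

import Mathlib

open MeasureTheory Set

/-- A family `n t` of finite positive Borel measures on `(0,∞)` (here: measures on `ℝ`
giving no mass to `(-∞,0]`) is a weak solution of Smoluchowski's coagulation equation
with kernel `K` on the time interval `I` if for every smooth compactly supported test
function `φ` with support in `(0,∞)`, the map `t ↦ ∫ φ dn(t)` is differentiable with
derivative `(1/2)∫∫ (φ(x+y) - φ(x) - φ(y)) K(x,y) n(t,dy) n(t,dx)`; moreover the moment
identities obtained from the weak form with the polynomial test functions `x^j`, `j ∈ J`,
hold whenever the corresponding moments are finite. -/
def IsWeakSolution (K : ℝ → ℝ → ℝ) (I : Set ℝ) (n : ℝ → Measure ℝ) (J : Set ℕ) : Prop :=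
  (∀ t ∈ I, IsFiniteMeasure (n t)) ∧
  (∀ t ∈ I, n t (Iic 0) = 0) ∧
  (∀ φ : ℝ → ℝ, ContDiff ℝ (⊤ : ℕ∞) φ → HasCompactSupport φ → tsupport φ ⊆ Ioi 0 →
    ∀ t ∈ I, HasDerivWithinAt (fun r => ∫ x, φ x ∂(n r))
      ((1 / 2) * ∫ x, ∫ y, (φ (x + y) - φ x - φ y) * K x y ∂(n t) ∂(n t)) I t) ∧
  (∀ j ∈ J,
    (∀ t ∈ I, Integrable (fun x => x ^ j) (n t)) →
    (∀ t ∈ I, Integrable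
        (fun p : ℝ × ℝ => ((p.1 + p.2) ^ j - p.1 ^ j - p.2 ^ j) * K p.1 p.2)
        ((n t).prod (n t))) →
    ∀ t ∈ I, HasDerivWithinAt (fun r => ∫ x, x ^ j ∂(n r))
      ((1 / 2) * ∫ p : ℝ × ℝ, ((p.1 + p.2) ^ j - p.1 ^ j - p.2 ^ j) * K p.1 p.2
          ∂((n t).prod (n t))) I t)


section
open MeasureTheory Set Filter Topology
namespace AK

/-! ### Cutoffs and test functions -/

structure IsTest (φ : ℝ → ℝ) : Prop where
  smooth : ContDiff ℝ (⊤ : ℕ∞) φ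
  cpt : HasCompactSupport φ
  supp : tsupport φ ⊆ Ioi 0

structure Nice (L : ℝ) (f : ℝ → ℝ) : Prop where
  smooth : ContDiff ℝ (⊤ : ℕ∞) f
  lip : ∀ x y, 0 ≤ x → 0 ≤ y → |f x - f y| ≤ L * |x - y|
  bdd : ∀ x, 0 ≤ x → |f x| ≤ L
  zero : f 0 = 0

lemma Nice.L_nonneg {L : ℝ} {f : ℝ → ℝ} (h : Nice L f) : 0 ≤ L :=
  (abs_nonneg _).trans (h.bdd 0 le_rfl)

lemma Nice.le_mul {L : ℝ} {f : ℝ → ℝ} (h : Nice L f) {x : ℝ} (hx : 0 ≤ x) : |f x| ≤ L * x := by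
  have := h.lip x 0 hx le_rfl
  simpa [h.zero, abs_of_nonneg hx] using this

lemma st_lip : ∃ C : ℝ, 0 ≤ C ∧ ∀ x y : ℝ,
    |Real.smoothTransition x - Real.smoothTransition y| ≤ C * |x - y| := by
  have hcd : ContDiff ℝ (⊤ : ℕ∞) Real.smoothTransition := Real.smoothTransition.contDiff
  have hdiff : Differentiable ℝ Real.smoothTransition := hcd.differentiable (by simp)
  have hcont : Continuous (deriv Real.smoothTransition) := hcd.continuous_deriv (by simp)
  obtain ⟨C, hC⟩ := (isCompact_Icc (a := (0:ℝ)) (b := 1)).exists_bound_of_continuousOn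
    hcont.continuousOn
  have hC0 : 0 ≤ C := (norm_nonneg _).trans (hC 0 (by simp))
  refine ⟨C, hC0, ?_⟩
  have hb : ∀ x, ‖deriv Real.smoothTransition x‖ ≤ C := by
    intro x
    by_cases hx : x ∈ Icc (0:ℝ) 1
    · exact hC x hx
    · have : deriv Real.smoothTransition x = 0 := by
        simp only [mem_Icc, not_and_or, not_le] at hx
        rcases hx with hx | hx
        · have : Real.smoothTransition =ᶠ[𝓝 x] fun _ => 0 := by
            filter_upwards [Iio_mem_nhds hx] with y hy
            exact Real.smoothTransition.zero_of_nonpos (le_of_lt hy)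
          rw [this.deriv_eq]; simp
        · have : Real.smoothTransition =ᶠ[𝓝 x] fun _ => 1 := by
            filter_upwards [Ioi_mem_nhds hx] with y hy
            exact Real.smoothTransition.one_of_one_le (le_of_lt hy)
          rw [this.deriv_eq]; simp
      rw [this]; simpa using hC0
  intro x y
  have := Convex.norm_image_sub_le_of_norm_deriv_le (f := Real.smoothTransition) (s := univ)
    (x := y) (y := x) (C := C) (fun z _ => hdiff z) (fun z _ => hb z) convex_univ trivial trivial
  simpa [Real.norm_eq_abs] using this

noncomputable def cut (k : ℕ) (x : ℝ) : ℝ :=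
  Real.smoothTransition (((k:ℝ) + 1) * x - 1) * Real.smoothTransition (2 - x / ((k:ℝ) + 1))

lemma cut_nonneg (k : ℕ) (x : ℝ) : 0 ≤ cut k x :=
  mul_nonneg (Real.smoothTransition.nonneg _) (Real.smoothTransition.nonneg _)

lemma cut_le_one (k : ℕ) (x : ℝ) : cut k x ≤ 1 :=
  mul_le_one₀ (Real.smoothTransition.le_one _) (Real.smoothTransition.nonneg _)
    (Real.smoothTransition.le_one _)

lemma cut_smooth (k : ℕ) : ContDiff ℝ (⊤ : ℕ∞) (cut k) := by
  unfold cut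
  apply ContDiff.mul
  · exact Real.smoothTransition.contDiff.comp (by fun_prop)
  · exact Real.smoothTransition.contDiff.comp (by fun_prop)

lemma cut_eq_zero {k : ℕ} {x : ℝ} (h : x ∉ Icc (1 / ((k:ℝ) + 1)) (2 * ((k:ℝ) + 1))) :
    cut k x = 0 := by
  have hk : (0:ℝ) < (k:ℝ) + 1 := by positivity
  simp only [mem_Icc, not_and_or, not_le] at h
  unfold cut
  rcases h with h | h
  · rw [lt_div_iff₀ hk] at h
    rw [Real.smoothTransition.zero_of_nonpos (by nlinarith), zero_mul]
  · rw [← lt_div_iff₀ hk] at h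
    rw [Real.smoothTransition.zero_of_nonpos (x := 2 - x / ((k:ℝ) + 1)) (by linarith), mul_zero]

lemma cut_tendsto {x : ℝ} (hx : 0 < x) : ∀ᶠ k in atTop, cut k x = 1 := by
  obtain ⟨N, hN⟩ := exists_nat_ge (max (2 / x) x)
  filter_upwards [eventually_ge_atTop N] with k hk
  have hkN : (N:ℝ) ≤ k := by exact_mod_cast hk
  have h1 : 2 / x ≤ k := (le_max_left _ _).trans (hN.trans hkN)
  have h2 : x ≤ k := (le_max_right _ _).trans (hN.trans hkN)
  have hk0 : (0:ℝ) < (k:ℝ) + 1 := by positivity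
  rw [div_le_iff₀ hx] at h1
  unfold cut
  rw [Real.smoothTransition.one_of_one_le (by nlinarith),
    Real.smoothTransition.one_of_one_le, one_mul]
  have : x / ((k:ℝ) + 1) ≤ 1 := by rw [div_le_one hk0]; linarith
  linarith

lemma isTest_cut {f : ℝ → ℝ} (hf : ContDiff ℝ (⊤ : ℕ∞) f) (k : ℕ) :
    IsTest (fun x => f x * cut k x) := by
  have hk : (0:ℝ) < (k:ℝ) + 1 := by positivity
  have hs : tsupport (fun x => f x * cut k x) ⊆ Icc (1 / ((k:ℝ) + 1)) (2 * ((k:ℝ) + 1)) := by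
    apply closure_minimal _ isClosed_Icc
    intro x hx
    by_contra h
    exact hx (by simp [cut_eq_zero h])
  refine ⟨hf.mul (cut_smooth k), ?_, ?_⟩
  · exact HasCompactSupport.of_support_subset_isCompact isCompact_Icc
      ((subset_tsupport _).trans hs)
  · intro x hx
    have := (hs hx).1
    exact lt_of_lt_of_le (by positivity) this

lemma cut_lip : ∃ C : ℝ, 0 ≤ C ∧ ∀ (k : ℕ) (x y : ℝ), 0 ≤ x → x ≤ y →
    x * |cut k x - cut k y| ≤ C * |x - y| := by
  obtain ⟨C, hC, h⟩ := st_lip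
  refine ⟨4 * C, by positivity, ?_⟩
  intro k x y hx hxy
  have hk : (0:ℝ) < (k:ℝ) + 1 := by positivity
  set K := (k:ℝ) + 1
  have e : cut k x - cut k y = (Real.smoothTransition (K * x - 1) - Real.smoothTransition (K * y - 1))
      * Real.smoothTransition (2 - x / K) + Real.smoothTransition (K * y - 1) *
      (Real.smoothTransition (2 - x / K) - Real.smoothTransition (2 - y / K)) := by
    unfold cut; ring
  have h1 : x * |Real.smoothTransition (K * x - 1) - Real.smoothTransition (K * y - 1)|
      ≤ 2 * C * |x - y| := by
    by_cases hx2 : 2 ≤ K * x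
    · rw [Real.smoothTransition.one_of_one_le (by linarith),
        Real.smoothTransition.one_of_one_le (by nlinarith)]
      simp; positivity
    · have := h (K * x - 1) (K * y - 1)
      have e2 : |K * x - 1 - (K * y - 1)| = K * |x - y| := by
        rw [← abs_of_pos hk, ← abs_mul, abs_of_pos hk]; congr 1; ring
      rw [e2] at this
      calc _ ≤ x * (C * (K * |x - y|)) := by gcongr
        _ = (K * x) * (C * |x - y|) := by ring
        _ ≤ 2 * (C * |x - y|) := by gcongr; linarith
        _ = _ := by ring
  have h2 : x * |Real.smoothTransition (2 - x / K) - Real.smoothTransition (2 - y / K)|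
      ≤ 2 * C * |x - y| := by
    by_cases hx2 : 2 ≤ x / K
    · have : x / K ≤ y / K := by gcongr
      rw [Real.smoothTransition.zero_of_nonpos (by linarith),
        Real.smoothTransition.zero_of_nonpos (by linarith)]
      simp; positivity
    · have := h (2 - x / K) (2 - y / K)
      have e2 : |2 - x / K - (2 - y / K)| = |x - y| / K := by
        rw [← abs_of_pos hk, ← abs_div, abs_of_pos hk, ← abs_neg]; congr 1; ring
      rw [e2] at this
      calc _ ≤ x * (C * (|x - y| / K)) := by gcongr
        _ = (x / K) * (C * |x - y|) := by ring
        _ ≤ 2 * (C * |x - y|) := by gcongr; linarith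
        _ = _ := by ring
  rw [e]
  calc _ ≤ x * (|Real.smoothTransition (K * x - 1) - Real.smoothTransition (K * y - 1)| * 1
        + 1 * |Real.smoothTransition (2 - x / K) - Real.smoothTransition (2 - y / K)|) := by
        gcongr
        refine (abs_add_le _ _).trans ?_
        rw [abs_mul, abs_mul, abs_of_nonneg (Real.smoothTransition.nonneg _),
          abs_of_nonneg (Real.smoothTransition.nonneg (K * y - 1))]
        gcongr
        · exact Real.smoothTransition.le_one _
        · exact Real.smoothTransition.le_one _
    _ ≤ _ := by linarith

lemma nice_cut : ∃ C : ℝ, 0 ≤ C ∧ ∀ (L : ℝ) (f : ℝ → ℝ), Nice L f → ∀ k : ℕ,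
    Nice (C * L) (fun x => f x * cut k x) := by
  obtain ⟨C, hC, h⟩ := cut_lip
  refine ⟨1 + C, by positivity, ?_⟩
  intro L f hf k
  have hL := hf.L_nonneg
  have key : ∀ x y, 0 ≤ x → x ≤ y → |f x * cut k x - f y * cut k y| ≤ (1 + C) * L * |x - y| := by
    intro x y hx hxy
    have e : f x * cut k x - f y * cut k y = (f x - f y) * cut k y + f x * (cut k x - cut k y) := by
      ring
    rw [e]
    calc _ ≤ |f x - f y| * 1 + (L * x) * |cut k x - cut k y| := by
          refine (abs_add_le _ _).trans ?_
          rw [abs_mul, abs_mul, abs_of_nonneg (cut_nonneg _ _)]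
          gcongr
          · exact cut_le_one _ _
          · exact hf.le_mul hx
      _ ≤ L * |x - y| + L * (C * |x - y|) := by
          have := h k x y hx hxy
          have h2 := hf.lip x y hx (hx.trans hxy)
          have h3 := mul_le_mul_of_nonneg_left this hL
          linarith
      _ = _ := by ring
  refine ⟨hf.smooth.mul (cut_smooth k), ?_, ?_, ?_⟩
  · intro x y hx hy
    rcases le_total x y with hxy | hxy
    · exact key x y hx hxy
    · have := key y x hy hxy
      rwa [abs_sub_comm, abs_sub_comm y x] at this
  · intro x hx
    rw [abs_mul, abs_of_nonneg (cut_nonneg _ _)]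
    calc _ ≤ L * 1 := by
          gcongr
          · exact cut_nonneg _ _
          · exact hf.bdd x hx
          · exact cut_le_one _ _
      _ ≤ _ := by nlinarith
  · simp [hf.zero]

end AK
end

section
open MeasureTheory Set Filter Topology
namespace AK

/-! ### Estimates for one measure -/

noncomputable def mass (μ : Measure ℝ) : ENNReal := ∫⁻ x, ENNReal.ofReal x ∂μ
noncomputable def M (μ : Measure ℝ) : ℝ := (mass μ).toReal
noncomputable def E (μ : Measure ℝ) : ℝ := ∫ x, (1 - Real.exp (-x)) ∂μ
noncomputable def gk (φ : ℝ → ℝ) (p : ℝ × ℝ) : ℝ := (φ (p.1 + p.2) - φ p.1 - φ p.2) * (p.1 + p.2)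
noncomputable def Q (μ : Measure ℝ) (φ : ℝ → ℝ) : ℝ := (1 / 2) * ∫ p, gk φ p ∂(μ.prod μ)

lemma IsTest.nice {φ : ℝ → ℝ} (h : IsTest φ) : ∃ L, Nice L φ := by
  obtain ⟨C, hC⟩ := h.smooth.lipschitzWith_of_hasCompactSupport h.cpt (by simp)
  obtain ⟨D, hD⟩ := h.cpt.exists_bound_of_continuous h.smooth.continuous
  refine ⟨max C D, h.smooth, ?_, ?_, ?_⟩
  · intro x y _ _
    have := hC.dist_le_mul x y
    rw [Real.dist_eq, Real.dist_eq] at this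
    refine this.trans ?_
    gcongr
    exact le_max_left _ _
  · intro x _
    exact (hD x).trans (le_max_right _ _)
  · by_contra h0
    have := h.supp (subset_tsupport φ h0)
    simp at this

lemma ae_pos {μ : Measure ℝ} (h : μ (Iic 0) = 0) : ∀ᵐ x ∂μ, 0 < x := by
  rw [ae_iff]
  convert h using 2
  ext x; simp

lemma ae_pos_prod {μ : Measure ℝ} [IsFiniteMeasure μ] (h : ∀ᵐ x ∂μ, 0 < x) :
    ∀ᵐ p ∂(μ.prod μ), 0 < p.1 ∧ 0 < p.2 :=
  (Measure.quasiMeasurePreserving_fst.ae h).and (Measure.quasiMeasurePreserving_snd.ae h)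

lemma integrable_id {μ : Measure ℝ} (h : ∀ᵐ x ∂μ, 0 < x) (hm : mass μ ≠ ⊤) :
    Integrable (fun x => x) μ := by
  refine ⟨by fun_prop, ?_⟩
  rw [hasFiniteIntegral_iff_ofReal (h.mono fun x hx => hx.le)]
  exact lt_top_iff_ne_top.2 hm

lemma mass_eq {μ : Measure ℝ} (h : ∀ᵐ x ∂μ, 0 < x) (hi : Integrable (fun x => x) μ) :
    mass μ = ENNReal.ofReal (∫ x, x ∂μ) := by
  rw [mass, ofReal_integral_eq_lintegral_ofReal hi (h.mono fun x hx => hx.le)]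

lemma M_eq {μ : Measure ℝ} (h : ∀ᵐ x ∂μ, 0 < x) (hm : mass μ ≠ ⊤) :
    M μ = ∫ x, x ∂μ := by
  rw [M, mass_eq h (integrable_id h hm), ENNReal.toReal_ofReal]
  exact integral_nonneg_of_ae (h.mono fun x hx => hx.le)

lemma M_nonneg (μ : Measure ℝ) : 0 ≤ M μ := ENNReal.toReal_nonneg

lemma integrable_of_bdd {μ : Measure ℝ} [IsFiniteMeasure μ] (h : ∀ᵐ x ∂μ, 0 < x) {f : ℝ → ℝ}
    (hf : Continuous f) (L : ℝ) (hb : ∀ x, 0 ≤ x → |f x| ≤ L) : Integrable f μ :=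
  Integrable.of_bound hf.aestronglyMeasurable L (h.mono fun x hx => hb x hx.le)

lemma Nice.integrable {μ : Measure ℝ} [IsFiniteMeasure μ] (h : ∀ᵐ x ∂μ, 0 < x) {f : ℝ → ℝ} {L : ℝ}
    (hf : Nice L f) : Integrable f μ := integrable_of_bdd h hf.smooth.continuous L hf.bdd

lemma integrable_min {μ : Measure ℝ} [IsFiniteMeasure μ] (h : ∀ᵐ x ∂μ, 0 < x) :
    Integrable (fun x => min x 1) μ :=
  integrable_of_bdd h (by fun_prop) 1 (fun x hx => by
    rw [abs_of_nonneg (le_min hx zero_le_one)]; exact min_le_right _ _)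

lemma integrable_exp {μ : Measure ℝ} [IsFiniteMeasure μ] (h : ∀ᵐ x ∂μ, 0 < x) :
    Integrable (fun x => 1 - Real.exp (-x)) μ :=
  integrable_of_bdd h (by fun_prop) 1 (fun x hx => by
    have h1 : Real.exp (-x) ≤ 1 := Real.exp_le_one_iff.2 (by linarith)
    have h2 := Real.exp_pos (-x)
    rw [abs_of_nonneg (by linarith)]; linarith)

lemma min_le_exp {x : ℝ} (hx : 0 ≤ x) : min x 1 ≤ 2 * (1 - Real.exp (-x)) := by
  have h1 : Real.exp (-x) * (1 + x) ≤ 1 := by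
    have := Real.add_one_le_exp x
    have h3 : Real.exp (-x) * Real.exp x = 1 := by rw [← Real.exp_add]; simp
    have := Real.exp_pos (-x)
    nlinarith
  rcases le_total x 1 with h | h
  · rw [min_eq_left h]
    have := Real.exp_pos (-x)
    nlinarith
  · rw [min_eq_right h]
    have := Real.exp_pos (-x)
    nlinarith

lemma w_le_E {μ : Measure ℝ} [IsFiniteMeasure μ] (h : ∀ᵐ x ∂μ, 0 < x) :
    ∫ x, min x 1 ∂μ ≤ 2 * E μ := by
  rw [E, ← integral_const_mul]
  exact integral_mono_ae (integrable_min h) ((integrable_exp h).const_mul 2)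
    (h.mono fun x hx => min_le_exp hx.le)

lemma w_nonneg {μ : Measure ℝ} (h : ∀ᵐ x ∂μ, 0 < x) :
    0 ≤ ∫ x, min x 1 ∂μ :=
  integral_nonneg_of_ae (h.mono fun x hx => le_min hx.le zero_le_one)

lemma E_nonneg {μ : Measure ℝ} (h : ∀ᵐ x ∂μ, 0 < x) : 0 ≤ E μ :=
  integral_nonneg_of_ae (h.mono fun x hx => by
    have : Real.exp (-x) ≤ 1 := Real.exp_le_one_iff.2 (by linarith)
    simpa using this)

lemma gk_bound {L : ℝ} {f : ℝ → ℝ} (hf : Nice L f) {x y : ℝ} (hx : 0 < x) (hy : 0 < y) :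
    |gk f (x, y)| ≤ 4 * L * (min x 1 * y + x * min y 1) := by
  have hL := hf.L_nonneg
  unfold gk
  simp only
  rw [abs_mul, abs_of_pos (add_pos hx hy)]
  have b : ∀ x y, 0 < x → 0 < y → |f (x + y) - f x - f y| ≤ 3 * L * min y 1 := by
    intro x y hx hy
    have h1 := hf.lip (x + y) x (by positivity) hx.le
    have h2 := hf.bdd (x + y) (by positivity)
    have h3 := hf.bdd x hx.le
    have h4 := hf.bdd y hy.le
    have h5 := hf.le_mul hy.le
    rw [show x + y - x = y by ring, abs_of_pos hy] at h1
    rcases le_total y 1 with h | h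
    · rw [min_eq_left h]
      calc _ ≤ |f (x + y) - f x| + |f y| := abs_sub _ _
        _ ≤ _ := by nlinarith [mul_nonneg hL hy.le]
    · rw [min_eq_right h]
      calc _ ≤ |f (x + y) - f x| + |f y| := abs_sub _ _
        _ ≤ |f (x + y)| + |f x| + |f y| := by gcongr; exact abs_sub _ _
        _ ≤ _ := by linarith
  have b' : ∀ x y, 0 < x → 0 < y → |f (x + y) - f x - f y| ≤ 2 * L * min y 1 ∨
     |f (x + y) - f x - f y| ≤ 3 * L * min y 1 := fun x y hx hy => Or.inr (b x y hx hy)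
  have h1 := b x y hx hy
  have h2 := b y x hy hx
  rw [add_comm y x, show f (x + y) - f y - f x = f (x + y) - f x - f y by ring] at h2
  have e1 : 0 < min x 1 := lt_min hx one_pos
  have e2 : 0 < min y 1 := lt_min hy one_pos
  nlinarith [mul_le_mul_of_nonneg_left h1 hx.le, mul_le_mul_of_nonneg_left h2 hy.le,
    mul_nonneg hL (mul_pos e1 hy).le, mul_nonneg hL (mul_pos hx e2).le]

lemma integrable_dom {μ : Measure ℝ} [IsFiniteMeasure μ] (h : ∀ᵐ x ∂μ, 0 < x) (hm : mass μ ≠ ⊤) :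
    Integrable (fun p : ℝ × ℝ => min p.1 1 * p.2 + p.1 * min p.2 1) (μ.prod μ) :=
  ((integrable_min h).mul_prod (integrable_id h hm)).add
    ((integrable_id h hm).mul_prod (integrable_min h))

lemma integral_dom {μ : Measure ℝ} [IsFiniteMeasure μ] (h : ∀ᵐ x ∂μ, 0 < x) (hm : mass μ ≠ ⊤) :
    ∫ p : ℝ × ℝ, (min p.1 1 * p.2 + p.1 * min p.2 1) ∂(μ.prod μ)
      = 2 * (∫ x, min x 1 ∂μ) * M μ := by
  rw [integral_add ((integrable_min h).mul_prod (integrable_id h hm))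
    ((integrable_id h hm).mul_prod (integrable_min h)),
    integral_prod_mul (fun x => min x 1) (fun y : ℝ => y),
    integral_prod_mul (fun y : ℝ => y) (fun x => min x 1), M_eq h hm]
  ring

lemma gk_cont {f : ℝ → ℝ} (hf : Continuous f) : Continuous (gk f) := by
  unfold gk; fun_prop

lemma gk_ae_bound {μ : Measure ℝ} [IsFiniteMeasure μ] (h : ∀ᵐ x ∂μ, 0 < x) {L : ℝ} {f : ℝ → ℝ}
    (hf : Nice L f) : ∀ᵐ p ∂(μ.prod μ),
      ‖gk f p‖ ≤ 4 * L * (min p.1 1 * p.2 + p.1 * min p.2 1) := by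
  filter_upwards [ae_pos_prod h] with p hp
  exact gk_bound hf hp.1 hp.2

lemma gk_integrable {μ : Measure ℝ} [IsFiniteMeasure μ] (h : ∀ᵐ x ∂μ, 0 < x) (hm : mass μ ≠ ⊤)
    {L : ℝ} {f : ℝ → ℝ} (hf : Nice L f) : Integrable (gk f) (μ.prod μ) :=
  ((integrable_dom h hm).const_mul (4 * L)).mono'
    (gk_cont hf.smooth.continuous).aestronglyMeasurable (gk_ae_bound h hf)

lemma Q_bound {μ : Measure ℝ} [IsFiniteMeasure μ] (h : ∀ᵐ x ∂μ, 0 < x) (hm : mass μ ≠ ⊤)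
    {L : ℝ} {f : ℝ → ℝ} (hf : Nice L f) : |Q μ f| ≤ 8 * L * E μ * M μ := by
  have := norm_integral_le_of_norm_le ((integrable_dom h hm).const_mul (4 * L)) (gk_ae_bound h hf)
  rw [integral_const_mul, integral_dom h hm, Real.norm_eq_abs] at this
  rw [Q, abs_mul, abs_of_pos (by norm_num : (0:ℝ) < 1 / 2)]
  have h2 := w_le_E h
  have := mul_nonneg hf.L_nonneg (M_nonneg μ)
  nlinarith

lemma Q_iter {μ : Measure ℝ} [IsFiniteMeasure μ] (h : ∀ᵐ x ∂μ, 0 < x) (hm : mass μ ≠ ⊤)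
    {L : ℝ} {f : ℝ → ℝ} (hf : Nice L f) :
    (1 / 2) * ∫ x, ∫ y, (f (x + y) - f x - f y) * (x + y) ∂μ ∂μ = Q μ f := by
  rw [Q, integral_prod _ (gk_integrable h hm hf)]
  rfl

lemma Q_tendsto {μ : Measure ℝ} [IsFiniteMeasure μ] (h : ∀ᵐ x ∂μ, 0 < x) (hm : mass μ ≠ ⊤)
    {L : ℝ} {f : ℝ → ℝ} {g : ℕ → ℝ → ℝ} (hg : ∀ k, Nice L (g k))
    (hlim : ∀ x, 0 < x → Tendsto (fun k => g k x) atTop (𝓝 (f x))) :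
    Tendsto (fun k => Q μ (g k)) atTop (𝓝 (Q μ f)) := by
  unfold Q
  apply Tendsto.const_mul
  apply tendsto_integral_of_dominated_convergence _
    (fun k => (gk_cont (hg k).smooth.continuous).aestronglyMeasurable)
    ((integrable_dom h hm).const_mul (4 * L)) (fun k => gk_ae_bound h (hg k))
  filter_upwards [ae_pos_prod h] with p hp
  unfold gk
  exact ((((hlim _ (add_pos hp.1 hp.2)).sub (hlim _ hp.1)).sub (hlim _ hp.2)).mul_const _)

lemma Q_upper {μ : Measure ℝ} [IsFiniteMeasure μ] (h : ∀ᵐ x ∂μ, 0 < x) (hm : mass μ ≠ ⊤)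
    {L R : ℝ} {f : ℝ → ℝ} (hf : Nice L f) (h0 : ∀ x, 0 ≤ x → 0 ≤ f x) (hR : 1 ≤ R)
    (hs : ∀ x, R ≤ x → f x = 0) :
    Q μ f ≤ 12 * L * R ^ 2 * (E μ) ^ 2 - (∫ x, f x ∂μ) * M μ := by
  have hL := hf.L_nonneg
  have hpt : ∀ x y, 0 < x → 0 < y →
      gk f (x, y) ≤ 6 * L * R ^ 2 * (min x 1 * min y 1) - (f x * y + x * f y) := by
    intro x y hx hy
    have e1 : 0 < min x 1 := lt_min hx one_pos
    have e2 : 0 < min y 1 := lt_min hy one_pos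
    have fx := h0 x hx.le
    have fy := h0 y hy.le
    unfold gk
    simp only
    rcases le_total R (x + y) with hxy | hxy
    · rw [hs _ hxy]
      have : 0 ≤ 6 * L * R ^ 2 * (min x 1 * min y 1) := by positivity
      nlinarith [mul_nonneg fx hx.le, mul_nonneg fy hy.le]
    · have hx1 : x ≤ R * min x 1 := by
        rcases le_total x 1 with h | h
        · rw [min_eq_left h]; nlinarith
        · rw [min_eq_right h]; linarith
      have hy1 : y ≤ R * min y 1 := by
        rcases le_total y 1 with h | h
        · rw [min_eq_left h]; nlinarith
        · rw [min_eq_right h]; linarith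
      have hxyR : x * y ≤ R ^ 2 * (min x 1 * min y 1) := by
        calc x * y ≤ (R * min x 1) * (R * min y 1) := by gcongr
          _ = _ := by ring
      have hLx : f x ≤ L * x := (le_abs_self _).trans (hf.le_mul hx.le)
      have hLy : f y ≤ L * y := (le_abs_self _).trans (hf.le_mul hy.le)
      have l1 := (le_abs_self _).trans (hf.lip (x + y) x (by positivity) hx.le)
      have l2 := (le_abs_self _).trans (hf.lip (x + y) y (by positivity) hy.le)
      rw [show x + y - x = y by ring, abs_of_pos hy] at l1
      rw [show x + y - y = x by ring, abs_of_pos hx] at l2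
      have l1' := mul_le_mul_of_nonneg_left (show f (x+y) - f x - f y ≤ L * y by linarith) hx.le
      have l2' := mul_le_mul_of_nonneg_left (show f (x+y) - f x - f y ≤ L * x by linarith) hy.le
      have k1 := mul_le_mul_of_nonneg_right hLx hy.le
      have k2 := mul_le_mul_of_nonneg_right hLy hx.le
      have := mul_le_mul_of_nonneg_left hxyR hL
      nlinarith [mul_pos hx hy, mul_nonneg hL (mul_pos hx hy).le, mul_nonneg hL (mul_nonneg (sq_nonneg R) (mul_pos e1 e2).le)]
  have i1 := (integrable_min h).mul_prod (integrable_min h)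
  have i2 := (hf.integrable h).mul_prod (integrable_id h hm)
  have i3 := (integrable_id h hm).mul_prod (hf.integrable h)
  have i23 : Integrable (fun p : ℝ × ℝ => f p.1 * p.2 + p.1 * f p.2) (μ.prod μ) := i2.add i3
  have key : ∫ p, gk f p ∂(μ.prod μ) ≤
      ∫ p : ℝ × ℝ, (6 * L * R ^ 2 * (min p.1 1 * min p.2 1) - (f p.1 * p.2 + p.1 * f p.2)) ∂(μ.prod μ) := by
    apply integral_mono_ae (gk_integrable h hm hf) ((i1.const_mul _).sub (i2.add i3))
    filter_upwards [ae_pos_prod h] with p hp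
    exact hpt p.1 p.2 hp.1 hp.2
  rw [integral_sub (i1.const_mul _) i23, integral_const_mul, integral_add i2 i3,
    integral_prod_mul f (fun y : ℝ => y), integral_prod_mul (fun y : ℝ => y) f,
    integral_prod_mul (fun x : ℝ => min x 1) (fun x : ℝ => min x 1), ← M_eq h hm] at key
  have h2 := w_le_E h
  have h3 := w_nonneg h
  have h4 : (∫ x, min x 1 ∂μ) * (∫ x, min x 1 ∂μ) ≤ 4 * (E μ) ^ 2 := by nlinarith
  have h5 := mul_le_mul_of_nonneg_left h4 (show 0 ≤ 6 * L * R ^ 2 by positivity)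
  unfold Q
  nlinarith

/-- The junk value: if the mass is infinite the iterated integral vanishes for `φ ≥ 0` with
positive integral. -/
lemma junk {μ : Measure ℝ} [IsFiniteMeasure μ] (h : ∀ᵐ x ∂μ, 0 < x) (hm : mass μ = ⊤)
    {φ : ℝ → ℝ} (hφ : IsTest φ) (hF : 0 < ∫ x, φ x ∂μ) :
    ∫ x, ∫ y, (φ (x + y) - φ x - φ y) * (x + y) ∂μ ∂μ = 0 := by
  obtain ⟨L, hn⟩ := hφ.nice
  obtain ⟨R, hR⟩ := hφ.cpt.isBounded.subset_closedBall 0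
  have hz : ∀ x, |R| < x → φ x = 0 := by
    intro x hx
    by_contra hne
    have := hR (subset_tsupport φ hne)
    simp only [Metric.mem_closedBall, dist_zero_right, Real.norm_eq_abs] at this
    linarith [le_abs_self x, le_abs_self R]
  apply integral_undef
  intro hi
  have hyi : Integrable (fun y => y * φ y) μ := by
    apply integrable_of_bdd h (by have := hφ.smooth.continuous; fun_prop) (|R| * L)
    intro x hx
    rcases le_or_gt x |R| with hx' | hx'
    · rw [abs_mul, abs_of_nonneg hx]
      have := hn.bdd x hx
      have := hn.L_nonneg
      gcongr
    · rw [hz x hx']; simp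
      have := hn.L_nonneg
      positivity
  have hfi := hn.integrable h
  set F := ∫ x, φ x ∂μ
  set D := ∫ x, x * φ x ∂μ
  have hG : ∀ x, |R| < x → ∫ y, (φ (x + y) - φ x - φ y) * (x + y) ∂μ = - (x * F + D) := by
    intro x hx
    have : (fun y => (φ (x + y) - φ x - φ y) * (x + y)) =ᵐ[μ] fun y => - (x * φ y + y * φ y) := by
      filter_upwards [h] with y hy
      rw [hz x hx, hz (x + y) (by linarith)]; ring
    rw [integral_congr_ae this, integral_neg, integral_add (hfi.const_mul x) hyi,
      integral_const_mul]
  have hid : Integrable (fun x => x) μ := by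
    refine ((hi.norm.add (integrable_const (|D|))).div_const F |>.add (integrable_const (|R|))).mono' 
      (by fun_prop) ?_
    filter_upwards [h] with x hx
    simp only [Pi.add_apply, Real.norm_eq_abs]
    rw [abs_of_pos hx]
    rcases le_or_gt x |R| with hx' | hx'
    · have : 0 ≤ (|∫ y, (φ (x + y) - φ x - φ y) * (x + y) ∂μ| + |D|) / F := by positivity
      linarith
    · rw [hG x hx', abs_neg]
      have : x ≤ (|x * F + D| + |D|) / F := by
        rw [le_div_iff₀ hF]
        have := le_abs_self (x * F + D)
        have := neg_abs_le D
        linarith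
      linarith [abs_nonneg R]
  rw [mass_eq h hid] at hm
  exact ENNReal.ofReal_ne_top hm

lemma nice_exp {s : ℝ} (hs : 0 < s) : Nice (max s 1) (fun x => 1 - Real.exp (-(s * x))) := by
  have hexp : ∀ x y, 0 ≤ x → x ≤ y →
      |(1 - Real.exp (-(s * x))) - (1 - Real.exp (-(s * y)))| ≤ s * |x - y| := by
    intro x y hx hxy
    have h1 : Real.exp (-(s * y)) ≤ Real.exp (-(s * x)) := Real.exp_le_exp.2 (by nlinarith)
    have h2 : Real.exp (-(s * x)) ≤ 1 := Real.exp_le_one_iff.2 (by nlinarith)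
    have h3 := Real.add_one_le_exp (-(s * (y - x)))
    have h4 : Real.exp (-(s * y)) = Real.exp (-(s * x)) * Real.exp (-(s * (y - x))) := by
      rw [← Real.exp_add]; congr 1; ring
    have h5 := Real.exp_pos (-(s * x))
    rw [abs_of_nonpos (by linarith), abs_of_nonpos (by linarith)]
    have : 0 ≤ s * (y - x) := by apply mul_nonneg hs.le; linarith
    nlinarith
  refine ⟨by fun_prop, ?_, ?_, by simp⟩
  · intro x y hx hy
    have : s * |x - y| ≤ max s 1 * |x - y| := by gcongr; exact le_max_left _ _
    refine le_trans ?_ this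
    rcases le_total x y with hxy | hxy
    · exact hexp x y hx hxy
    · rw [abs_sub_comm, abs_sub_comm x y]; exact hexp y x hy hxy
  · intro x hx
    have h2 : Real.exp (-(s * x)) ≤ 1 := Real.exp_le_one_iff.2 (by nlinarith)
    have h5 := Real.exp_pos (-(s * x))
    rw [abs_of_nonneg (by linarith)]
    linarith [le_max_right s 1]

lemma Q_exp {μ : Measure ℝ} [IsFiniteMeasure μ] (h : ∀ᵐ x ∂μ, 0 < x) (hm : mass μ ≠ ⊤)
    {s : ℝ} (hs : 0 < s) : Q μ (fun x => 1 - Real.exp (-(s * x)))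
      = - ((∫ x, (1 - Real.exp (-(s * x))) ∂μ) * ∫ x, x * (1 - Real.exp (-(s * x))) ∂μ) := by
  have hi := (nice_exp hs).integrable h
  have hxi : Integrable (fun x => x * (1 - Real.exp (-(s * x)))) μ := by
    refine (integrable_id h hm).mono (by fun_prop) ?_
    filter_upwards [h] with x hx
    have h2 : Real.exp (-(s * x)) ≤ 1 := Real.exp_le_one_iff.2 (by nlinarith)
    have h5 := Real.exp_pos (-(s * x))
    rw [norm_mul]
    apply mul_le_of_le_one_right (norm_nonneg _)
    rw [Real.norm_eq_abs, abs_of_nonneg (by linarith)]; linarith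
  set f : ℝ → ℝ := fun x => 1 - Real.exp (-(s * x)) with hf
  have : gk f = fun p => - (f p.1 * (p.2 * f p.2) + (p.1 * f p.1) * f p.2) := by
    funext p
    simp only [gk, hf]
    have : Real.exp (-(s * (p.1 + p.2))) = Real.exp (-(s * p.1)) * Real.exp (-(s * p.2)) := by
      rw [← Real.exp_add]; congr 1; ring
    rw [this]; ring
  rw [Q, this, integral_neg, integral_add (hi.mul_prod hxi) (hxi.mul_prod hi),
    integral_prod_mul f (fun x => x * f x), integral_prod_mul (fun x => x * f x) f]
  ring

end AK
end

section
open MeasureTheory Set Filter Topology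
namespace AK

/-! ### Time evolution -/

structure Sol (n : ℝ → Measure ℝ) : Prop where
  fin : ∀ t, 0 ≤ t → IsFiniteMeasure (n t)
  pos : ∀ t, 0 ≤ t → ∀ᵐ x ∂(n t), 0 < x
  weak : ∀ φ, IsTest φ → ∀ t, 0 ≤ t → HasDerivWithinAt (fun r => ∫ x, φ x ∂(n r))
      ((1 / 2) * ∫ x, ∫ y, (φ (x + y) - φ x - φ y) * (x + y) ∂(n t) ∂(n t)) (Ici 0) t

open Classical in
noncomputable def q (n : ℝ → Measure ℝ) (f : ℝ → ℝ) (t : ℝ) : ℝ :=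
  if mass (n t) = ⊤ then 0 else Q (n t) f

lemma Sol.cont {n : ℝ → Measure ℝ} (S : Sol n) {φ : ℝ → ℝ} (hφ : IsTest φ) :
    ContinuousOn (fun r => ∫ x, φ x ∂(n r)) (Ici 0) :=
  fun t ht => (S.weak φ hφ t ht).continuousWithinAt

lemma Sol.deriv {n : ℝ → Measure ℝ} (S : Sol n) {φ : ℝ → ℝ} (hφ : IsTest φ) {t : ℝ} (ht : 0 < t)
    (h : (∀ x, 0 ≤ x → 0 ≤ φ x) ∨ mass (n t) ≠ ⊤) :
    HasDerivAt (fun r => ∫ x, φ x ∂(n r)) (q n φ t) t := by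
  have hd := (S.weak φ hφ t ht.le).hasDerivAt (Ici_mem_nhds ht)
  have := S.fin t ht.le
  have hp := S.pos t ht.le
  by_cases hm : mass (n t) = ⊤
  · have h0 : ∀ x, 0 ≤ x → 0 ≤ φ x := by
      rcases h with h | h
      · exact h
      · exact absurd hm h
    have hq : q n φ t = 0 := by simp [q, hm]
    rw [hq]
    have hnn : ∀ r, 0 ≤ r → 0 ≤ ∫ x, φ x ∂(n r) := fun r hr =>
      integral_nonneg_of_ae ((S.pos r hr).mono fun x hx => h0 x hx.le)
    rcases (hnn t ht.le).lt_or_eq with hF | hF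
    · rwa [junk hp hm hφ hF, mul_zero] at hd
    · have hmin : IsLocalMin (fun r => ∫ x, φ x ∂(n r)) t := by
        filter_upwards [Ici_mem_nhds ht] with r hr
        rw [← hF]; exact hnn r hr
      have := hmin.hasDerivAt_eq_zero hd
      rwa [this] at hd
  · obtain ⟨L, hL⟩ := hφ.nice
    have hq : q n φ t = Q (n t) φ := by simp [q, hm]
    rw [hq, ← Q_iter hp hm hL]
    exact hd

lemma q_bound {n : ℝ → Measure ℝ} (S : Sol n) {L : ℝ} {f : ℝ → ℝ} (hf : Nice L f) {t W : ℝ}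
    (ht : 0 ≤ t) (hW : E (n t) ≤ W) : |q n f t| ≤ 8 * L * W * M (n t) := by
  have := S.fin t ht
  have h0 := hf.L_nonneg
  have hM := M_nonneg (n t)
  have hE := E_nonneg (S.pos t ht)
  by_cases hm : mass (n t) = ⊤
  · simp only [q, hm, if_true, abs_zero]
    have : 0 ≤ W := hE.trans hW
    positivity
  · simp only [q, hm, if_false]
    refine (Q_bound (S.pos t ht) hm hf).trans ?_
    gcongr

lemma int_cut_tendsto {μ : Measure ℝ} [IsFiniteMeasure μ] (h : ∀ᵐ x ∂μ, 0 < x) {L : ℝ} {f : ℝ → ℝ}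
    (hf : Nice L f) :
    Tendsto (fun k => ∫ x, f x * cut k x ∂μ) atTop (𝓝 (∫ x, f x ∂μ)) := by
  have hc := hf.smooth.continuous
  apply tendsto_integral_of_dominated_convergence (fun _ => L)
  · intro k
    exact (hc.mul (cut_smooth k).continuous).aestronglyMeasurable
  · exact integrable_const _
  · intro k
    filter_upwards [h] with x hx
    rw [norm_mul, Real.norm_eq_abs, Real.norm_eq_abs, abs_of_nonneg (cut_nonneg _ _)]
    calc _ ≤ |f x| * 1 := by gcongr; exact cut_le_one _ _
      _ ≤ L := by rw [mul_one]; exact hf.bdd x hx.le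
  · filter_upwards [h] with x hx
    apply tendsto_const_nhds.congr'
    filter_upwards [cut_tendsto hx] with k hk
    rw [hk, mul_one]

/-- Integrated weak form for Lipschitz bounded test functions. -/
lemma Sol.wf {n : ℝ → Measure ℝ} (S : Sol n) {c d W : ℝ} (hc : 0 ≤ c) (hcd : c ≤ d)
    (hW : ∀ t ∈ Icc c d, E (n t) ≤ W) (hM : IntegrableOn (fun t => M (n t)) (Icc c d))
    {L : ℝ} {f : ℝ → ℝ} (hf : Nice L f)
    (h : (∀ x, 0 ≤ x → 0 ≤ f x) ∨ ∀ t ∈ Icc c d, mass (n t) ≠ ⊤) :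
    (∫ x, f x ∂(n d)) - ∫ x, f x ∂(n c) = ∫ t in c..d, q n f t := by
  obtain ⟨C, hC, hcut⟩ := nice_cut
  set g : ℕ → ℝ → ℝ := fun k x => f x * cut k x with hg
  have hgT : ∀ k, IsTest (g k) := fun k => isTest_cut hf.smooth k
  have hgN : ∀ k, Nice (C * L) (g k) := fun k => hcut L f hf k
  have hder : ∀ k, ∀ t ∈ Ioo c d, HasDerivAt (fun r => ∫ x, g k x ∂(n r)) (q n (g k) t) t := by
    intro k t ht
    apply S.deriv (hgT k) (hc.trans_lt ht.1)
    rcases h with h | h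
    · exact Or.inl fun x hx => mul_nonneg (h x hx) (cut_nonneg _ _)
    · exact Or.inr (h t (Ioo_subset_Icc_self ht))
  have hmeas : ∀ k, AEStronglyMeasurable (q n (g k)) (volume.restrict (Ioc c d)) := by
    intro k
    rw [← restrict_Ioo_eq_restrict_Ioc]
    have := (measurable_deriv (fun r => ∫ x, g k x ∂(n r))).aestronglyMeasurable
      (μ := volume.restrict (Ioo c d))
    refine this.congr ?_
    filter_upwards [ae_restrict_mem measurableSet_Ioo] with t ht
    exact (hder k t ht).deriv
  have hbound : ∀ k, ∀ t ∈ Icc c d, ‖q n (g k) t‖ ≤ 8 * (C * L) * W * M (n t) := fun k t ht =>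
    q_bound S (hgN k) (hc.trans ht.1) (hW t ht)
  have hMi : IntegrableOn (fun t => 8 * (C * L) * W * M (n t)) (Ioc c d) :=
    (hM.mono_set Ioc_subset_Icc_self).const_mul _
  have hii : ∀ k, IntervalIntegrable (q n (g k)) volume c d := by
    intro k
    rw [intervalIntegrable_iff_integrableOn_Ioc_of_le hcd]
    refine hMi.mono' (hmeas k) ?_
    filter_upwards [ae_restrict_mem measurableSet_Ioc] with t ht
    exact hbound k t (Ioc_subset_Icc_self ht)
  have hftc : ∀ k, ∫ t in c..d, q n (g k) t = (∫ x, g k x ∂(n d)) - ∫ x, g k x ∂(n c) := by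
    intro k
    exact intervalIntegral.integral_eq_sub_of_hasDerivAt_of_le hcd
      ((S.cont (hgT k)).mono fun t ht => hc.trans ht.1) (hder k) (hii k)
  have := S.fin c hc
  have := S.fin d (hc.trans hcd)
  have l1 := (int_cut_tendsto (S.pos d (hc.trans hcd)) hf).sub (int_cut_tendsto (S.pos c hc) hf)
  have l2 : Tendsto (fun k => ∫ t in c..d, q n (g k) t) atTop (𝓝 (∫ t in c..d, q n f t)) := by
    simp only [intervalIntegral.integral_of_le hcd]
    apply tendsto_integral_of_dominated_convergence _ hmeas hMi
    · intro k
      filter_upwards [ae_restrict_mem measurableSet_Ioc] with t ht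
      exact hbound k t (Ioc_subset_Icc_self ht)
    · filter_upwards [ae_restrict_mem measurableSet_Ioc] with t ht
      have ht0 : 0 ≤ t := hc.trans ht.1.le
      by_cases hm : mass (n t) = ⊤
      · simp [q, hm]
      · simp only [q, hm, if_false]
        have := S.fin t ht0
        apply Q_tendsto (S.pos t ht0) hm hgN
        intro x hx
        apply tendsto_const_nhds.congr'
        filter_upwards [cut_tendsto hx] with k hk
        simp [hg, hk]
  simp only [hftc] at l2
  exact tendsto_nhds_unique l1 l2

/-- approximations of the mass -/
lemma mass_tendsto {μ : Measure ℝ} (h : ∀ᵐ x ∂μ, 0 < x) {g : ℕ → ℝ → ℝ}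
    (hg : ∀ k, Measurable (g k)) (hle : ∀ k x, 0 < x → g k x ≤ x)
    (hlim : ∀ x, 0 < x → Tendsto (fun k => g k x) atTop (𝓝 x)) :
    Tendsto (fun k => ∫⁻ x, ENNReal.ofReal (g k x) ∂μ) atTop (𝓝 (mass μ)) := by
  have h1 : mass μ ≤ liminf (fun k => ∫⁻ x, ENNReal.ofReal (g k x) ∂μ) atTop := by
    refine le_trans ?_ (lintegral_liminf_le fun k => (hg k).ennreal_ofReal)
    apply le_of_eq
    apply lintegral_congr_ae
    filter_upwards [h] with x hx
    exact ((ENNReal.continuous_ofReal.tendsto x).comp (hlim x hx)).liminf_eq.symm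
  have h2 : ∀ k, ∫⁻ x, ENNReal.ofReal (g k x) ∂μ ≤ mass μ := fun k =>
    lintegral_mono_ae (h.mono fun x hx => ENNReal.ofReal_le_ofReal (hle k x hx))
  exact tendsto_of_le_liminf_of_limsup_le h1
    (limsup_le_of_le (h := Eventually.of_forall h2))

lemma mass_tendsto_cut {n : ℝ → Measure ℝ} (S : Sol n) {t : ℝ} (ht : 0 ≤ t) :
    Tendsto (fun k => ENNReal.ofReal (∫ x, x * cut k x ∂(n t))) atTop (𝓝 (mass (n t))) := by
  have := S.fin t ht
  have := mass_tendsto (S.pos t ht) (g := fun k x => x * cut k x)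
    (fun k => (continuous_id.mul (cut_smooth k).continuous).measurable)
    (fun k x hx => mul_le_of_le_one_right hx.le (cut_le_one _ _))
    (fun x hx => by
      apply tendsto_const_nhds.congr'
      filter_upwards [cut_tendsto hx] with k hk
      simp [hk])
  refine this.congr fun k => ?_
  obtain ⟨L, hL⟩ := (isTest_cut (f := fun x => x) contDiff_id k).nice
  rw [ofReal_integral_eq_lintegral_ofReal (hL.integrable (S.pos t ht))]
  filter_upwards [S.pos t ht] with x hx
  exact mul_nonneg hx.le (cut_nonneg _ _)

lemma mass_aemeas {n : ℝ → Measure ℝ} (S : Sol n) {c d : ℝ} (hc : 0 ≤ c) :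
    AEMeasurable (fun t => mass (n t)) (volume.restrict (Icc c d)) := by
  apply aemeasurable_of_tendsto_metrizable_ae atTop
    (f := fun k t => ENNReal.ofReal (∫ x, x * cut k x ∂(n t)))
  · intro k
    exact (((S.cont (isTest_cut (f := fun x => x) contDiff_id k)).mono
      (fun t ht => hc.trans ht.1)).aemeasurable measurableSet_Icc).ennreal_ofReal
  · filter_upwards [ae_restrict_mem measurableSet_Icc] with t ht
    exact mass_tendsto_cut S (hc.trans ht.1)

lemma M_integrable {n : ℝ → Measure ℝ} (S : Sol n) {c d W δ : ℝ} (hc : 0 ≤ c)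
    (hW : ∀ t ∈ Icc c d, E (n t) ≤ W) {φ : ℝ → ℝ} (hφ : IsTest φ) (h0 : ∀ x, 0 ≤ x → 0 ≤ φ x)
    (hδ : 0 < δ) (hF : ∀ t ∈ Icc c d, δ ≤ ∫ x, φ x ∂(n t)) :
    IntegrableOn (fun t => M (n t)) (Icc c d) := by
  obtain ⟨L, hL⟩ := hφ.nice
  obtain ⟨R, hR⟩ := hφ.cpt.isBounded.subset_closedBall 0
  set R' := max (|R| + 1) 1
  have hs : ∀ x, R' ≤ x → φ x = 0 := by
    intro x hx
    by_contra hne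
    have := hR (subset_tsupport φ hne)
    simp only [Metric.mem_closedBall, dist_zero_right, Real.norm_eq_abs] at this
    linarith [le_abs_self x, le_abs_self R, le_max_left (|R| + 1) 1]
  set D := 12 * L * R' ^ 2 * W ^ 2
  have hL0 := hL.L_nonneg
  have hup : ∀ t ∈ Icc c d, δ * M (n t) ≤ D - q n φ t := by
    intro t ht
    have ht0 := hc.trans ht.1
    have := S.fin t ht0
    have hE0 := E_nonneg (S.pos t ht0)
    have hE := hW t ht
    by_cases hm : mass (n t) = ⊤
    · simp only [M, q, hm, if_true]
      simp; positivity
    · simp only [q, hm, if_false]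
      have := Q_upper (S.pos t ht0) hm hL h0 (le_max_right (|R| + 1) 1) hs
      have h1 : 12 * L * R' ^ 2 * (E (n t)) ^ 2 ≤ D := by
        simp only [D]; gcongr
      have h2 := mul_le_mul_of_nonneg_right (hF t ht) (M_nonneg (n t))
      linarith
  have hder : ∀ t ∈ Ioo c d, HasDerivAt (fun r => D * r - ∫ x, φ x ∂(n r)) (D - q n φ t) t := by
    intro t ht
    have h1 := S.deriv hφ (hc.trans_lt ht.1) (Or.inl h0)
    have h2 : HasDerivAt (fun r => D * r - ∫ x, φ x ∂(n r)) (D * 1 - q n φ t) t :=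
      ((hasDerivAt_id t).const_mul D).sub h1
    rwa [mul_one] at h2
  have hint : IntegrableOn (fun t => D - q n φ t) (Ioc c d) := by
    apply intervalIntegral.integrableOn_deriv_of_nonneg _ hder
    · intro t ht
      exact le_trans (mul_nonneg hδ.le (M_nonneg _)) (hup t (Ioo_subset_Icc_self ht))
    · exact (continuousOn_const.mul continuousOn_id).sub ((S.cont hφ).mono fun t ht => hc.trans ht.1)
  rw [integrableOn_Icc_iff_integrableOn_Ioc]
  refine (hint.const_mul (1 / δ)).mono' ?_ ?_
  · exact ((mass_aemeas S hc).mono_measure (Measure.restrict_mono Ioc_subset_Icc_self le_rfl)).ennreal_toReal.aestronglyMeasurable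
  · filter_upwards [ae_restrict_mem measurableSet_Ioc] with t ht
    rw [Real.norm_eq_abs, abs_of_nonneg (M_nonneg _), one_div, ← div_eq_inv_mul, le_div_iff₀ hδ]
    have := hup t (Ioc_subset_Icc_self ht)
    linarith

end AK
end

section
open MeasureTheory Set Filter Topology
namespace AK

lemma exp_fac_nonneg {s x : ℝ} (hs : 0 < s) (hx : 0 ≤ x) : 0 ≤ 1 - Real.exp (-(s * x)) := by
  have : Real.exp (-(s * x)) ≤ 1 := Real.exp_le_one_iff.2 (by nlinarith)
  linarith

lemma exp_fac_le {s x : ℝ} : 1 - Real.exp (-(s * x)) ≤ 1 := by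
  linarith [Real.exp_pos (-(s * x))]

open Classical in
noncomputable def J (n : ℝ → Measure ℝ) (s t : ℝ) : ℝ :=
  if mass (n t) = ⊤ then 0 else ∫ x, x * (1 - Real.exp (-(s * x))) ∂(n t)

lemma q_exp {n : ℝ → Measure ℝ} (S : Sol n) {s t : ℝ} (hs : 0 < s) (ht : 0 ≤ t) :
    q n (fun x => 1 - Real.exp (-(s * x))) t
      = - ((∫ x, (1 - Real.exp (-(s * x))) ∂(n t)) * J n s t) := by
  have := S.fin t ht
  by_cases hm : mass (n t) = ⊤
  · simp [q, J, hm]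
  · simp only [q, J, hm, if_false]
    exact Q_exp (S.pos t ht) hm hs

lemma J_int {μ : Measure ℝ} (h : ∀ᵐ x ∂μ, 0 < x) (hm : mass μ ≠ ⊤) {s : ℝ} (hs : 0 < s) :
    Integrable (fun x => x * (1 - Real.exp (-(s * x)))) μ := by
  refine (integrable_id h hm).mono (by fun_prop) ?_
  filter_upwards [h] with x hx
  rw [norm_mul]
  apply mul_le_of_le_one_right (norm_nonneg _)
  rw [Real.norm_eq_abs, abs_of_nonneg (exp_fac_nonneg hs hx.le)]
  exact exp_fac_le

lemma J_nonneg {n : ℝ → Measure ℝ} (S : Sol n) {s t : ℝ} (hs : 0 < s) (ht : 0 ≤ t) :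
    0 ≤ J n s t := by
  by_cases hm : mass (n t) = ⊤
  · simp [J, hm]
  · simp only [J, hm, if_false]
    apply integral_nonneg_of_ae
    filter_upwards [S.pos t ht] with x hx
    exact mul_nonneg hx.le (exp_fac_nonneg hs hx.le)

lemma J_le {n : ℝ → Measure ℝ} (S : Sol n) {s t : ℝ} (hs : 0 < s) (ht : 0 ≤ t) :
    J n s t ≤ M (n t) := by
  by_cases hm : mass (n t) = ⊤
  · simp [J, M, hm]
  · simp only [J, hm, if_false]
    rw [M_eq (S.pos t ht) hm]
    apply integral_mono_ae (J_int (S.pos t ht) hm hs) (integrable_id (S.pos t ht) hm)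
    filter_upwards [S.pos t ht] with x hx
    exact mul_le_of_le_one_right hx.le exp_fac_le

lemma J_aemeas {n : ℝ → Measure ℝ} (S : Sol n) {s c d : ℝ} (hc : 0 ≤ c) (hs : 0 < s) :
    AEMeasurable (J n s) (volume.restrict (Icc c d)) := by
  have hms : NullMeasurableSet {t | mass (n t) = ⊤} (volume.restrict (Icc c d)) :=
    (mass_aemeas S hc).nullMeasurable (measurableSet_singleton ⊤)
  apply aemeasurable_of_tendsto_metrizable_ae atTop
    (f := fun k => indicator {t | mass (n t) = ⊤}ᶜ
      (fun t => ∫ x, (x * (1 - Real.exp (-(s * x)))) * cut k x ∂(n t)))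
  · intro k
    refine AEMeasurable.indicator₀ ?_ hms.compl
    exact (((S.cont (isTest_cut (f := fun x => x * (1 - Real.exp (-(s * x)))) (by fun_prop) k)).mono
      (fun t ht => hc.trans ht.1)).aemeasurable measurableSet_Icc)
  · filter_upwards [ae_restrict_mem measurableSet_Icc] with t ht
    have ht0 := hc.trans ht.1
    by_cases hm : mass (n t) = ⊤
    · simp [J, hm]
    · simp only [J, hm, if_false, indicator, mem_compl_iff, mem_ofPred_eq, not_false_eq_true, if_true]
      apply tendsto_integral_of_dominated_convergence (fun x => ‖x * (1 - Real.exp (-(s * x)))‖)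
      · intro k
        have := (cut_smooth k).continuous
        apply Continuous.aestronglyMeasurable
        fun_prop
      · exact (J_int (S.pos t ht0) hm hs).norm
      · intro k
        refine Eventually.of_forall fun x => ?_
        rw [norm_mul]
        apply mul_le_of_le_one_right (norm_nonneg _)
        rw [Real.norm_eq_abs, abs_of_nonneg (cut_nonneg _ _)]
        exact cut_le_one _ _
      · filter_upwards [S.pos t ht0] with x hx
        apply tendsto_const_nhds.congr'
        filter_upwards [cut_tendsto hx] with k hk
        rw [hk, mul_one]

/-- the sequence s_j -/
noncomputable def sj (j : ℕ) : ℝ := 1 / ((j : ℝ) + 1)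
lemma sj_pos (j : ℕ) : 0 < sj j := by unfold sj; positivity
lemma sj_le (j : ℕ) : sj j ≤ 1 := by
  unfold sj; rw [div_le_one (by positivity)]; linarith [(Nat.cast_nonneg j : (0:ℝ) ≤ j)]
lemma sj_tendsto : Tendsto sj atTop (𝓝 0) := tendsto_one_div_add_atTop_nhds_zero_nat

lemma J_tendsto {n : ℝ → Measure ℝ} (S : Sol n) {t : ℝ} (ht : 0 ≤ t) :
    Tendsto (fun j => J n (sj j) t) atTop (𝓝 0) := by
  by_cases hm : mass (n t) = ⊤
  · simp [J, hm]
  · simp only [J, hm, if_false]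
    have : (0:ℝ) = ∫ x, x * (1 - Real.exp (-(0 * x))) ∂(n t) := by simp
    rw [this]
    apply tendsto_integral_of_dominated_convergence (fun x => ‖x‖)
    · intro k; apply Continuous.aestronglyMeasurable; fun_prop
    · exact (integrable_id (S.pos t ht) hm).norm
    · intro k
      filter_upwards [S.pos t ht] with x hx
      rw [norm_mul]
      apply mul_le_of_le_one_right (norm_nonneg _)
      rw [Real.norm_eq_abs, abs_of_nonneg (exp_fac_nonneg (sj_pos k) hx.le)]
      exact exp_fac_le
    · refine Eventually.of_forall fun x => ?_
      have hc : Continuous (fun s : ℝ => x * (1 - Real.exp (-(s * x)))) := by fun_prop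
      exact (hc.tendsto 0).comp sj_tendsto

lemma y_mass {n : ℝ → Measure ℝ} (S : Sol n) {t : ℝ} (ht : 0 ≤ t) :
    Tendsto (fun j => ENNReal.ofReal ((∫ x, (1 - Real.exp (-(sj j * x))) ∂(n t)) / sj j)) atTop
      (𝓝 (mass (n t))) := by
  have := S.fin t ht
  have h := mass_tendsto (S.pos t ht) (g := fun j x => (1 - Real.exp (-(sj j * x))) / sj j)
    (fun k => by fun_prop)
    (fun k x hx => by
      rw [div_le_iff₀ (sj_pos k)]
      linarith [Real.add_one_le_exp (-(sj k * x))])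
    (fun x hx => by
      have hd : HasDerivAt (fun s : ℝ => 1 - Real.exp (-(s * x))) x 0 := by
        have h1 : HasDerivAt (fun s : ℝ => -(s * x)) (-(1 * x)) 0 := ((hasDerivAt_id 0).mul_const x).neg
        have := (h1.exp).const_sub 1
        simpa using this
      have h2 := hd.tendsto_slope.comp (f := sj) (x := atTop) (by
        apply tendsto_nhdsWithin_of_tendsto_nhds_of_eventually_within _ sj_tendsto
        exact Eventually.of_forall fun k => (sj_pos k).ne')
      refine h2.congr fun k => ?_
      simp [slope_def_field])
  refine h.congr fun k => ?_
  rw [← integral_div, ofReal_integral_eq_lintegral_ofReal (((nice_exp (sj_pos k)).integrable (S.pos t ht)).div_const _)]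
  filter_upwards [S.pos t ht] with x hx
  exact div_nonneg (exp_fac_nonneg (sj_pos k) hx.le) (sj_pos k).le

lemma y_nonneg {n : ℝ → Measure ℝ} (S : Sol n) {s t : ℝ} (hs : 0 < s) (ht : 0 ≤ t) :
    0 ≤ ∫ x, (1 - Real.exp (-(s * x))) ∂(n t) := by
  apply integral_nonneg_of_ae
  filter_upwards [S.pos t ht] with x hx
  exact exp_fac_nonneg hs hx.le

lemma y_anti {n : ℝ → Measure ℝ} (S : Sol n) {c d W s : ℝ} (hc : 0 ≤ c) (hcd : c ≤ d)
    (hW : ∀ t ∈ Icc c d, E (n t) ≤ W) (hM : IntegrableOn (fun t => M (n t)) (Icc c d))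
    (hs : 0 < s) :
    (∫ x, (1 - Real.exp (-(s * x))) ∂(n d)) ≤ ∫ x, (1 - Real.exp (-(s * x))) ∂(n c) := by
  have := S.wf hc hcd hW hM (nice_exp hs) (Or.inl fun x hx => exp_fac_nonneg hs hx)
  have h2 : ∫ t in c..d, q n (fun x => 1 - Real.exp (-(s * x))) t ≤ 0 := by
    rw [intervalIntegral.integral_of_le hcd]
    apply integral_nonpos_of_ae
    filter_upwards [ae_restrict_mem measurableSet_Ioc] with t ht
    have ht0 : 0 ≤ t := hc.trans ht.1.le
    rw [q_exp S hs ht0]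
    simp only [Pi.zero_apply, Left.neg_nonpos_iff]
    exact mul_nonneg (y_nonneg S hs ht0) (J_nonneg S hs ht0)
  linarith

lemma y_lower {n : ℝ → Measure ℝ} (S : Sol n) {c d W s : ℝ} (hc : 0 ≤ c) (hcd : c ≤ d)
    (hW : ∀ t ∈ Icc c d, E (n t) ≤ W) (hM : IntegrableOn (fun t => M (n t)) (Icc c d))
    (hs : 0 < s) :
    (∫ x, (1 - Real.exp (-(s * x))) ∂(n c)) * (1 - ∫ t in Icc c d, J n s t)
      ≤ ∫ x, (1 - Real.exp (-(s * x))) ∂(n d) := by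
  have := S.wf hc hcd hW hM (nice_exp hs) (Or.inl fun x hx => exp_fac_nonneg hs hx)
  have hJ : IntegrableOn (J n s) (Icc c d) := by
    refine hM.mono' (J_aemeas S hc hs).aestronglyMeasurable ?_
    filter_upwards [ae_restrict_mem measurableSet_Icc] with t ht
    have ht0 : 0 ≤ t := hc.trans ht.1
    rw [Real.norm_eq_abs, abs_of_nonneg (J_nonneg S hs ht0)]
    exact J_le S hs ht0
  have h2 : ∫ t in c..d, -q n (fun x => 1 - Real.exp (-(s * x))) t
      ≤ ∫ t in Icc c d, (∫ x, (1 - Real.exp (-(s * x))) ∂(n c)) * J n s t := by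
    rw [intervalIntegral.integral_of_le hcd, ← integral_Icc_eq_integral_Ioc]
    apply integral_mono_of_nonneg
    · filter_upwards [ae_restrict_mem measurableSet_Icc] with t ht
      have ht0 : 0 ≤ t := hc.trans ht.1
      rw [q_exp S hs ht0, neg_neg]
      exact mul_nonneg (y_nonneg S hs ht0) (J_nonneg S hs ht0)
    · exact hJ.const_mul _
    · filter_upwards [ae_restrict_mem measurableSet_Icc] with t ht
      have ht0 : 0 ≤ t := hc.trans ht.1
      rw [q_exp S hs ht0, neg_neg]
      apply mul_le_mul_of_nonneg_right _ (J_nonneg S hs ht0)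
      exact y_anti S hc ht.1 (fun r hr => hW r ⟨hr.1, hr.2.trans ht.2⟩)
        (hM.mono_set (Icc_subset_Icc_right ht.2)) hs
  rw [intervalIntegral.integral_neg, integral_const_mul] at h2
  linarith

lemma mass_const {n : ℝ → Measure ℝ} (S : Sol n) {c d W : ℝ} (hc : 0 ≤ c) (hcd : c ≤ d)
    (hW : ∀ t ∈ Icc c d, E (n t) ≤ W) (hM : IntegrableOn (fun t => M (n t)) (Icc c d)) :
    mass (n c) = mass (n d) := by
  have hd0 := hc.trans hcd
  have lc := y_mass S hc
  have ld := y_mass S hd0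
  apply le_antisymm
  · have hJ0 : Tendsto (fun j => ∫ t in Icc c d, J n (sj j) t) atTop (𝓝 0) := by
      have : (0:ℝ) = ∫ t in Icc c d, (0:ℝ) := by simp
      rw [this]
      apply tendsto_integral_of_dominated_convergence (fun t => M (n t))
        (fun k => (J_aemeas S hc (sj_pos k)).aestronglyMeasurable) hM
      · intro k
        filter_upwards [ae_restrict_mem measurableSet_Icc] with t ht
        have ht0 : 0 ≤ t := hc.trans ht.1
        rw [Real.norm_eq_abs, abs_of_nonneg (J_nonneg S (sj_pos k) ht0)]
        exact J_le S (sj_pos k) ht0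
      · filter_upwards [ae_restrict_mem measurableSet_Icc] with t ht
        exact J_tendsto S (hc.trans ht.1)
    have l1 : Tendsto (fun j => ENNReal.ofReal (1 - ∫ t in Icc c d, J n (sj j) t)) atTop (𝓝 1) := by
      have := (ENNReal.continuous_ofReal.tendsto _).comp (hJ0.const_sub 1)
      simpa [Function.comp_def] using this
    have l2 := ENNReal.Tendsto.mul lc (Or.inr ENNReal.one_ne_top) l1 (Or.inl one_ne_zero)
    rw [mul_one] at l2
    refine le_of_tendsto_of_tendsto' l2 ld fun j => ?_
    rw [← ENNReal.ofReal_mul (div_nonneg (y_nonneg S (sj_pos j) hc) (sj_pos j).le)]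
    apply ENNReal.ofReal_le_ofReal
    rw [div_mul_eq_mul_div]
    exact div_le_div_of_nonneg_right (y_lower S hc hcd hW hM (sj_pos j)) (sj_pos j).le
  · refine le_of_tendsto_of_tendsto' ld lc fun j => ?_
    apply ENNReal.ofReal_le_ofReal
    exact div_le_div_of_nonneg_right (y_anti S hc hcd hW hM (sj_pos j)) (sj_pos j).le

lemma E_anti {n : ℝ → Measure ℝ} (S : Sol n) {c d W : ℝ} (hc : 0 ≤ c) (hcd : c ≤ d)
    (hW : ∀ t ∈ Icc c d, E (n t) ≤ W) (hM : IntegrableOn (fun t => M (n t)) (Icc c d)) :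
    E (n d) ≤ E (n c) := by
  have := y_anti S hc hcd hW hM one_pos
  simpa [E] using this

end AK
end

section
open MeasureTheory Set Filter Topology
namespace AK

lemma niceE : Nice (max 1 1) (fun x => 1 - Real.exp (-(1 * x))) := nice_exp one_pos

lemma E_eq (μ : Measure ℝ) : E μ = ∫ x, (1 - Real.exp (-(1 * x))) ∂μ := by simp [E]

lemma E_tend {n : ℝ → Measure ℝ} (S : Sol n) {t : ℝ} (ht : 0 ≤ t) :
    Tendsto (fun k => ∫ x, (1 - Real.exp (-(1 * x))) * cut k x ∂(n t)) atTop (𝓝 (E (n t))) := by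
  have := S.fin t ht
  rw [E_eq]
  exact int_cut_tendsto (S.pos t ht) niceE

lemma E_ge {n : ℝ → Measure ℝ} (S : Sol n) {t : ℝ} (ht : 0 ≤ t) (k : ℕ) :
    ∫ x, (1 - Real.exp (-(1 * x))) * cut k x ∂(n t) ≤ E (n t) := by
  have := S.fin t ht
  rw [E_eq]
  obtain ⟨L, hL⟩ := (isTest_cut niceE.smooth k).nice
  apply integral_mono_ae (hL.integrable (S.pos t ht)) (niceE.integrable (S.pos t ht))
  filter_upwards [S.pos t ht] with x hx
  exact mul_le_of_le_one_right (exp_fac_nonneg one_pos hx.le) (cut_le_one _ _)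

lemma closed_of_cont {f : ℕ → ℝ → ℝ} (hf : ∀ k, ContinuousOn (f k) (Ici 0)) (K : ℝ) :
    IsClosed {t | 0 ≤ t ∧ ∀ k, f k t ≤ K} := by
  have : {t | 0 ≤ t ∧ ∀ k, f k t ≤ K} = Ici 0 ∩ ⋂ k, (Ici 0 ∩ f k ⁻¹' Iic K) := by
    ext t; simp only [mem_ofPred_eq, mem_inter_iff, mem_Ici, mem_iInter, mem_preimage, mem_Iic]
    exact ⟨fun h => ⟨h.1, fun k => ⟨h.1, h.2 k⟩⟩, fun h => ⟨h.1, fun k => (h.2 k).2⟩⟩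
  rw [this]
  exact isClosed_Ici.inter (isClosed_iInter fun k => (hf k).preimage_isClosed_of_isClosed isClosed_Ici isClosed_Iic)

lemma E_closed {n : ℝ → Measure ℝ} (S : Sol n) (K : ℝ) : IsClosed {t | 0 ≤ t ∧ E (n t) ≤ K} := by
  have := closed_of_cont (fun k => S.cont (isTest_cut niceE.smooth k)) K
  convert this using 1
  ext t
  simp only [mem_ofPred_eq]
  refine ⟨fun h => ⟨h.1, fun k => (E_ge S h.1 k).trans h.2⟩, fun h => ⟨h.1, ?_⟩⟩
  exact le_of_tendsto' (E_tend S h.1) h.2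

lemma mass_closed {n : ℝ → Measure ℝ} (S : Sol n) {K : ℝ} (hK : 0 ≤ K) :
    IsClosed {t | 0 ≤ t ∧ mass (n t) ≤ ENNReal.ofReal K} := by
  have := closed_of_cont (fun k => S.cont (isTest_cut (f := fun x => x) contDiff_id k)) K
  convert this using 1
  ext t
  simp only [mem_ofPred_eq]
  refine ⟨fun h => ⟨h.1, fun k => ?_⟩, fun h => ⟨h.1, ?_⟩⟩
  · rw [← ENNReal.ofReal_le_ofReal_iff hK]
    refine le_trans ?_ h.2
    have := S.fin t h.1
    obtain ⟨L, hL⟩ := (isTest_cut (f := fun x => x) contDiff_id k).nice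
    rw [ofReal_integral_eq_lintegral_ofReal (hL.integrable (S.pos t h.1))]
    · exact lintegral_mono_ae ((S.pos t h.1).mono fun x hx =>
        ENNReal.ofReal_le_ofReal (mul_le_of_le_one_right hx.le (cut_le_one _ _)))
    · filter_upwards [S.pos t h.1] with x hx
      exact mul_nonneg hx.le (cut_nonneg _ _)
  · refine le_of_tendsto' (mass_tendsto_cut S h.1) fun k => ENNReal.ofReal_le_ofReal (h.2 k)

lemma const_of_top {n : ℝ → Measure ℝ} (S : Sol n) {a b : ℝ} (ha : 0 ≤ a)
    (hm : ∀ t ∈ Ioo a b, mass (n t) = ⊤) {c d : ℝ} (hc : c ∈ Icc a b) (hd : d ∈ Icc a b) (hcd : c ≤ d) :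
    E (n c) = E (n d) := by
  refine tendsto_nhds_unique (E_tend S (ha.trans hc.1)) ((E_tend S (ha.trans hd.1)).congr fun k => ?_)
  have hT := isTest_cut niceE.smooth k
  rcases hcd.eq_or_lt with rfl | hlt
  · rfl
  obtain ⟨x, hx, h⟩ := exists_hasDerivAt_eq_slope
    (fun r => ∫ x, (1 - Real.exp (-(1 * x))) * cut k x ∂(n r)) (fun _ => 0) hlt
    ((S.cont hT).mono fun r hr => (ha.trans hc.1).trans hr.1)
    (fun r hr => by
      have := S.deriv hT (t := r) ((ha.trans hc.1).trans_lt hr.1)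
        (Or.inl fun x hx => mul_nonneg (exp_fac_nonneg one_pos hx) (cut_nonneg _ _))
      rwa [q, if_pos (hm r ⟨hc.1.trans_lt hr.1, hr.2.trans_le hd.2⟩)] at this)
  rw [eq_comm, div_eq_zero_iff] at h
  rcases h with h | h <;> linarith

lemma E_le_M {n : ℝ → Measure ℝ} (S : Sol n) {t : ℝ} (ht : 0 ≤ t) (hm : mass (n t) ≠ ⊤) :
    E (n t) ≤ M (n t) := by
  have := S.fin t ht
  rw [M_eq (S.pos t ht) hm, E_eq]
  apply integral_mono_ae (niceE.integrable (S.pos t ht)) (integrable_id (S.pos t ht) hm)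
  filter_upwards [S.pos t ht] with x hx
  linarith [Real.add_one_le_exp (-(1 * x))]

lemma M_int_of_const {n : ℝ → Measure ℝ} (S : Sol n) {a b : ℝ} (ha : 0 ≤ a) (hab : a < b) {c : ENNReal}
    (hc : c ≠ ⊤) (hm : ∀ t ∈ Ioo a b, mass (n t) = c) :
    (∀ t ∈ Icc a b, E (n t) ≤ c.toReal) ∧ IntegrableOn (fun t => M (n t)) (Icc a b) := by
  have hle : ∀ t ∈ Icc a b, 0 ≤ t ∧ mass (n t) ≤ ENNReal.ofReal c.toReal := by
    rw [← closure_Ioo hab.ne]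
    apply (mass_closed S ENNReal.toReal_nonneg).closure_subset_iff.2
    intro t ht
    exact ⟨ha.trans ht.1.le, by rw [hm t ht, ENNReal.ofReal_toReal hc]⟩
  have hle' : ∀ t ∈ Icc a b, mass (n t) ≤ c := fun t ht => by
    have := (hle t ht).2; rwa [ENNReal.ofReal_toReal hc] at this
  have hM : ∀ t ∈ Icc a b, M (n t) ≤ c.toReal := fun t ht => ENNReal.toReal_mono hc (hle' t ht)
  refine ⟨fun t ht => (E_le_M S (ha.trans ht.1) (ne_top_of_le_ne_top hc (hle' t ht))).trans (hM t ht), ?_⟩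
  refine (integrableOn_const (C := c.toReal) (by simp)).mono'
    (mass_aemeas S ha).ennreal_toReal.aestronglyMeasurable ?_
  filter_upwards [ae_restrict_mem measurableSet_Icc] with t ht
  rw [Real.norm_eq_abs]
  show |M (n t)| ≤ _
  rw [abs_of_nonneg (M_nonneg _)]
  exact hM t ht

lemma E_le_left {n : ℝ → Measure ℝ} (S : Sol n) {a b : ℝ} (ha : 0 ≤ a) {c : ENNReal}
    (hm : ∀ t ∈ Ioo a b, mass (n t) = c) {t : ℝ} (ht : t ∈ Icc a b) : E (n t) ≤ E (n a) := by
  rcases ht.1.eq_or_lt with rfl | hat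
  · rfl
  have hab : a < b := hat.trans_le ht.2
  by_cases hc : c = ⊤
  · subst hc
    exact (const_of_top S ha hm (left_mem_Icc.2 hab.le) ht ht.1).ge
  · obtain ⟨h1, h2⟩ := M_int_of_const S ha hab hc hm
    exact E_anti S ha ht.1 (fun r hr => h1 r ⟨hr.1, hr.2.trans ht.2⟩)
      (h2.mono_set (Icc_subset_Icc_right ht.2))

lemma mass_zero_of_E {n : ℝ → Measure ℝ} (S : Sol n) {t : ℝ} (ht : 0 ≤ t) (h : E (n t) ≤ 0) :
    mass (n t) = 0 := by
  have := S.fin t ht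
  have h0 := le_antisymm h (E_nonneg (S.pos t ht))
  rw [E_eq, integral_eq_zero_iff_of_nonneg_ae ((S.pos t ht).mono fun x hx => exp_fac_nonneg one_pos hx.le)
    (niceE.integrable (S.pos t ht))] at h0
  have : ∀ᵐ x ∂(n t), False := by
    filter_upwards [h0, S.pos t ht] with x hx hx'
    simp only [Pi.zero_apply] at hx
    have : Real.exp (-(1 * x)) < 1 := Real.exp_lt_one_iff.2 (by linarith)
    linarith
  unfold mass
  rw [lintegral_congr_ae (g := fun _ => 0) (this.mono fun x hx => hx.elim)]
  simp

lemma E_zero_of_mass {n : ℝ → Measure ℝ} (S : Sol n) {t : ℝ} (ht : 0 ≤ t) (h : mass (n t) = 0) :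
    E (n t) = 0 := by
  have := E_le_M S ht (by rw [h]; simp)
  simp only [M, h, ENNReal.toReal_zero] at this
  exact le_antisymm this (E_nonneg (S.pos t ht))

lemma zero_left {n : ℝ → Measure ℝ} (S : Sol n) {a b : ℝ} (ha : 0 ≤ a) {c : ENNReal}
    (hm : ∀ t ∈ Ioo a b, mass (n t) = c) (hb : mass (n b) = 0) {t : ℝ} (ht : t ∈ Ioo a b) :
    mass (n t) = 0 := by
  have hab : a < b := ht.1.trans ht.2
  have ht0 := ha.trans ht.1.le
  by_cases hc : c = ⊤
  · subst hc
    apply mass_zero_of_E S ht0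
    rw [const_of_top S ha hm (Ioo_subset_Icc_self ht) (right_mem_Icc.2 hab.le) ht.2.le,
      E_zero_of_mass S (ha.trans hab.le) hb]
  · obtain ⟨h1, h2⟩ := M_int_of_const S ha hab hc hm
    rw [mass_const S ht0 ht.2.le (fun r hr => h1 r ⟨ht.1.le.trans hr.1, hr.2⟩)
      (h2.mono_set (Icc_subset_Icc_left ht.1.le)), hb]

lemma loc_const {n : ℝ → Measure ℝ} (S : Sol n) {t1 W ε : ℝ} (ht1 : 0 ≤ t1) (hε : 0 < ε)
    (hE : ∀ t, 0 ≤ t → |t - t1| < ε → E (n t) ≤ W) (hm : mass (n t1) ≠ 0) :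
    ∀ᶠ r in 𝓝[Ici 0] t1, mass (n r) = mass (n t1) := by
  have h1 : ∃ k, 0 < ∫ x, x * cut k x ∂(n t1) := by
    by_contra! hcon
    apply hm
    refine tendsto_nhds_unique (mass_tendsto_cut S ht1) ?_
    simp [ENNReal.ofReal_of_nonpos (hcon _)]
  obtain ⟨k, hk⟩ := h1
  set F := fun t => ∫ x, x * cut k x ∂(n t)
  have hT := isTest_cut (f := fun x => x) contDiff_id k
  have hc := (S.cont hT) t1 ht1
  have h2 : ∀ᶠ r in 𝓝[Ici 0] t1, F t1 / 2 < F r := hc.eventually_const_lt (by simp only [F]; linarith)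
  rw [eventually_nhdsWithin_iff, Metric.eventually_nhds_iff] at h2
  obtain ⟨ε', hε', h2⟩ := h2
  rw [eventually_nhdsWithin_iff, Metric.eventually_nhds_iff]
  refine ⟨min ε ε', lt_min hε hε', fun r hr hr0 => ?_⟩
  have key : ∀ c d, 0 ≤ c → c ≤ d → (∀ t ∈ Icc c d, |t - t1| < min ε ε') → mass (n c) = mass (n d) := by
    intro c d hc0 hcd hw
    have hW : ∀ t ∈ Icc c d, E (n t) ≤ W := fun t ht =>
      hE t (hc0.trans ht.1) ((hw t ht).trans_le (min_le_left _ _))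
    refine mass_const S hc0 hcd hW (M_integrable S hc0 hW hT
      (fun x hx => mul_nonneg hx (cut_nonneg _ _)) (half_pos hk) fun t ht => ?_)
    exact (h2 (by rw [Real.dist_eq]; exact (hw t ht).trans_le (min_le_right _ _)) (hc0.trans ht.1)).le
  rw [Real.dist_eq] at hr
  rcases le_total r t1 with h | h
  · apply key r t1 hr0 h
    intro t ht
    rw [abs_of_nonpos (by linarith [ht.2])]
    rw [abs_of_nonpos (by linarith)] at hr
    linarith [ht.1]
  · symm
    apply key t1 r ht1 h
    intro t ht
    rw [abs_of_nonneg (by linarith [ht.1])]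
    rw [abs_of_nonneg (by linarith)] at hr
    linarith [ht.2]

def Bad (n : ℝ → Measure ℝ) : Set ℝ :=
  {t | 0 ≤ t ∧ ¬ ∀ᶠ r in 𝓝[Ici 0] t, mass (n r) = mass (n t)}

lemma Bad_closed (n : ℝ → Measure ℝ) : IsClosed (Bad n) := by
  rw [← isOpen_compl_iff, isOpen_iff_mem_nhds]
  intro t ht
  simp only [Bad, mem_compl_iff, mem_ofPred_eq, not_and, not_not] at ht
  by_cases h0 : 0 ≤ t
  · have h1 := ht h0
    have h2 := eventually_eventually_nhdsWithin.2 h1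
    rw [eventually_nhdsWithin_iff] at h1 h2
    filter_upwards [h1, h2] with r h1 h2
    simp only [Bad, mem_compl_iff, mem_ofPred_eq, not_and, not_not]
    intro hr
    filter_upwards [h2 hr] with s hs
    rw [hs, h1 hr]
  · filter_upwards [Iio_mem_nhds (not_le.1 h0)] with r hr hB
    exact absurd hB.1 (not_le.2 hr)

lemma const_of_good {n : ℝ → Measure ℝ} {s : Set ℝ} (hs : IsPreconnected s) (h0 : s ⊆ Ici 0)
    (hB : ∀ t ∈ s, t ∉ Bad n) {x y : ℝ} (hx : x ∈ s) (hy : y ∈ s) : mass (n x) = mass (n y) := by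
  refine hs.induction₂ (fun x y => mass (n x) = mass (n y)) ?_ ?_ ?_ hx hy
  · intro t ht
    have := hB t ht
    simp only [Bad, mem_ofPred_eq, not_and, not_not] at this
    filter_upwards [nhdsWithin_mono t h0 (this (h0 ht))] with r hr using hr.symm
  · intro x y z h1 h2 h3 h4 h5; exact h4.trans h5
  · intro x y h1 h2 h3; exact h3.symm

lemma const_Ioo {n : ℝ → Measure ℝ} {a b : ℝ} (h0 : 0 ≤ a) 
    (hB : ∀ t ∈ Ioo a b, t ∉ Bad n) : ∃ c, ∀ t ∈ Ioo a b, mass (n t) = c := by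
  refine ⟨mass (n ((a + b) / 2)), fun t ht => ?_⟩
  have hab := ht.1.trans ht.2
  exact const_of_good isPreconnected_Ioo (fun r hr => h0.trans hr.1.le) hB ht
    ⟨by linarith, by linarith⟩

/-- bound to the right of a bad point -/
lemma E_right {n : ℝ → Measure ℝ} (S : Sol n) {b t K : ℝ} (hb : b ∈ Bad n) (hbt : b ≤ t)
    (hK : ∀ r ∈ Bad n, r ∈ Icc b t → E (n r) ≤ K) : E (n t) ≤ K := by
  have hcpt : IsCompact (Bad n ∩ Icc b t) := isCompact_Icc.inter_left (Bad_closed n)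
  have hne : (Bad n ∩ Icc b t).Nonempty := ⟨b, hb, left_mem_Icc.2 hbt⟩
  have ha := hcpt.sSup_mem hne
  set a := sSup (Bad n ∩ Icc b t)
  have hgood : ∀ r ∈ Ioo a t, r ∉ Bad n := by
    intro r hr hrB
    have : r ≤ a := le_csSup hcpt.bddAbove ⟨hrB, ha.2.1.trans hr.1.le, hr.2.le⟩
    linarith [hr.1]
  obtain ⟨c, hc⟩ := const_Ioo ha.1.1 hgood
  exact (E_le_left S ha.1.1 hc (right_mem_Icc.2 ha.2.2)).trans (hK a ha.1 ha.2)

lemma bad_mass_zero {n : ℝ → Measure ℝ} (S : Sol n) {t1 K δ : ℝ} (h1 : t1 ∈ Bad n) (hδ : 0 < δ)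
    (hK : ∀ r ∈ Bad n, |r - t1| < δ → E (n r) ≤ K) : mass (n t1) = 0 := by
  by_contra hm
  set a0 := max 0 (t1 - δ / 2)
  apply h1.2
  refine loc_const S (W := max K (E (n a0))) h1.1 (half_pos hδ) ?_ hm
  intro t ht htt
  rw [abs_lt] at htt
  by_cases hex : ∃ b ∈ Bad n, b ≤ t ∧ t1 - δ / 2 ≤ b
  · obtain ⟨b, hb, hbt, hb2⟩ := hex
    refine (E_right S hb hbt fun r hr hr2 => hK r hr ?_).trans (le_max_left _ _)
    rw [abs_lt]; constructor <;> linarith [hr2.1, hr2.2]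
  · push Not at hex
    have hgood : ∀ r ∈ Ioo a0 t, r ∉ Bad n := fun r hr hrB => by
      have := hex r hrB hr.2.le
      linarith [hr.1, le_max_right 0 (t1 - δ / 2)]
    obtain ⟨c, hc⟩ := const_Ioo (le_max_left _ _) hgood
    refine (E_le_left S (le_max_left _ _) hc (right_mem_Icc.2 ?_)).trans (le_max_right _ _)
    exact max_le ht (by linarith)

lemma Bad_empty {n : ℝ → Measure ℝ} (S : Sol n) : Bad n = ∅ := by
  by_contra hne
  have hne := nonempty_iff_ne_empty.2 hne
  have : CompleteSpace (Bad n) := (Bad_closed n).completeSpace_coe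
  have : Nonempty (Bad n) := hne.to_subtype
  have hcov : ⋃ K : ℕ, {t : Bad n | E (n t) ≤ K} = univ := by
    refine eq_univ_of_forall fun t => mem_iUnion.2 ?_
    obtain ⟨K, hK⟩ := exists_nat_ge (E (n t))
    exact ⟨K, hK⟩
  have hcl : ∀ K : ℕ, IsClosed {t : Bad n | E (n t) ≤ K} := by
    intro K
    have := (E_closed S K).preimage (continuous_subtype_val (p := (· ∈ Bad n)))
    convert this using 1
    ext t
    simp only [mem_ofPred_eq, mem_preimage]
    exact ⟨fun h => ⟨t.2.1, h⟩, fun h => h.2⟩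
  obtain ⟨K, t1, hint⟩ := nonempty_interior_of_iUnion_of_closed hcl hcov
  rw [mem_interior_iff_mem_nhds, Metric.mem_nhds_iff] at hint
  obtain ⟨δ, hδ, hball⟩ := hint
  have hK : ∀ r ∈ Bad n, |r - t1| < δ → E (n r) ≤ K := fun r hr h =>
    hball (show (⟨r, hr⟩ : Bad n) ∈ Metric.ball t1 δ by
      rw [Metric.mem_ball, Subtype.dist_eq, Real.dist_eq]; exact h)
  have hz : ∀ r ∈ Bad n, |r - t1| < δ → E (n r) ≤ 0 := by
    intro r hr h
    refine (E_zero_of_mass S hr.1 ?_).le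
    refine bad_mass_zero S hr (δ := δ - |r - t1|) (by linarith) (K := K) fun r' hr' h' => hK r' hr' ?_
    have := abs_sub_le r' r t1
    linarith
  have hz1 : mass (n t1) = 0 := mass_zero_of_E S t1.2.1 (hz t1 t1.2 (by simpa using hδ))
  apply t1.2.2
  rw [hz1]
  have hright : ∀ t, (t1:ℝ) ≤ t → t < t1 + δ → mass (n t) = 0 := by
    intro t h1 h2
    refine mass_zero_of_E S (t1.2.1.trans h1) (E_right S t1.2 h1 fun r hr hr2 => hz r hr ?_)
    rw [abs_lt]; constructor <;> linarith [hr2.1, hr2.2]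
  by_cases hex : ∃ b ∈ Bad n, b < t1 ∧ t1 - δ < b
  · obtain ⟨b, hb, hb1, hb2⟩ := hex
    have : Ioo b (t1 + δ) ∈ 𝓝 (t1:ℝ) := Ioo_mem_nhds hb1 (by linarith)
    filter_upwards [mem_nhdsWithin_of_mem_nhds this] with t ht
    rcases le_total (t1:ℝ) t with h | h
    · exact hright t h ht.2
    · refine mass_zero_of_E S (hb.1.trans ht.1.le) (E_right S hb ht.1.le fun r hr hr2 => hz r hr ?_)
      rw [abs_lt]; constructor <;> linarith [hr2.1, hr2.2]
  · push Not at hex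
    have : Ioo (t1 - δ) (t1 + δ) ∈ 𝓝 (t1:ℝ) := Ioo_mem_nhds (by linarith) (by linarith)
    filter_upwards [mem_nhdsWithin_of_mem_nhds this, self_mem_nhdsWithin] with t ht ht0
    rcases le_or_gt (t1:ℝ) t with h | h
    · exact hright t h ht.2
    · have hgood : ∀ r ∈ Ioo t t1, r ∉ Bad n := fun r hr hrB => by
        linarith [hex r hrB hr.2, ht.1, hr.1]
      have h3 : ∀ r ∈ Ioo (max 0 (t1 - δ)) (t1:ℝ), r ∉ Bad n := fun r hr hrB => by
        linarith [hex r hrB hr.2, hr.1, le_max_right 0 ((t1:ℝ) - δ)]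
      rcases (show (0:ℝ) ≤ t from ht0).eq_or_lt with h0 | h0
      · -- t = 0
        have hc0 : ∀ r ∈ Icc (0:ℝ) t, r ∉ Bad n := by
          intro r hr hrB
          have := hex r hrB (hr.2.trans_lt h)
          linarith [hr.1, ht.1]
        have h4 : mass (n 0) = mass (n ((t1:ℝ) / 2)) := by
          refine const_of_good (s := Ico 0 (t1:ℝ)) isPreconnected_Ico (fun r hr => hr.1) ?_
            ⟨le_rfl, by linarith⟩ ⟨by linarith, by linarith⟩
          intro r hr hrB
          have := hex r hrB hr.2
          linarith [hr.1, ht.1]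
        rw [← h0, h4]
        have h5 : ∀ r ∈ Ioo (0:ℝ) t1, r ∉ Bad n := fun r hr hrB => by
          linarith [hex r hrB hr.2, hr.1, ht.1]
        obtain ⟨c, hc⟩ := const_Ioo le_rfl h5
        exact zero_left S le_rfl hc hz1 ⟨by linarith, by linarith⟩
      · obtain ⟨c, hc⟩ := const_Ioo (le_max_left _ _) h3
        exact zero_left S (le_max_left _ _) hc hz1 ⟨max_lt h0 ht.1, h⟩

theorem mass_eq_init {n : ℝ → Measure ℝ} (S : Sol n) {t : ℝ} (ht : 0 ≤ t) :
    mass (n t) = mass (n 0) :=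
  const_of_good (s := Ici 0) isPreconnected_Ici subset_rfl
    (fun r _ h => by rw [Bad_empty S] at h; exact h) ht (mem_Ici.2 le_rfl)

end AK
end

section
open MeasureTheory Set Filter Topology
namespace AK

/-! ### Complex exponential estimates on the right half plane -/

lemma norm_exp_neg_le {a : ℂ} (ha : 0 ≤ a.re) : ‖Complex.exp (-a)‖ ≤ 1 := by
  rw [Complex.norm_exp, Real.exp_le_one_iff]; simpa using ha

lemma convex_hp : Convex ℝ {z : ℂ | 0 ≤ z.re} := by
  have := convex_halfSpace_re_ge 0
  simpa using this

lemma e1 {a b : ℂ} (ha : 0 ≤ a.re) (hb : 0 ≤ b.re) :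
    ‖Complex.exp (-b) - Complex.exp (-a)‖ ≤ ‖b - a‖ := by
  have := convex_hp.norm_image_sub_le_of_norm_hasDerivWithin_le (f := fun z => Complex.exp (-z))
    (f' := fun z => - Complex.exp (-z)) (C := 1) (x := a) (y := b)
    (fun z hz => by
      have := ((hasDerivAt_id z).neg).cexp
      simpa using this.hasDerivWithinAt)
    (fun z hz => by rw [norm_neg]; exact norm_exp_neg_le hz) ha hb
  simpa using this

lemma e2 {a b : ℂ} (ha : 0 ≤ a.re) (hb : 0 ≤ b.re) :
    ‖Complex.exp (-b) - Complex.exp (-a) + (b - a) * Complex.exp (-a)‖ ≤ ‖b - a‖ ^ 2 := by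
  have := (convex_segment (𝕜 := ℝ) a b).norm_image_sub_le_of_norm_hasDerivWithin_le
    (f := fun z => Complex.exp (-z) + z * Complex.exp (-a))
    (f' := fun z => - Complex.exp (-z) + Complex.exp (-a)) (C := ‖b - a‖) (x := a) (y := b)
    (fun z hz => by
      have h1 := ((hasDerivAt_id z).neg).cexp
      have h2 := (hasDerivAt_id z).mul_const (Complex.exp (-a))
      have := h1.fun_add h2
      simpa using this.hasDerivWithinAt)
    (fun z hz => by
      have hz' : 0 ≤ z.re := convex_hp.segment_subset ha hb hz
      rw [neg_add_eq_sub]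
      refine (e1 hz' ha).trans ?_
      rw [norm_sub_rev, norm_sub_rev b a]
      have := norm_sub_le_of_mem_segment hz
      rwa [norm_sub_rev a b]) (left_mem_segment ℝ a b) (right_mem_segment ℝ a b)
  rw [sq]
  refine le_trans (le_of_eq ?_) this
  congr 1; ring

lemma e3 {a : ℂ} (ha : 0 ≤ a.re) :
    ‖1 - Complex.exp (-a) - a + a ^ 2 / 2‖ ≤ ‖a‖ ^ 3 := by
  have := (convex_segment (𝕜 := ℝ) 0 a).norm_image_sub_le_of_norm_hasDerivWithin_le
    (f := fun z => 1 - Complex.exp (-z) - z + z ^ 2 / 2)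
    (f' := fun z => Complex.exp (-z) - 1 + z) (C := ‖a‖ ^ 2) (x := 0) (y := a)
    (fun z hz => by
      have h1 := (((hasDerivAt_id z).neg).cexp).const_sub 1
      have h2 := (h1.fun_sub (hasDerivAt_id z)).fun_add ((hasDerivAt_pow 2 z).div_const 2)
      have := h2.hasDerivWithinAt (s := segment ℝ 0 a)
      convert this using 1
      · rfl
      show Complex.exp (-z) - 1 + z = -(Complex.exp (-z) * -1) - 1 + ((2:ℕ):ℂ) * z ^ (2 - 1) / 2
      push_cast
      ring)
    (fun z hz => by
      have hz' : 0 ≤ z.re := convex_hp.segment_subset (by simp) ha hz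
      have h := e2 (a := 0) (by simp) hz'
      simp only [neg_zero, Complex.exp_zero, sub_zero, mul_one] at h
      refine h.trans ?_
      have := norm_sub_le_of_mem_segment hz
      simp only [sub_zero] at this
      gcongr) (left_mem_segment ℝ 0 a) (right_mem_segment ℝ 0 a)
  simp only [neg_zero, Complex.exp_zero, sub_zero] at this
  refine le_trans (le_of_eq ?_) (this.trans (le_of_eq ?_))
  · congr 1; ring
  · ring

/-! ### Laplace transforms of one measure -/

noncomputable def eta (μ : Measure ℝ) (s : ℂ) : ℂ := ∫ x, (1 - Complex.exp (-(s * (x:ℝ)))) ∂μ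
noncomputable def etas (μ : Measure ℝ) (s : ℂ) : ℂ := ∫ x, (x:ℂ) * Complex.exp (-(s * (x:ℝ))) ∂μ

/-- measures with finite total mass and first moment one -/
structure PM (μ : Measure ℝ) : Prop where
  fin : IsFiniteMeasure μ
  pos : ∀ᵐ x ∂μ, 0 < x
  int : Integrable (fun x => x) μ
  one : ∫ x, x ∂μ = 1

lemma re_mul_nonneg {s : ℂ} {x : ℝ} (hs : 0 ≤ s.re) (hx : 0 ≤ x) : 0 ≤ (s * (x:ℝ)).re := by
  simp; positivity

lemma PM.intC {μ : Measure ℝ} (h : PM μ) : Integrable (fun x : ℝ => (x:ℂ)) μ := h.int.ofReal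

lemma PM.int_bdd {μ : Measure ℝ} (h : PM μ) {f : ℝ → ℂ} (hf : Continuous f) {C : ℝ}
    (hb : ∀ x, 0 < x → ‖f x‖ ≤ C * x) : Integrable f μ := by
  refine (h.int.const_mul C).mono' hf.aestronglyMeasurable ?_
  filter_upwards [h.pos] with x hx using hb x hx

lemma PM.norm_int_le {μ : Measure ℝ} (h : PM μ) {f : ℝ → ℂ} {C : ℝ}
    (hb : ∀ x, 0 < x → ‖f x‖ ≤ C * x) : ‖∫ x, f x ∂μ‖ ≤ C := by
  have : ‖∫ x, f x ∂μ‖ ≤ ∫ x, C * x ∂μ := by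
    apply norm_integral_le_of_norm_le (h.int.const_mul C)
    filter_upwards [h.pos] with x hx using hb x hx
  rwa [integral_const_mul, h.one, mul_one] at this

lemma f_bound {s : ℂ} (hs : 0 ≤ s.re) {x : ℝ} (hx : 0 < x) :
    ‖1 - Complex.exp (-(s * (x:ℝ)))‖ ≤ ‖s‖ * x := by
  have := e1 (a := s * (x:ℝ)) (b := 0) (re_mul_nonneg hs hx.le) (by simp)
  simpa [abs_of_pos hx] using this

lemma fs_bound {s : ℂ} (hs : 0 ≤ s.re) {x : ℝ} (hx : 0 < x) :
    ‖(x:ℂ) * Complex.exp (-(s * (x:ℝ)))‖ ≤ 1 * x := by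
  rw [norm_mul, mul_comm]
  have := norm_exp_neg_le (re_mul_nonneg hs hx.le)
  gcongr
  simp [abs_of_pos hx]

lemma PM.eta_int {μ : Measure ℝ} (h : PM μ) {s : ℂ} (hs : 0 ≤ s.re) :
    Integrable (fun x : ℝ => 1 - Complex.exp (-(s * (x:ℝ)))) μ :=
  h.int_bdd (by fun_prop) fun _ hx => f_bound hs hx

lemma PM.etas_int {μ : Measure ℝ} (h : PM μ) {s : ℂ} (hs : 0 ≤ s.re) :
    Integrable (fun x : ℝ => (x:ℂ) * Complex.exp (-(s * (x:ℝ)))) μ :=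
  h.int_bdd (by fun_prop) fun _ hx => fs_bound hs hx

lemma PM.eta_le {μ : Measure ℝ} (h : PM μ) {s : ℂ} (hs : 0 ≤ s.re) : ‖eta μ s‖ ≤ ‖s‖ :=
  h.norm_int_le fun _ hx => f_bound hs hx

lemma PM.etas_le {μ : Measure ℝ} (h : PM μ) {s : ℂ} (hs : 0 ≤ s.re) : ‖etas μ s‖ ≤ 1 :=
  h.norm_int_le fun _ hx => fs_bound hs hx

lemma PM.eta_re {μ : Measure ℝ} (h : PM μ) {s : ℂ} (hs : 0 ≤ s.re) : 0 ≤ (eta μ s).re := by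
  have h1 : (eta μ s).re = ∫ x, (1 - Complex.exp (-(s * (x:ℝ)))).re ∂μ := by
    exact (Complex.reCLM.integral_comp_comm (h.eta_int hs)).symm
  rw [h1]
  apply integral_nonneg_of_ae
  filter_upwards [h.pos] with x hx
  have := norm_exp_neg_le (re_mul_nonneg hs hx.le)
  have h2 := Complex.re_le_norm (Complex.exp (-(s * (x:ℝ))))
  simp only [Pi.zero_apply, Complex.sub_re, Complex.one_re]
  linarith

/-- Real Laplace transform of the mass. -/
noncomputable def lam (μ : Measure ℝ) (u : ℝ) : ℝ := ∫ x, x * Real.exp (-(u * x)) ∂μ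

lemma PM.lam_int {μ : Measure ℝ} (h : PM μ) {u : ℝ} (hu : 0 ≤ u) :
    Integrable (fun x : ℝ => x * Real.exp (-(u * x))) μ := by
  refine h.int.mono' (by fun_prop) ?_
  filter_upwards [h.pos] with x hx
  have : Real.exp (-(u * x)) ≤ 1 := Real.exp_le_one_iff.2 (by nlinarith)
  rw [Real.norm_eq_abs, abs_of_nonneg (by positivity)]
  exact mul_le_of_le_one_right hx.le this

lemma min_two_le {z : ℝ} (hz : 0 ≤ z) : min 2 z ≤ 4 * (1 - Real.exp (-z)) := by
  have := min_le_exp hz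
  have h2 : min 2 z ≤ 2 * min z 1 := by
    rcases le_total z 1 with h | h
    · rw [min_eq_left h]; linarith [min_le_right 2 z]
    · rw [min_eq_right h]; linarith [min_le_left 2 z]
  linarith

lemma PM.tail {μ : Measure ℝ} (h : PM μ) {f : ℝ → ℂ} {u A : ℝ} (hu : 0 ≤ u) (hA : 0 ≤ A)
    (hb : ∀ x, 0 < x → ‖f x‖ ≤ A * x * min 2 (u * x)) :
    ‖∫ x, f x ∂μ‖ ≤ A * (4 * (1 - lam μ u)) := by
  have : ‖∫ x, f x ∂μ‖ ≤ ∫ x, A * (4 * (x - x * Real.exp (-(u * x)))) ∂μ := by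
    apply norm_integral_le_of_norm_le (((h.int.sub (h.lam_int hu)).const_mul 4).const_mul A)
    filter_upwards [h.pos] with x hx
    refine (hb x hx).trans ?_
    have := min_two_le (z := u * x) (by positivity)
    have h2 : A * x * min 2 (u * x) ≤ A * x * (4 * (1 - Real.exp (-(u * x)))) := by gcongr
    refine h2.trans (le_of_eq ?_)
    simp only [Pi.sub_apply]
    ring
  rwa [integral_const_mul, integral_const_mul, integral_sub h.int (h.lam_int hu), h.one] at this

lemma PM.etas_sub {μ : Measure ℝ} (h : PM μ) {s s' : ℂ} (hs : 0 ≤ s.re) (hs' : 0 ≤ s'.re) :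
    ‖etas μ s' - etas μ s‖ ≤ 4 * (1 - lam μ ‖s' - s‖) := by
  unfold etas
  rw [← integral_sub (h.etas_int hs') (h.etas_int hs)]
  have := h.tail (f := fun x => (x:ℂ) * Complex.exp (-(s' * (x:ℝ))) - (x:ℂ) * Complex.exp (-(s * (x:ℝ))))
    (norm_nonneg (s' - s)) zero_le_one (fun x hx => by
      rw [← mul_sub, norm_mul, Complex.norm_real, Real.norm_eq_abs, abs_of_pos hx, one_mul]
      gcongr
      apply le_min
      · refine (norm_sub_le _ _).trans ?_
        linarith [norm_exp_neg_le (re_mul_nonneg hs hx.le), norm_exp_neg_le (re_mul_nonneg hs' hx.le)]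
      · refine (e1 (re_mul_nonneg hs hx.le) (re_mul_nonneg hs' hx.le)).trans (le_of_eq ?_)
        rw [← sub_mul, norm_mul, Complex.norm_real, Real.norm_eq_abs, abs_of_pos hx])
  rwa [one_mul] at this

lemma PM.eta_sub {μ : Measure ℝ} (h : PM μ) {s s' : ℂ} (hs : 0 ≤ s.re) (hs' : 0 ≤ s'.re) :
    ‖eta μ s' - eta μ s - (s' - s) * etas μ s‖ ≤ ‖s' - s‖ * (4 * (1 - lam μ ‖s' - s‖)) := by
  unfold eta etas
  rw [← integral_sub (h.eta_int hs') (h.eta_int hs), ← integral_const_mul,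
    ← integral_sub (f := fun x : ℝ => 1 - Complex.exp (-(s' * (x:ℝ))) - (1 - Complex.exp (-(s * (x:ℝ)))))
      ((h.eta_int hs').sub (h.eta_int hs)) ((h.etas_int hs).const_mul _)]
  apply h.tail (norm_nonneg (s' - s)) (norm_nonneg (s' - s))
  intro x hx
  have hx1 := re_mul_nonneg hs hx.le
  have hx2 := re_mul_nonneg hs' hx.le
  have hn : ‖s' * (x:ℂ) - s * (x:ℂ)‖ = ‖s' - s‖ * x := by
    rw [← sub_mul, norm_mul, Complex.norm_real, Real.norm_eq_abs, abs_of_pos hx]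
  have hneg : ‖1 - Complex.exp (-(s' * (x:ℝ))) - (1 - Complex.exp (-(s * (x:ℝ))))
      - (s' - s) * ((x:ℂ) * Complex.exp (-(s * (x:ℝ))))‖
      = ‖Complex.exp (-(s' * (x:ℝ))) - Complex.exp (-(s * (x:ℝ)))
        + (s' * (x:ℂ) - s * (x:ℂ)) * Complex.exp (-(s * (x:ℝ)))‖ := by
    rw [← norm_neg]; congr 1; ring
  rw [hneg, mul_min_of_nonneg _ _ (by positivity)]
  apply le_min
  · refine (norm_add_le _ _).trans ?_
    have h1 := e1 hx1 hx2
    have h2 : ‖(s' * (x:ℂ) - s * (x:ℂ)) * Complex.exp (-(s * (x:ℝ)))‖ ≤ ‖s' * (x:ℂ) - s * (x:ℂ)‖ := by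
      rw [norm_mul]; exact mul_le_of_le_one_right (norm_nonneg _) (norm_exp_neg_le hx1)
    linarith
  · refine (e2 hx1 hx2).trans (le_of_eq ?_)
    rw [hn]; ring

lemma PM.lam_le {μ : Measure ℝ} (h : PM μ) {u v : ℝ} (hu : 0 ≤ u) (huv : u ≤ v) :
    lam μ v ≤ lam μ u := by
  apply integral_mono_ae (h.lam_int (hu.trans huv)) (h.lam_int hu)
  filter_upwards [h.pos] with x hx
  gcongr

lemma PM.lam_le_one {μ : Measure ℝ} (h : PM μ) {u : ℝ} (hu : 0 ≤ u) : lam μ u ≤ 1 := by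
  have := h.lam_le le_rfl hu
  simpa [lam, h.one] using this

lemma PM.lam_tendsto {μ : Measure ℝ} (h : PM μ) : Tendsto (fun u => lam μ u) (𝓝[>] 0) (𝓝 1) := by
  have h1 : (1:ℝ) = ∫ x, x * Real.exp (-(0 * x)) ∂μ := by simp [h.one]
  rw [h1]
  apply tendsto_integral_filter_of_dominated_convergence (fun x => ‖x‖)
  · exact Eventually.of_forall fun u => by apply Continuous.aestronglyMeasurable; fun_prop
  · filter_upwards [self_mem_nhdsWithin] with u hu
    filter_upwards [h.pos] with x hx
    have hu' : 0 < u := hu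
    have : Real.exp (-(u * x)) ≤ 1 := Real.exp_le_one_iff.2 (by nlinarith)
    rw [norm_mul]
    apply mul_le_of_le_one_right (norm_nonneg _)
    rwa [Real.norm_eq_abs, abs_of_nonneg (Real.exp_pos _).le]
  · exact h.int.norm
  · refine Eventually.of_forall fun x => ?_
    have hc : Continuous (fun u : ℝ => x * Real.exp (-(u * x))) := by fun_prop
    exact (hc.tendsto 0).mono_left nhdsWithin_le_nhds

end AK
end

section
open MeasureTheory Set Filter Topology
namespace AK

/-! ### Evolution of the complex Laplace transform -/

noncomputable def fC (s : ℂ) (x : ℝ) : ℂ := 1 - Complex.exp (-(s * (x:ℝ)))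

lemma fC_smooth (s : ℂ) : ContDiff ℝ (⊤ : ℕ∞) (fC s) := by
  unfold fC
  have : ContDiff ℝ (⊤ : ℕ∞) (fun x : ℝ => (x:ℂ)) := Complex.ofRealCLM.contDiff
  fun_prop

lemma fC_lip {s : ℂ} (hs : 0 ≤ s.re) {x y : ℝ} (hx : 0 ≤ x) (hy : 0 ≤ y) :
    ‖fC s x - fC s y‖ ≤ max ‖s‖ 2 * |x - y| := by
  have := e1 (re_mul_nonneg hs hx) (re_mul_nonneg hs hy)
  have h2 : fC s x - fC s y = Complex.exp (-(s * (y:ℝ))) - Complex.exp (-(s * (x:ℝ))) := by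
    simp [fC]
  rw [h2]
  refine this.trans ?_
  rw [← mul_sub, norm_mul, norm_sub_rev, ← Complex.ofReal_sub, Complex.norm_real, Real.norm_eq_abs]
  gcongr
  exact le_max_left _ _

lemma fC_bdd {s : ℂ} (hs : 0 ≤ s.re) {x : ℝ} (hx : 0 ≤ x) : ‖fC s x‖ ≤ max ‖s‖ 2 := by
  refine ((norm_sub_le _ _).trans ?_).trans (le_max_right _ _)
  have := norm_exp_neg_le (re_mul_nonneg hs hx)
  simp only [norm_one]; linarith

lemma nice_re {s : ℂ} (hs : 0 ≤ s.re) : Nice (max ‖s‖ 2) (fun x => (fC s x).re) where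
  smooth := Complex.reCLM.contDiff.comp (fC_smooth s)
  lip x y hx hy := by
    rw [← Complex.sub_re]
    exact (Complex.abs_re_le_norm _).trans (fC_lip hs hx hy)
  bdd x hx := (Complex.abs_re_le_norm _).trans (fC_bdd hs hx)
  zero := by simp [fC]

lemma nice_im {s : ℂ} (hs : 0 ≤ s.re) : Nice (max ‖s‖ 2) (fun x => (fC s x).im) where
  smooth := Complex.imCLM.contDiff.comp (fC_smooth s)
  lip x y hx hy := by
    rw [← Complex.sub_im]
    exact (Complex.abs_im_le_norm _).trans (fC_lip hs hx hy)
  bdd x hx := (Complex.abs_im_le_norm _).trans (fC_bdd hs hx)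
  zero := by simp [fC]

noncomputable def gC (s : ℂ) (p : ℝ × ℝ) : ℂ :=
  -(fC s p.1 * (p.2 * fC s p.2) + (p.1 * fC s p.1) * fC s p.2)

lemma gC_eq (s : ℂ) (p : ℝ × ℝ) :
    gC s p = (fC s (p.1 + p.2) - fC s p.1 - fC s p.2) * ((p.1 + p.2 : ℝ) : ℂ) := by
  unfold gC fC
  have : Complex.exp (-(s * ((p.1 + p.2 : ℝ) : ℂ)))
      = Complex.exp (-(s * (p.1:ℂ))) * Complex.exp (-(s * (p.2:ℂ))) := by
    rw [← Complex.exp_add]; congr 1; push_cast; ring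
  rw [this]; push_cast; ring

lemma PM.xf_int {μ : Measure ℝ} (h : PM μ) {s : ℂ} (hs : 0 ≤ s.re) :
    Integrable (fun x : ℝ => (x:ℂ) * fC s x) μ := by
  have : (fun x : ℝ => (x:ℂ) * fC s x) = fun x : ℝ => (x:ℂ) - (x:ℂ) * Complex.exp (-(s * (x:ℝ))) := by
    funext x; simp [fC, mul_sub]
  rw [this]
  exact h.intC.sub (h.etas_int hs)

lemma PM.xf {μ : Measure ℝ} (h : PM μ) {s : ℂ} (hs : 0 ≤ s.re) :
    ∫ x : ℝ, (x:ℂ) * fC s x ∂μ = 1 - etas μ s := by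
  have : (fun x : ℝ => (x:ℂ) * fC s x) = fun x : ℝ => (x:ℂ) - (x:ℂ) * Complex.exp (-(s * (x:ℝ))) := by
    funext x; simp [fC, mul_sub]
  rw [this, integral_sub h.intC (h.etas_int hs), etas]
  congr 1
  have := Complex.ofRealCLM.integral_comp_comm h.int
  simp only [Complex.ofRealCLM_apply] at this
  rw [this, h.one]; simp

lemma PM.gC_int {μ : Measure ℝ} (h : PM μ) {s : ℂ} (hs : 0 ≤ s.re) : Integrable (gC s) (μ.prod μ) := by
  have := h.fin
  have h1 : Integrable (fun x => fC s x) μ := h.eta_int hs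
  have h2 := h.xf_int hs
  exact ((h1.mul_prod h2).add (h2.mul_prod h1)).neg

lemma PM.gC_integral {μ : Measure ℝ} (h : PM μ) {s : ℂ} (hs : 0 ≤ s.re) :
    ∫ p, gC s p ∂(μ.prod μ) = 2 * (eta μ s * etas μ s - eta μ s) := by
  have := h.fin
  have h1 : Integrable (fun x => fC s x) μ := h.eta_int hs
  have h2 := h.xf_int hs
  unfold gC
  rw [integral_neg, integral_add (h1.mul_prod h2) (h2.mul_prod h1),
    integral_prod_mul (fC s) (fun x : ℝ => (x:ℂ) * fC s x),
    integral_prod_mul (fun x : ℝ => (x:ℂ) * fC s x) (fC s), h.xf hs]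
  have : ∫ x, fC s x ∂μ = eta μ s := rfl
  rw [this]; ring

lemma PM.Q_re {μ : Measure ℝ} (h : PM μ) {s : ℂ} (hs : 0 ≤ s.re) :
    Q μ (fun x => (fC s x).re) = (eta μ s * etas μ s - eta μ s).re := by
  have h1 : gk (fun x => (fC s x).re) = fun p => (gC s p).re := by
    funext p; rw [gC_eq, Complex.re_mul_ofReal]; simp [gk]
  have h2 := Complex.reCLM.integral_comp_comm (h.gC_int hs)
  simp only [Complex.reCLM_apply] at h2
  rw [Q, h1, h2, h.gC_integral hs]
  simp [Complex.mul_re]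

lemma PM.Q_im {μ : Measure ℝ} (h : PM μ) {s : ℂ} (hs : 0 ≤ s.re) :
    Q μ (fun x => (fC s x).im) = (eta μ s * etas μ s - eta μ s).im := by
  have h1 : gk (fun x => (fC s x).im) = fun p => (gC s p).im := by
    funext p; rw [gC_eq, Complex.im_mul_ofReal]; simp [gk]
  have h2 := Complex.imCLM.integral_comp_comm (h.gC_int hs)
  simp only [Complex.imCLM_apply] at h2
  rw [Q, h1, h2, h.gC_integral hs]
  simp [Complex.mul_im]

lemma PM.mass {μ : Measure ℝ} (h : PM μ) : mass μ = 1 := by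
  rw [mass_eq h.pos h.int, h.one]; simp

lemma PM.eta_re_eq {μ : Measure ℝ} (h : PM μ) {s : ℂ} (hs : 0 ≤ s.re) :
    ∫ x, (fC s x).re ∂μ = (eta μ s).re :=
  Complex.reCLM.integral_comp_comm (h.eta_int hs)

lemma PM.eta_im_eq {μ : Measure ℝ} (h : PM μ) {s : ℂ} (hs : 0 ≤ s.re) :
    ∫ x, (fC s x).im ∂μ = (eta μ s).im :=
  Complex.imCLM.integral_comp_comm (h.eta_int hs)

section
variable {n : ℝ → Measure ℝ}

/-- weak continuity of the mass measure -/
lemma cont_xf (S : Sol n) (hP : ∀ t, 0 ≤ t → PM (n t)) {f : ℝ → ℝ} (hf : ContDiff ℝ (⊤ : ℕ∞) f)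
    (hb : ∀ x, 0 ≤ x → |f x| ≤ 1) : ContinuousOn (fun t => ∫ x, x * f x ∂(n t)) (Ici 0) := by
  intro t0 ht0
  have ht0' : 0 ≤ t0 := ht0
  have key : ∀ t, 0 ≤ t → ∀ k, |(∫ x, x * f x ∂(n t)) - ∫ x, x * f x * cut k x ∂(n t)|
      ≤ 1 - ∫ x, x * cut k x ∂(n t) := by
    intro t ht k
    have h := hP t ht
    have hc := (cut_smooth k).continuous
    have hfc := hf.continuous
    have i1 : Integrable (fun x => x * f x) (n t) := by
      refine h.int.mono' (by fun_prop) ?_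
      filter_upwards [h.pos] with x hx
      rw [norm_mul, Real.norm_eq_abs, abs_of_pos hx]
      exact mul_le_of_le_one_right hx.le (hb x hx.le)
    have i2 : Integrable (fun x => x * f x * cut k x) (n t) := by
      refine i1.norm.mono' (by fun_prop) ?_
      filter_upwards with x
      rw [norm_mul _ (cut k x), Real.norm_eq_abs (cut k x), abs_of_nonneg (cut_nonneg _ _)]
      exact mul_le_of_le_one_right (norm_nonneg _) (cut_le_one _ _)
    have i3 : Integrable (fun x => x * cut k x) (n t) := by
      refine h.int.norm.mono' (by fun_prop) ?_
      filter_upwards with x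
      rw [norm_mul _ (cut k x), Real.norm_eq_abs (cut k x), abs_of_nonneg (cut_nonneg _ _)]
      exact mul_le_of_le_one_right (norm_nonneg _) (cut_le_one _ _)
    rw [← h.one, ← integral_sub i1 i2, ← integral_sub h.int i3]
    rw [← Real.norm_eq_abs]; refine norm_integral_le_of_norm_le (g := fun a => a - a * cut k a) (h.int.sub i3) ?_
    filter_upwards [h.pos] with x hx
    have : x * f x - x * f x * cut k x = (f x) * (x * (1 - cut k x)) := by ring
    have h1 : 0 ≤ x * (1 - cut k x) := mul_nonneg hx.le (by linarith [cut_le_one k x])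
    rw [this, norm_mul, Real.norm_eq_abs, Real.norm_eq_abs, abs_of_nonneg h1]
    calc |f x| * (x * (1 - cut k x)) ≤ 1 * (x * (1 - cut k x)) := by gcongr; exact hb x hx.le
      _ = _ := by ring
  have hlim : Tendsto (fun k => ∫ x, x * cut k x ∂(n t0)) atTop (𝓝 1) := by
    have h1 := mass_tendsto_cut S ht0'
    rw [(hP t0 ht0').mass] at h1
    have h2 := (ENNReal.tendsto_toReal ENNReal.one_ne_top).comp h1
    simp only [ENNReal.toReal_one] at h2
    refine h2.congr fun k => ?_
    simp only [Function.comp]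
    apply ENNReal.toReal_ofReal
    apply integral_nonneg_of_ae
    filter_upwards [S.pos t0 ht0'] with x hx using mul_nonneg hx.le (cut_nonneg _ _)
  rw [Metric.continuousWithinAt_iff']
  intro ε hε
  obtain ⟨k, hk⟩ := (hlim.eventually (lt_mem_nhds (show 1 - ε / 4 < 1 by linarith))).exists
  have hc1 := (S.cont (isTest_cut (f := fun x => x) contDiff_id k)) t0 ht0
  have hc2 := (S.cont (isTest_cut (f := fun x => x * f x) (contDiff_id.mul hf) k)) t0 ht0
  filter_upwards [hc1.eventually_const_lt hk, Metric.continuousWithinAt_iff'.1 hc2 (ε / 4) (by linarith),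
    self_mem_nhdsWithin] with t h1 h2 h3
  have a1 := key t h3 k
  have a2 := key t0 ht0' k
  rw [Real.dist_eq] at h2 ⊢
  rw [abs_le] at a1 a2
  rw [abs_lt] at h2 ⊢
  constructor <;> linarith [a1.1, a1.2, a2.1, a2.2, h2.1, h2.2]

lemma etas_cont (S : Sol n) (hP : ∀ t, 0 ≤ t → PM (n t)) {s : ℂ} (hs : 0 ≤ s.re) :
    ContinuousOn (fun t => etas (n t) s) (Ici 0) := by
  have hsm : ContDiff ℝ (⊤ : ℕ∞) (fun x : ℝ => Complex.exp (-(s * (x:ℝ)))) := by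
    have : ContDiff ℝ (⊤ : ℕ∞) (fun x : ℝ => (x:ℂ)) := Complex.ofRealCLM.contDiff
    fun_prop
  have c1 := cont_xf S hP (f := fun x => (Complex.exp (-(s * (x:ℝ)))).re)
    (Complex.reCLM.contDiff.comp hsm) fun x hx =>
      (Complex.abs_re_le_norm _).trans (norm_exp_neg_le (re_mul_nonneg hs hx))
  have c2 := cont_xf S hP (f := fun x => (Complex.exp (-(s * (x:ℝ)))).im)
    (Complex.imCLM.contDiff.comp hsm) fun x hx =>
      (Complex.abs_im_le_norm _).trans (norm_exp_neg_le (re_mul_nonneg hs hx))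
  have := (Complex.continuous_ofReal.comp_continuousOn c1).add
    ((Complex.continuous_ofReal.comp_continuousOn c2).mul (continuousOn_const (c := Complex.I)))
  refine this.congr fun t ht => ?_
  have e1 := Complex.reCLM.integral_comp_comm ((hP t ht).etas_int hs)
  have e2 := Complex.imCLM.integral_comp_comm ((hP t ht).etas_int hs)
  simp only [Complex.reCLM_apply, Complex.imCLM_apply, Complex.re_ofReal_mul, Complex.im_ofReal_mul] at e1 e2
  simp only [Pi.add_apply, Function.comp_def, Pi.mul_apply]
  rw [e1, e2, ← etas, Complex.re_add_im]

lemma lam_cont (S : Sol n) (hP : ∀ t, 0 ≤ t → PM (n t)) {u : ℝ} (hu : 0 ≤ u) :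
    ContinuousOn (fun t => lam (n t) u) (Ici 0) := by
  refine cont_xf S hP (f := fun x => Real.exp (-(u * x))) (by fun_prop) fun x hx => ?_
  rw [abs_of_nonneg (Real.exp_pos _).le, Real.exp_le_one_iff]
  nlinarith

lemma eta_ftc (S : Sol n) (hP : ∀ t, 0 ≤ t → PM (n t)) {s : ℂ} (hs : 0 ≤ s.re) {c d : ℝ}
    (hc : 0 ≤ c) (hcd : c ≤ d) :
    (eta (n d) s).re - (eta (n c) s).re
        = ∫ t in c..d, (eta (n t) s * etas (n t) s - eta (n t) s).re ∧
    (eta (n d) s).im - (eta (n c) s).im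
        = ∫ t in c..d, (eta (n t) s * etas (n t) s - eta (n t) s).im := by
  have hm : ∀ t ∈ Icc c d, mass (n t) ≠ ⊤ := fun t ht => by
    rw [(hP t (hc.trans ht.1)).mass]; simp
  have hM : ∀ t ∈ Icc c d, M (n t) = 1 := fun t ht => by
    rw [M, (hP t (hc.trans ht.1)).mass]; simp
  have hW : ∀ t ∈ Icc c d, E (n t) ≤ 1 := fun t ht => by
    rw [← hM t ht]; exact E_le_M S (hc.trans ht.1) (hm t ht)
  have hMi : IntegrableOn (fun t => M (n t)) (Icc c d) :=
    (integrableOn_const (C := (1:ℝ)) (by simp)).congr_fun (fun t ht => (hM t ht).symm) measurableSet_Icc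
  constructor
  · have := S.wf hc hcd hW hMi (nice_re hs) (Or.inr hm)
    rw [(hP d (hc.trans hcd)).eta_re_eq hs, (hP c hc).eta_re_eq hs] at this
    rw [this]
    apply intervalIntegral.integral_congr
    intro t ht
    rw [uIcc_of_le hcd] at ht
    simp only [q, hm t ht, if_false]
    exact (hP t (hc.trans ht.1)).Q_re hs
  · have := S.wf hc hcd hW hMi (nice_im hs) (Or.inr hm)
    rw [(hP d (hc.trans hcd)).eta_im_eq hs, (hP c hc).eta_im_eq hs] at this
    rw [this]
    apply intervalIntegral.integral_congr
    intro t ht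
    rw [uIcc_of_le hcd] at ht
    simp only [q, hm t ht, if_false]
    exact (hP t (hc.trans ht.1)).Q_im hs

end
end AK
end

section
open MeasureTheory Set Filter Topology
namespace AK

section
variable {n : ℝ → Measure ℝ}

lemma eta_lip (S : Sol n) (hP : ∀ t, 0 ≤ t → PM (n t)) {s : ℂ} (hs : 0 ≤ s.re) {c d : ℝ}
    (hc : 0 ≤ c) (hcd : c ≤ d) : ‖eta (n d) s - eta (n c) s‖ ≤ 4 * ‖s‖ * (d - c) := by
  obtain ⟨h1, h2⟩ := eta_ftc S hP hs hc hcd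
  have hb : ∀ t ∈ uIoc c d, ‖eta (n t) s * etas (n t) s - eta (n t) s‖ ≤ 2 * ‖s‖ := by
    intro t ht
    rw [uIoc_of_le hcd] at ht
    have h := hP t (hc.trans ht.1.le)
    have a := h.eta_le hs
    have b := h.etas_le hs
    calc _ ≤ ‖eta (n t) s * etas (n t) s‖ + ‖eta (n t) s‖ := norm_sub_le _ _
      _ ≤ ‖s‖ * 1 + ‖s‖ := by rw [norm_mul]; gcongr
      _ = _ := by ring
  have r1 := intervalIntegral.norm_integral_le_of_norm_le_const
    (f := fun t => (eta (n t) s * etas (n t) s - eta (n t) s).re)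
    (fun t ht => (Complex.abs_re_le_norm _).trans (hb t ht))
  have r2 := intervalIntegral.norm_integral_le_of_norm_le_const
    (f := fun t => (eta (n t) s * etas (n t) s - eta (n t) s).im)
    (fun t ht => (Complex.abs_im_le_norm _).trans (hb t ht))
  rw [← h1, abs_of_nonneg (by linarith : 0 ≤ d - c), Real.norm_eq_abs] at r1
  rw [← h2, abs_of_nonneg (by linarith : 0 ≤ d - c), Real.norm_eq_abs] at r2
  calc _ ≤ |(eta (n d) s - eta (n c) s).re| + |(eta (n d) s - eta (n c) s).im| :=
        Complex.norm_le_abs_re_add_abs_im _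
    _ ≤ 2 * ‖s‖ * (d - c) + 2 * ‖s‖ * (d - c) := by
        rw [Complex.sub_re, Complex.sub_im]; gcongr
    _ = _ := by ring

lemma eta_cont (S : Sol n) (hP : ∀ t, 0 ≤ t → PM (n t)) {s : ℂ} (hs : 0 ≤ s.re) :
    ContinuousOn (fun t => eta (n t) s) (Ici 0) := by
  have : LipschitzOnWith (4 * ‖s‖₊) (fun t => eta (n t) s) (Ici 0) := by
    apply LipschitzOnWith.of_dist_le_mul
    intro x hx y hy
    rw [dist_eq_norm, Real.dist_eq]
    push_cast
    rcases le_total x y with h | h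
    · rw [norm_sub_rev, abs_sub_comm, abs_of_nonneg (by linarith : 0 ≤ y - x)]
      exact eta_lip S hP hs hx h
    · rw [abs_of_nonneg (by linarith : 0 ≤ x - y)]
      exact eta_lip S hP hs hy h
  exact this.continuousOn

lemma eta_deriv (S : Sol n) (hP : ∀ t, 0 ≤ t → PM (n t)) {s : ℂ} (hs : 0 ≤ s.re) {t : ℝ} (ht : 0 ≤ t) :
    HasDerivWithinAt (fun r => eta (n r) s) (eta (n t) s * etas (n t) s - eta (n t) s) (Ici 0) t := by
  set g : ℝ → ℂ := fun r => eta (n (max r 0)) s * etas (n (max r 0)) s - eta (n (max r 0)) s with hg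
  have hmax : Continuous fun r : ℝ => max r 0 := by fun_prop
  have c1 : Continuous fun r : ℝ => eta (n (max r 0)) s :=
    (eta_cont S hP hs).comp_continuous hmax fun x => mem_Ici.2 (le_max_right _ _)
  have c2 : Continuous fun r : ℝ => etas (n (max r 0)) s :=
    (etas_cont S hP hs).comp_continuous hmax fun x => mem_Ici.2 (le_max_right _ _)
  have hgc : Continuous g := (c1.mul c2).sub c1
  have hd : HasDerivAt (fun r => eta (n 0) s + ∫ u in (0:ℝ)..r, g u) (g t) t :=
    (intervalIntegral.integral_hasDerivAt_right (hgc.intervalIntegrable _ _)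
      (hgc.stronglyMeasurableAtFilter _ _) hgc.continuousAt).const_add _
  have hgt : g t = eta (n t) s * etas (n t) s - eta (n t) s := by simp [hg, max_eq_left ht]
  rw [← hgt]
  have key : ∀ r ∈ Ici (0:ℝ), eta (n r) s = eta (n 0) s + ∫ u in (0:ℝ)..r, g u := by
    intro r hr
    obtain ⟨h1, h2⟩ := eta_ftc S hP hs le_rfl hr
    have hcg : ∀ u ∈ uIcc 0 r, g u = eta (n u) s * etas (n u) s - eta (n u) s := by
      intro u hu
      rw [uIcc_of_le hr] at hu
      simp [hg, max_eq_left hu.1]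
    have e1 := Complex.reCLM.intervalIntegral_comp_comm (hgc.intervalIntegrable 0 r (μ := volume))
    have e2 := Complex.imCLM.intervalIntegral_comp_comm (hgc.intervalIntegrable 0 r (μ := volume))
    simp only [Complex.reCLM_apply, Complex.imCLM_apply] at e1 e2
    rw [intervalIntegral.integral_congr (fun u hu => by rw [← hcg u hu])] at h1 h2
    apply Complex.ext
    · rw [Complex.add_re, ← e1, ← h1]; ring
    · rw [Complex.add_im, ← e2, ← h2]; ring
  exact hd.hasDerivWithinAt.congr (fun r hr => key r hr) (key t ht)

lemma eta_chain (S : Sol n) (hP : ∀ t, 0 ≤ t → PM (n t)) {T : ℝ} {σ : ℝ → ℂ} {σ' : ℂ}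
    (hσ : ∀ r ∈ Icc 0 T, 0 ≤ (σ r).re) {r : ℝ} (hr : r ∈ Icc 0 T)
    (hd : HasDerivWithinAt σ σ' (Icc 0 T) r) :
    HasDerivWithinAt (fun r => eta (n r) (σ r))
      (eta (n r) (σ r) * etas (n r) (σ r) - eta (n r) (σ r) + σ' * etas (n r) (σ r)) (Icc 0 T) r := by
  have hsub : Icc 0 T ⊆ Ici (0:ℝ) := fun x hx => hx.1
  have t1 := ((eta_deriv S hP (hσ r hr) hr.1).mono hsub)
  have hΔ : (fun r' => σ r' - σ r) =O[𝓝[Icc 0 T] r] fun r' => r' - r := by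
    have h1 : (fun r' => (r' - r) • σ') =O[𝓝[Icc 0 T] r] fun r' => r' - r :=
      Asymptotics.IsBigO.of_bound ‖σ'‖ (Eventually.of_forall fun x => by rw [norm_smul, mul_comm])
    exact (hd.isLittleO.isBigO.add h1).congr_left fun r' => by ring
  have hΔ0 : Tendsto (fun r' => ‖σ r' - σ r‖) (𝓝[Icc 0 T] r) (𝓝 0) := by
    have := (hd.continuousWithinAt.sub (continuousWithinAt_const (b := σ r))).norm
    simpa [ContinuousWithinAt] using this
  have hlam : Tendsto (fun r' => 4 * (1 - lam (n r') ‖σ r' - σ r‖)) (𝓝[Icc 0 T] r) (𝓝 0) := by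
    rw [Metric.tendsto_nhds]
    intro ε hε
    have l1 := (hP r hr.1).lam_tendsto
    obtain ⟨u, hu1, hu2⟩ := ((l1.eventually (lt_mem_nhds (show 1 - ε / 4 < 1 by linarith))).and
      self_mem_nhdsWithin).exists
    have hu0 : 0 < u := hu2
    have l2 := ((lam_cont S hP hu0.le).mono hsub) r hr
    filter_upwards [l2.eventually_const_lt hu1, hΔ0.eventually (gt_mem_nhds hu0), self_mem_nhdsWithin]
      with r' h1 h2 h3
    have p := hP r' h3.1
    have a := p.lam_le (norm_nonneg (σ r' - σ r)) h2.le
    have b := p.lam_le_one (norm_nonneg (σ r' - σ r))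
    rw [Real.dist_eq, sub_zero, abs_of_nonneg (by linarith)]
    linarith
  have t2 : (fun r' => eta (n r') (σ r') - eta (n r') (σ r) - (σ r' - σ r) * etas (n r') (σ r))
      =o[𝓝[Icc 0 T] r] fun r' => r' - r := by
    have h1 : (fun r' => ‖σ r' - σ r‖ * (4 * (1 - lam (n r') ‖σ r' - σ r‖)))
        =o[𝓝[Icc 0 T] r] fun r' => (r' - r) * (1:ℝ) :=
      hΔ.norm_left.mul_isLittleO ((Asymptotics.isLittleO_one_iff ℝ).2 hlam)
    simp only [mul_one] at h1
    refine Asymptotics.IsBigO.trans_isLittleO (Asymptotics.IsBigO.of_bound 1 ?_) h1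
    filter_upwards [self_mem_nhdsWithin] with r' h3
    rw [one_mul]
    exact ((hP r' h3.1).eta_sub (hσ r hr) (hσ r' h3)).trans (le_abs_self _)
  have t3 : (fun r' => (σ r' - σ r) * (etas (n r') (σ r) - etas (n r) (σ r)))
      =o[𝓝[Icc 0 T] r] fun r' => r' - r := by
    have h0 : Tendsto (fun r' => etas (n r') (σ r) - etas (n r) (σ r)) (𝓝[Icc 0 T] r) (𝓝 0) := by
      have := (((etas_cont S hP (hσ r hr)).mono hsub) r hr).sub
        (continuousWithinAt_const (b := etas (n r) (σ r)))
      rw [ContinuousWithinAt] at this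
      rw [Pi.sub_apply, sub_self] at this
      exact this
    have h1 := hΔ.mul_isLittleO ((Asymptotics.isLittleO_one_iff ℝ).2 h0)
    simpa using h1
  have t4 := hd.isLittleO.const_mul_left (etas (n r) (σ r))
  rw [hasDerivWithinAt_iff_isLittleO]
  refine (((t1.isLittleO.add t2).add t3).add t4).congr (fun r' => ?_) (fun r' => rfl)
  simp only [Complex.real_smul]
  ring

/-- Explicit solution along characteristics. -/
lemma charac (S : Sol n) (hP : ∀ t, 0 ≤ t → PM (n t)) {t : ℝ} (ht : 0 ≤ t) {s : ℂ} (hs : 0 ≤ s.re) :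
    eta (n 0) (s + (Real.exp t - 1) * eta (n t) s) = Real.exp t * eta (n t) s := by
  set Y := eta (n t) s with hY
  have hYr : 0 ≤ Y.re := (hP t ht).eta_re hs
  set σ : ℝ → ℂ := fun r => s + ((Real.exp (t - r) : ℝ) - 1) * Y with hσd
  have hσ : ∀ r ∈ Icc 0 t, 0 ≤ (σ r).re := by
    intro r hr
    have : (1:ℝ) ≤ Real.exp (t - r) := Real.one_le_exp (by linarith [hr.2])
    have e : (σ r).re = s.re + (Real.exp (t - r) - 1) * Y.re := by
      simp only [hσd]
      rw [← Complex.ofReal_one, ← Complex.ofReal_sub, Complex.add_re, Complex.re_ofReal_mul]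
    rw [e]
    have := mul_nonneg (sub_nonneg.2 this) hYr
    linarith
  set H : ℝ → ℂ := fun r => (Real.exp r : ℝ) * eta (n r) (σ r) - (Real.exp t : ℝ) * Y with hH
  have hHd : ∀ r ∈ Icc 0 t, HasDerivWithinAt H (etas (n r) (σ r) * H r) (Icc 0 t) r := by
    intro r hr
    have d1 : HasDerivAt σ (-(Real.exp (t - r) : ℝ) * Y) r := by
      have a : HasDerivAt (fun r : ℝ => Real.exp (t - r)) (-Real.exp (t - r)) r := by
        simpa using ((hasDerivAt_id r).const_sub t).exp
      have b := ((a.ofReal_comp.sub_const 1).mul_const Y).const_add s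
      exact b.congr_deriv (by push_cast; ring)
    have d2 := eta_chain S hP hσ hr d1.hasDerivWithinAt
    have d3 := ((Real.hasDerivAt_exp r).ofReal_comp).hasDerivWithinAt (s := Icc 0 t)
    have d4 := (d3.mul d2).sub_const ((Real.exp t : ℝ) * Y : ℂ)
    refine d4.congr_deriv ?_
    have : (Real.exp t : ℂ) = (Real.exp r : ℝ) * (Real.exp (t - r) : ℝ) := by
      rw [← Complex.ofReal_mul, ← Real.exp_add]; congr 2; ring
    simp only [hH]
    rw [this]; ring
  have hg := eq_zero_of_abs_deriv_le_mul_abs_self_of_eq_zero_right (f := fun u => H (t - u))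
    (f' := fun u => -(etas (n (t - u)) (σ (t - u)) * H (t - u))) (K := 1) (a := 0) (b := t)
  have hmaps : MapsTo (fun u => t - u) (Icc 0 t) (Icc 0 t) := fun u hu => by
    constructor <;> linarith [hu.1, hu.2]
  have hd' : ∀ u ∈ Icc 0 t, HasDerivWithinAt (fun u => H (t - u))
      (-(etas (n (t - u)) (σ (t - u)) * H (t - u))) (Icc 0 t) u := by
    intro u hu
    have a : HasDerivWithinAt (fun u : ℝ => t - u) (-1) (Icc 0 t) u := by
      simpa using ((hasDerivAt_id u).const_sub t).hasDerivWithinAt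
    have := (hHd (t - u) (hmaps hu)).scomp u a hmaps
    simpa [Function.comp_def] using this
  have h0 := hg (fun u hu => (hd' u hu).continuousWithinAt)
    (fun u hu => (hd' u (Ico_subset_Icc_self hu)).mono_of_mem_nhdsWithin (Icc_mem_nhdsGE_of_mem hu))
    (by simp [hH, hσd, ← hY]) (fun u hu => by
      have hu' := hmaps (Ico_subset_Icc_self hu)
      rw [norm_neg, norm_mul]
      gcongr
      exact (hP _ hu'.1).etas_le (hσ _ hu')) t (right_mem_Icc.2 ht)
  simp only [sub_self, hH, hσd, sub_zero, Real.exp_zero, Complex.ofReal_one, one_mul] at h0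
  exact sub_eq_zero.1 h0

end
end AK
end

section
open MeasureTheory Set Filter Topology
namespace AK

lemma PM.eta_hasDeriv {μ : Measure ℝ} (h : PM μ) {s : ℂ} (hs : 0 ≤ s.re) :
    HasDerivWithinAt (eta μ) (etas μ s) {z : ℂ | 0 ≤ z.re} s := by
  have hlam : Tendsto (fun s' => 4 * (1 - lam μ ‖s' - s‖)) (𝓝[{z : ℂ | 0 ≤ z.re}] s) (𝓝 0) := by
    rw [Metric.tendsto_nhds]
    intro ε hε
    obtain ⟨u, hu1, hu2⟩ := ((h.lam_tendsto.eventually (lt_mem_nhds (show 1 - ε / 4 < 1 by linarith))).and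
      self_mem_nhdsWithin).exists
    have hu0 : 0 < u := hu2
    have : {z : ℂ | ‖z - s‖ < u} ∈ 𝓝 s := by
      have := Metric.ball_mem_nhds s hu0
      simpa [Metric.ball, dist_eq_norm] using this
    filter_upwards [mem_nhdsWithin_of_mem_nhds this] with z hz
    have hz' : ‖z - s‖ < u := hz
    have a := h.lam_le (norm_nonneg (z - s)) hz'.le
    have b := h.lam_le_one (norm_nonneg (z - s))
    rw [Real.dist_eq, sub_zero, abs_of_nonneg (by linarith)]
    linarith
  rw [hasDerivWithinAt_iff_isLittleO]
  have h1 : (fun s' => ‖s' - s‖ * (4 * (1 - lam μ ‖s' - s‖)))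
      =o[𝓝[{z : ℂ | 0 ≤ z.re}] s] fun s' => ‖s' - s‖ * (1:ℝ) :=
    (Asymptotics.isBigO_refl _ _).mul_isLittleO ((Asymptotics.isLittleO_one_iff ℝ).2 hlam)
  simp only [mul_one] at h1
  refine Asymptotics.IsBigO.trans_isLittleO (Asymptotics.IsBigO.of_bound 1 ?_) (Asymptotics.isLittleO_norm_right.1 h1)
  filter_upwards [self_mem_nhdsWithin] with s' h3
  rw [one_mul, smul_eq_mul]
  exact (h.eta_sub hs h3).trans (le_abs_self _)

lemma PM.eta_line {μ : Measure ℝ} (h : PM μ) (κ : ℝ) :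
    HasDerivAt (fun κ : ℝ => eta μ (κ * Complex.I)) (Complex.I * etas μ (κ * Complex.I)) κ := by
  have h0 : 0 ≤ ((κ:ℂ) * Complex.I).re := by simp
  have a := h.eta_hasDeriv h0
  have b : HasDerivWithinAt (fun κ : ℝ => (κ:ℂ) * Complex.I) Complex.I univ κ := by
    have := ((hasDerivAt_id κ).ofReal_comp).mul_const Complex.I
    simpa using this
  have := a.scomp κ b (fun x _ => by simp [mem_ofPred_eq])
  simpa [Function.comp_def] using this

section
variable {n : ℝ → Measure ℝ}

/-- starting point of the characteristic arriving at `iκ` -/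
noncomputable def s0 (n : ℝ → Measure ℝ) (t κ : ℝ) : ℂ :=
  κ * Complex.I + (Real.exp t - 1) * eta (n t) (κ * Complex.I)

lemma s0_re (hP : ∀ t, 0 ≤ t → PM (n t)) {t : ℝ} (ht : 0 ≤ t) (κ : ℝ) : 0 ≤ (s0 n t κ).re := by
  have h0 : 0 ≤ ((κ:ℂ) * Complex.I).re := by simp
  have h1 := (hP t ht).eta_re h0
  have h2 := Real.one_le_exp ht
  rw [s0, ← Complex.ofReal_one, ← Complex.ofReal_sub, Complex.add_re, Complex.re_ofReal_mul (_ - _)]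
  have := mul_nonneg (sub_nonneg.2 h2) h1
  linarith

lemma s0_cont (hP : ∀ t, 0 ≤ t → PM (n t)) {t : ℝ} (ht : 0 ≤ t) : Continuous (s0 n t) := by
  have : Continuous (fun κ : ℝ => eta (n t) (κ * Complex.I)) :=
    continuous_iff_continuousAt.2 fun κ => ((hP t ht).eta_line κ).continuousAt
  unfold s0
  fun_prop

lemma s0_zero (t : ℝ) : s0 n t 0 = 0 := by simp [s0, eta]

lemma s0_le (hP : ∀ t, 0 ≤ t → PM (n t)) {t : ℝ} (ht : 0 ≤ t) (κ : ℝ) :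
    ‖s0 n t κ‖ ≤ Real.exp t * |κ| := by
  have h0 : 0 ≤ ((κ:ℂ) * Complex.I).re := by simp
  have h1 := (hP t ht).eta_le h0
  have h2 := Real.one_le_exp ht
  have h3 : ‖(κ:ℂ) * Complex.I‖ = |κ| := by simp
  rw [h3] at h1
  have h4 : ‖((Real.exp t : ℝ):ℂ) - 1‖ = Real.exp t - 1 := by
    rw [← Complex.ofReal_one, ← Complex.ofReal_sub, Complex.norm_real, Real.norm_of_nonneg (by linarith)]
  calc _ ≤ ‖(κ:ℂ) * Complex.I‖ + ‖(((Real.exp t : ℝ):ℂ) - 1) * eta (n t) (κ * Complex.I)‖ := norm_add_le _ _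
    _ ≤ |κ| + (Real.exp t - 1) * |κ| := by
      rw [h3, norm_mul, h4]
      gcongr
    _ = _ := by ring

lemma s0_eq (S : Sol n) (hP : ∀ t, 0 ≤ t → PM (n t)) {t : ℝ} (ht : 0 ≤ t) (κ : ℝ) :
    s0 n t κ - (1 - Real.exp (-t) : ℝ) * eta (n 0) (s0 n t κ) = κ * Complex.I := by
  have h0 : 0 ≤ ((κ:ℂ) * Complex.I).re := by simp
  have h := charac S hP ht h0
  rw [← s0] at h
  rw [h, s0]
  have : ((Real.exp (-t) : ℝ):ℂ) * (Real.exp t : ℝ) = 1 := by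
    rw [← Complex.ofReal_mul, ← Real.exp_add]; simp
  push_cast at this ⊢
  linear_combination (-eta (n t) (κ * Complex.I)) * (-this)

lemma phi_eq (S : Sol n) (hP : ∀ t, 0 ≤ t → PM (n t)) {t : ℝ} (ht : 0 ≤ t) (κ : ℝ) :
    etas (n t) (κ * Complex.I) * (1 - (1 - Real.exp (-t) : ℝ) * etas (n 0) (s0 n t κ))
      = Real.exp (-t) * etas (n 0) (s0 n t κ) := by
  have hd := (hP t ht).eta_line κ
  have d1 : HasDerivAt (s0 n t) (Complex.I * (1 + (Real.exp t - 1) * etas (n t) (κ * Complex.I))) κ := by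
    have a : HasDerivAt (fun κ : ℝ => (κ:ℂ) * Complex.I) Complex.I κ := by
      have := ((hasDerivAt_id κ).ofReal_comp).mul_const Complex.I
      simpa using this
    have := a.fun_add (hd.const_mul ((Real.exp t : ℂ) - 1))
    refine this.congr_deriv ?_
    ring
  have d2 := ((hP 0 le_rfl).eta_hasDeriv (s0_re hP ht κ)).scomp κ (d1.hasDerivWithinAt (s := univ))
    (fun x _ => s0_re hP ht x)
  have e : (eta (n 0) ∘ s0 n t) = fun κ : ℝ => (Real.exp t : ℂ) * eta (n t) (κ * Complex.I) := by
    funext x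
    exact charac S hP ht (by simp)
  rw [e, hasDerivWithinAt_univ] at d2
  have := d2.unique (hd.const_mul (Real.exp t : ℂ))
  simp only [smul_eq_mul] at this
  have h3 : (1 + (Real.exp t - 1) * etas (n t) (κ * Complex.I)) * etas (n 0) (s0 n t κ)
      = (Real.exp t : ℂ) * etas (n t) (κ * Complex.I) := by
    apply mul_left_cancel₀ Complex.I_ne_zero
    linear_combination this
  have h4 : ((Real.exp (-t) : ℝ):ℂ) * (Real.exp t : ℝ) = 1 := by
    rw [← Complex.ofReal_mul, ← Real.exp_add]; simp
  push_cast at h3 h4 ⊢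
  linear_combination (-Complex.exp (-t)) * h3 + (-etas (n t) (κ * Complex.I)
    + etas (n t) (κ * Complex.I) * etas (n 0) (s0 n t κ)) * h4

end
end AK
end

section
open MeasureTheory Set Filter Topology
namespace AK

lemma norm_add_ge {a : ℝ} {z : ℂ} (ha : 0 ≤ a) (hz : 0 ≤ z.re) : ‖z‖ ≤ ‖(a:ℂ) + z‖ := by
  rw [← sq_le_sq₀ (norm_nonneg _) (norm_nonneg _), Complex.sq_norm, Complex.sq_norm,
    Complex.normSq_apply, Complex.normSq_apply]
  simp
  nlinarith

lemma norm_add_ge' {a : ℝ} {z : ℂ} (ha : 0 ≤ a) (hz : 0 ≤ z.re) : a ≤ ‖(a:ℂ) + z‖ := by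
  have := Complex.re_le_norm ((a:ℂ) + z)
  simp at this
  linarith

set_option maxHeartbeats 1000000 in
lemma core {ε A k : ℝ} {z r r' φ v : ℂ} (hε : 0 < ε) (hε2 : ε ≤ 1 / 2) (hA : 1 ≤ A) (hz : 0 ≤ z.re)
    (hs : A * (ε * ‖z‖) ≤ 1 / 16) (hk : ‖z‖ ≤ |k|) (hk2 : ‖z‖ ^ 2 ≤ 8 * |k|)
    (hr : ‖r‖ ≤ A * ε * ‖z‖ ^ 3) (hr' : ‖r'‖ ≤ A * ε * ‖z‖ ^ 2)
    (eq1 : z + (1 - ε) * z ^ 2 / 2 - (1 - ε) * r = k * Complex.I)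
    (eq2 : φ * (1 + (1 - ε) * z - (1 - ε) * r') = 1 - ε * z + ε * r')
    (hv : 0 < v.re) (hv2 : v ^ 2 = 1 + 2 * k * Complex.I) :
    ‖φ - 1 / v‖ ≤ 40 * (1 + 2 * A) * ε * (|k| / (1 + |k|)) := by
  set w : ℂ := 1 + z with hw
  have hτ : ‖(1:ℂ) - ε‖ ≤ 1 := by
    rw [← Complex.ofReal_one, ← Complex.ofReal_sub, Complex.norm_real, Real.norm_of_nonneg (by linarith)]
    linarith
  have hεn : ‖(ε:ℂ)‖ = ε := by rw [Complex.norm_real, Real.norm_of_nonneg hε.le]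
  have w1 : 1 ≤ ‖w‖ := by simpa using norm_add_ge' (a := 1) zero_le_one hz
  have w2 : ‖z‖ ≤ ‖w‖ := by simpa using norm_add_ge (a := 1) zero_le_one hz
  have w3 : ‖w‖ ≤ 1 + ‖z‖ := by simpa using norm_add_le (1:ℂ) z
  have hz0 := norm_nonneg z
  have hεz : ε * ‖z‖ ≤ 1 / 16 := by nlinarith [mul_nonneg hε.le hz0]
  set D : ℂ := 1 + (1 - ε) * z - (1 - ε) * r' with hD
  have hr'2 : ‖r'‖ ≤ ‖w‖ / 16 := by
    calc _ ≤ A * ε * ‖z‖ ^ 2 := hr'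
      _ = (A * (ε * ‖z‖)) * ‖z‖ := by ring
      _ ≤ 1 / 16 * ‖w‖ := by gcongr
      _ = _ := by ring
  have hDn : ‖w‖ / 4 ≤ ‖D‖ := by
    have h1 : ‖((1 - ε : ℝ) : ℂ) * w‖ ≤ ‖(ε:ℂ) + ((1 - ε : ℝ) : ℂ) * w‖ := by
      apply norm_add_ge hε.le
      rw [Complex.re_ofReal_mul]
      apply mul_nonneg (by linarith)
      simp [hw]; linarith
    rw [norm_mul, Complex.norm_real, Real.norm_of_nonneg (by linarith)] at h1
    have h2 : D = ((ε:ℂ) + ((1 - ε : ℝ) : ℂ) * w) - (1 - ε) * r' := by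
      rw [hD, hw]; push_cast; ring
    have h3 : ‖(1 - ε : ℂ) * r'‖ ≤ ‖w‖ / 16 := by
      rw [norm_mul]
      calc _ ≤ 1 * (‖w‖ / 16) := by gcongr
        _ = _ := one_mul _
    have h4 := norm_sub_norm_le ((ε:ℂ) + ((1 - ε : ℝ) : ℂ) * w) ((1 - ε) * r')
    rw [← h2] at h4
    nlinarith
  have hDpos : 0 < ‖D‖ := by linarith
  have hD0 : D ≠ 0 := norm_pos_iff.1 hDpos
  have hwpos : 0 < ‖w‖ := by linarith
  have hw0 : w ≠ 0 := norm_pos_iff.1 hwpos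
  have hv0 : v ≠ 0 := by rintro rfl; simp at hv
  have hvpos : 0 < ‖v‖ := norm_pos_iff.2 hv0
  have hk0 := abs_nonneg k
  -- first difference
  have f1 : ‖φ - 1 / w‖ ≤ 8 * (1 + 2 * A) * ε * (|k| / (1 + |k|)) := by
    have e : φ - 1 / w = (-(ε * z ^ 2) + ε * r' * w + (1 - ε) * r') / (D * w) := by
      have : φ = (1 - ε * z + ε * r') / D := by rw [eq_div_iff hD0, ← eq2]
      rw [this]
      field_simp
      rw [hD, hw]; ring
    have hn : ‖-(ε * z ^ 2) + ε * r' * w + (1 - ε) * r'‖ ≤ ε * ‖z‖ ^ 2 * (1 + 2 * A) := by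
      have a1 : ‖(ε:ℂ) * r' * w‖ ≤ A * ε * ‖z‖ ^ 2 := by
        rw [norm_mul, norm_mul, hεn]
        have : ε * ‖w‖ ≤ 1 := by nlinarith
        calc _ = ‖r'‖ * (ε * ‖w‖) := by ring
          _ ≤ ‖r'‖ * 1 := by gcongr
          _ ≤ _ := by linarith
      have a2 : ‖(1 - ε : ℂ) * r'‖ ≤ A * ε * ‖z‖ ^ 2 := by
        rw [norm_mul]
        calc _ ≤ 1 * ‖r'‖ := by gcongr
          _ ≤ _ := by linarith
      have a3 : ‖-((ε:ℂ) * z ^ 2)‖ = ε * ‖z‖ ^ 2 := by rw [norm_neg, norm_mul, norm_pow, hεn]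
      calc _ ≤ ‖-((ε:ℂ) * z ^ 2)‖ + ‖(ε:ℂ) * r' * w‖ + ‖(1 - ε : ℂ) * r'‖ := norm_add₃_le
        _ ≤ _ := by rw [a3]; linarith
    rw [e, norm_div, norm_mul]
    have hden : ‖w‖ ^ 2 / 4 ≤ ‖D‖ * ‖w‖ := by nlinarith
    have hq : ‖z‖ ^ 2 / ‖w‖ ^ 2 ≤ 2 * (|k| / (1 + |k|)) := by
      rw [← mul_div_assoc, div_le_div_iff₀ (by positivity) (by positivity)]
      have b1 : ‖z‖ ^ 2 ≤ ‖w‖ ^ 2 := by gcongr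
      rcases le_total |k| 1 with h | h
      · have : ‖z‖ ^ 2 ≤ |k| * ‖w‖ ^ 2 := by
          calc ‖z‖ ^ 2 = ‖z‖ * ‖z‖ := sq _
            _ ≤ |k| * ‖w‖ := by gcongr
            _ ≤ |k| * ‖w‖ ^ 2 := by gcongr; nlinarith
        nlinarith [sq_nonneg ‖z‖]
      · nlinarith [sq_nonneg ‖w‖]
    calc _ ≤ (ε * ‖z‖ ^ 2 * (1 + 2 * A)) / (‖w‖ ^ 2 / 4) := by gcongr
      _ = 4 * ε * (1 + 2 * A) * (‖z‖ ^ 2 / ‖w‖ ^ 2) := by field_simp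
      _ ≤ 4 * ε * (1 + 2 * A) * (2 * (|k| / (1 + |k|))) := by gcongr
      _ = _ := by ring
  have f2 : ‖1 / w - 1 / v‖ ≤ 32 * (1 + 2 * A) * ε * (|k| / (1 + |k|)) := by
    have hre : ‖v‖ / 2 ≤ ‖w + v‖ := by
      have h1 := Complex.re_le_norm (w + v)
      have h2 : 1 ≤ w.re := by simp [hw]; exact hz
      have h3 : |v.im| ≤ v.re := by
        have := congrArg Complex.re hv2
        simp [sq] at this
        apply abs_le_of_sq_le_sq _ hv.le
        nlinarith
      have h4 := Complex.norm_le_abs_re_add_abs_im v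
      rw [abs_of_pos hv] at h4
      rw [Complex.add_re] at h1
      linarith
    have hwvpos : 0 < ‖w + v‖ := by linarith
    have hwv0 : w + v ≠ 0 := norm_pos_iff.1 hwvpos
    have e : 1 / w - 1 / v = -(ε * z ^ 2 + 2 * (1 - ε) * r) / (w * v * (w + v)) := by
      field_simp
      rw [hw] at *
      linear_combination hv2 - 2 * eq1
    have hn : ‖-(ε * z ^ 2 + 2 * (1 - ε) * r)‖ ≤ ε * ‖z‖ ^ 2 * ((1 + 2 * A) * ‖w‖) := by
      have a1 : ‖(ε:ℂ) * z ^ 2‖ = ε * ‖z‖ ^ 2 := by rw [norm_mul, norm_pow, hεn]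
      have a2 : ‖2 * (1 - ε : ℂ) * r‖ ≤ 2 * (A * ε * ‖z‖ ^ 3) := by
        rw [norm_mul, norm_mul]
        calc _ ≤ ‖(2:ℂ)‖ * 1 * (A * ε * ‖z‖ ^ 3) := by gcongr
          _ = _ := by simp
      rw [norm_neg]
      calc _ ≤ ‖(ε:ℂ) * z ^ 2‖ + ‖2 * (1 - ε : ℂ) * r‖ := norm_add_le _ _
        _ ≤ ε * ‖z‖ ^ 2 * (1 + 2 * A * ‖z‖) := by rw [a1]; linarith
        _ ≤ _ := by gcongr; nlinarith
    have hvk : (1 + |k|) / 2 ≤ ‖v‖ ^ 2 := by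
      rw [← norm_pow, hv2]
      have h1 := Complex.re_le_norm (1 + 2 * k * Complex.I)
      have h2 := Complex.abs_im_le_norm (1 + 2 * k * Complex.I)
      simp [abs_mul] at h1 h2
      linarith
    rw [e, norm_div, norm_mul, norm_mul]
    calc _ ≤ (ε * ‖z‖ ^ 2 * ((1 + 2 * A) * ‖w‖)) / (‖w‖ * ‖v‖ * (‖v‖ / 2)) := by gcongr
      _ = 2 * ε * (1 + 2 * A) * (‖z‖ ^ 2 / ‖v‖ ^ 2) := by field_simp
      _ ≤ 2 * ε * (1 + 2 * A) * (8 * |k| / ((1 + |k|) / 2)) := by gcongr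
      _ = _ := by field_simp; ring
  calc _ = ‖(φ - 1 / w) + (1 / w - 1 / v)‖ := by congr 1; ring
    _ ≤ _ := norm_add_le _ _
    _ ≤ _ := add_le_add f1 f2
    _ = _ := by ring
end AK
end

section
open MeasureTheory Set Filter Topology
namespace AK

lemma ofReal_int {μ : Measure ℝ} {f : ℝ → ℝ} (c : ℝ) (h1 : ∫ x, f x ∂μ = c) :
    ∫ x, ((f x : ℝ) : ℂ) ∂μ = c := by
  rw [← h1]; exact integral_complex_ofReal

lemma PM.eta_exp {μ : Measure ℝ} (h : PM μ) (i2 : Integrable (fun x => x ^ 2) μ)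
    (m2 : ∫ x, x ^ 2 ∂μ = 1) (i3 : Integrable (fun x => x ^ 3) μ) {s : ℂ} (hs : 0 ≤ s.re) :
    ‖eta μ s - s + s ^ 2 / 2‖ ≤ (∫ x, x ^ 3 ∂μ) * ‖s‖ ^ 3 := by
  have j1 : Integrable (fun x : ℝ => s * ((x:ℝ):ℂ)) μ := h.intC.const_mul s
  have j2 : Integrable (fun x : ℝ => s ^ 2 / 2 * ((x ^ 2 : ℝ):ℂ)) μ := i2.ofReal.const_mul (s ^ 2 / 2)
  have e : eta μ s - s + s ^ 2 / 2
      = ∫ x : ℝ, ((1 - Complex.exp (-(s * (x:ℝ)))) - s * (x:ℝ) + s ^ 2 / 2 * ((x ^ 2 : ℝ):ℂ)) ∂μ := by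
    have j3 : Integrable (fun x : ℝ => (1 - Complex.exp (-(s * (x:ℝ)))) - s * (x:ℝ)) μ :=
      (h.eta_int hs).sub j1
    rw [integral_add j3 j2, integral_sub (h.eta_int hs) j1,
      integral_const_mul, integral_const_mul, ofReal_int 1 h.one, ofReal_int 1 m2, eta]
    simp
  rw [e, ← integral_mul_const]
  refine norm_integral_le_of_norm_le (i3.mul_const _) ?_
  filter_upwards [h.pos] with x hx
  have := e3 (re_mul_nonneg hs hx.le)
  rw [norm_mul, Complex.norm_real, Real.norm_of_nonneg hx.le] at this
  calc _ = ‖1 - Complex.exp (-(s * (x:ℝ))) - s * (x:ℝ) + (s * (x:ℝ)) ^ 2 / 2‖ := by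
        congr 1; push_cast; ring
    _ ≤ _ := this
    _ = _ := by ring

lemma PM.etas_exp {μ : Measure ℝ} (h : PM μ) (i2 : Integrable (fun x => x ^ 2) μ)
    (m2 : ∫ x, x ^ 2 ∂μ = 1) (i3 : Integrable (fun x => x ^ 3) μ) {s : ℂ} (hs : 0 ≤ s.re) :
    ‖etas μ s - 1 + s‖ ≤ (∫ x, x ^ 3 ∂μ) * ‖s‖ ^ 2 := by
  have j2 : Integrable (fun x : ℝ => s * ((x ^ 2 : ℝ):ℂ)) μ := i2.ofReal.const_mul s
  have e : etas μ s - 1 + s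
      = ∫ x : ℝ, ((x:ℂ) * Complex.exp (-(s * (x:ℝ))) - (x:ℝ) + s * ((x ^ 2 : ℝ):ℂ)) ∂μ := by
    have j3 : Integrable (fun x : ℝ => (x:ℂ) * Complex.exp (-(s * (x:ℝ))) - (x:ℝ)) μ :=
      (h.etas_int hs).sub h.intC
    rw [integral_add j3 j2, integral_sub (h.etas_int hs) h.intC,
      integral_const_mul, ofReal_int 1 h.one, ofReal_int 1 m2, etas]
    simp
  rw [e, ← integral_mul_const]
  refine norm_integral_le_of_norm_le (i3.mul_const _) ?_
  filter_upwards [h.pos] with x hx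
  have := e2 (a := 0) (by simp) (re_mul_nonneg hs hx.le)
  rw [sub_zero, norm_mul s, Complex.norm_real, Real.norm_of_nonneg hx.le] at this
  simp only [neg_zero, Complex.exp_zero, mul_one] at this
  calc _ = ‖(x:ℂ) * (Complex.exp (-(s * (x:ℝ))) - 1 + s * (x:ℝ))‖ := by
        congr 1; push_cast; ring
    _ = x * ‖Complex.exp (-(s * (x:ℝ))) - 1 + s * (x:ℝ)‖ := by
        rw [norm_mul, Complex.norm_real, Real.norm_of_nonneg hx.le]
    _ ≤ x * (‖s‖ * x) ^ 2 := by gcongr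
    _ = _ := by ring

section
variable {n : ℝ → Measure ℝ}

lemma s0_low (S : Sol n) (hP : ∀ t, 0 ≤ t → PM (n t)) (i2 : Integrable (fun x => x ^ 2) (n 0))
    (m2 : ∫ x, x ^ 2 ∂(n 0) = 1) (i3 : Integrable (fun x => x ^ 3) (n 0)) {A : ℝ}
    (hA : 1 ≤ A) (hA3 : ∫ x, x ^ 3 ∂(n 0) ≤ A) {t : ℝ} (ht : 0 ≤ t) (ht2 : Real.exp (-t) ≤ 1 / 2) {κ : ℝ}
    (hs : A * ‖s0 n t κ‖ ≤ 1 / 16) : ‖s0 n t κ‖ ^ 2 ≤ 8 * |κ| := by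
  have h := (hP 0 le_rfl).eta_exp i2 m2 i3 (s0_re hP ht κ)
  have he := s0_eq S hP ht κ
  have hre := s0_re hP ht κ
  set s := s0 n t κ
  set ε := Real.exp (-t)
  have hε : 0 < ε := Real.exp_pos _
  have hs0 := norm_nonneg s
  have hR : ‖eta (n 0) s - s + s ^ 2 / 2‖ ≤ ‖s‖ ^ 2 / 16 := by
    calc _ ≤ A * ‖s‖ ^ 3 := h.trans (by gcongr)
      _ = (A * ‖s‖) * ‖s‖ ^ 2 := by ring
      _ ≤ (1 / 16) * ‖s‖ ^ 2 := by gcongr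
      _ = _ := by ring
  have h1 : ‖((1 - ε : ℝ):ℂ) * s‖ ≤ ‖((2 * ε : ℝ):ℂ) + ((1 - ε : ℝ):ℂ) * s‖ := by
    apply norm_add_ge (by positivity)
    rw [Complex.re_ofReal_mul]
    exact mul_nonneg (by linarith) hre
  have hτ : ‖((1 - ε : ℝ):ℂ)‖ = 1 - ε := by
    rw [Complex.norm_real, Real.norm_of_nonneg (by linarith)]
  rw [norm_mul, hτ] at h1
  have e2 : s * (((2 * ε : ℝ):ℂ) + ((1 - ε : ℝ):ℂ) * s) =
      2 * (κ * Complex.I + ((1 - ε : ℝ):ℂ) * (eta (n 0) s - s + s ^ 2 / 2)) := by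
    rw [← he]; push_cast; ring
  have h3 := congrArg norm e2
  rw [norm_mul, norm_mul] at h3
  have h4 : ‖(κ:ℂ) * Complex.I + ((1 - ε : ℝ):ℂ) * (eta (n 0) s - s + s ^ 2 / 2)‖
      ≤ |κ| + 1 * (‖s‖ ^ 2 / 16) := by
    refine (norm_add_le _ _).trans ?_
    rw [norm_mul, norm_mul, hτ]
    simp only [Complex.norm_real, Complex.norm_I, mul_one, Real.norm_eq_abs]
    gcongr
    linarith
  have h5 : ‖s‖ * ((1 - ε) * ‖s‖) ≤ 2 * (|κ| + ‖s‖ ^ 2 / 16) := by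
    calc _ ≤ ‖s‖ * ‖((2 * ε : ℝ):ℂ) + ((1 - ε : ℝ):ℂ) * s‖ := by gcongr
      _ = _ := h3
      _ ≤ _ := by simp only [Complex.norm_ofNat]; linarith
  nlinarith [sq_nonneg ‖s‖]

lemma s0_small (S : Sol n) (hP : ∀ t, 0 ≤ t → PM (n t)) (i2 : Integrable (fun x => x ^ 2) (n 0))
    (m2 : ∫ x, x ^ 2 ∂(n 0) = 1) (i3 : Integrable (fun x => x ^ 3) (n 0)) {A : ℝ}
    (hA : 1 ≤ A) (hA3 : ∫ x, x ^ 3 ∂(n 0) ≤ A) {t : ℝ} (ht : 0 ≤ t) (ht2 : Real.exp (-t) ≤ 1 / 2) {κ : ℝ}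
    (hκ : |κ| ≤ 1 / (4096 * A ^ 2)) : A * ‖s0 n t κ‖ ≤ 1 / 16 := by
  by_contra hcon
  push Not at hcon
  set f : ℝ → ℝ := fun θ => A * ‖s0 n t (θ * κ)‖ with hf
  have hc : ContinuousOn f (Icc 0 1) := by
    have := s0_cont hP ht
    apply Continuous.continuousOn
    fun_prop
  have h01 := intermediate_value_Icc zero_le_one hc
  have hmem : (1 / 16 : ℝ) ∈ Icc (f 0) (f 1) := by
    constructor
    · simp [hf, s0_zero]
    · simp only [hf, one_mul]; exact hcon.le
  obtain ⟨θ, hθ, hθ2⟩ := h01 hmem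
  have hlow := s0_low S hP i2 m2 i3 hA hA3 ht ht2 (κ := θ * κ) hθ2.le
  have hθ3 : A * ‖s0 n t (θ * κ)‖ = 1 / 16 := hθ2
  have h1 : |θ * κ| ≤ 1 / (4096 * A ^ 2) := by
    rw [abs_mul, abs_of_nonneg hθ.1]
    calc _ ≤ 1 * |κ| := by gcongr; exact hθ.2
      _ ≤ _ := by linarith
  have h2 : (A * ‖s0 n t (θ * κ)‖) ^ 2 ≤ A ^ 2 * (8 * (1 / (4096 * A ^ 2))) := by
    rw [mul_pow]; gcongr; linarith
  rw [hθ3] at h2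
  have h3 : A ^ 2 * (8 * (1 / (4096 * A ^ 2))) = 1 / 512 := by
    field_simp; norm_num
  rw [h3] at h2
  norm_num at h2

lemma phi_bound (S : Sol n) (hP : ∀ t, 0 ≤ t → PM (n t)) (i2 : Integrable (fun x => x ^ 2) (n 0))
    (m2 : ∫ x, x ^ 2 ∂(n 0) = 1) (i3 : Integrable (fun x => x ^ 3) (n 0)) {A : ℝ}
    (hA : 1 ≤ A) (hA3 : ∫ x, x ^ 3 ∂(n 0) ≤ A) {t : ℝ} (ht : 0 ≤ t) (ht2 : Real.exp (-t) ≤ 1 / 2) {k : ℝ}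
    (hκ : |k| ≤ Real.exp (2 * t) / (4096 * A ^ 2)) {v : ℂ} (hv : 0 < v.re)
    (hv2 : v ^ 2 = 1 + 2 * k * Complex.I) :
    ‖etas (n t) ((Real.exp (-2 * t) * k : ℝ) * Complex.I) - 1 / v‖
      ≤ 40 * (1 + 2 * A) * Real.exp (-t) * (|k| / (1 + |k|)) := by
  have hE : Real.exp (-2 * t) = Real.exp (-t) ^ 2 := by rw [← Real.exp_nat_mul]; congr 1; push_cast; ring
  have hE1 : Real.exp (2 * t) = (Real.exp (-t) ^ 2)⁻¹ := by rw [← hE, ← Real.exp_neg]; congr 1; ring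
  have hE2 : Real.exp t = (Real.exp (-t))⁻¹ := by rw [← Real.exp_neg]; congr 1; ring
  set κ := Real.exp (-2 * t) * k with hκd
  have hκk : |κ| = Real.exp (-t) ^ 2 * |k| := by rw [hκd, abs_mul, hE, abs_of_nonneg (by positivity)]
  have hsm : |κ| ≤ 1 / (4096 * A ^ 2) := by
    rw [hκk]
    rw [hE1] at hκ
    calc _ ≤ Real.exp (-t) ^ 2 * ((Real.exp (-t) ^ 2)⁻¹ / (4096 * A ^ 2)) := by gcongr
      _ = _ := by field_simp
  have hs := s0_small S hP i2 m2 i3 hA hA3 ht ht2 hsm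
  have hs2 := s0_low S hP i2 m2 i3 hA hA3 ht ht2 hs
  have hs3 := s0_le hP ht κ
  have hR := (hP 0 le_rfl).eta_exp i2 m2 i3 (s0_re hP ht κ)
  have hR' := (hP 0 le_rfl).etas_exp i2 m2 i3 (s0_re hP ht κ)
  have he := s0_eq S hP ht κ
  have hp := phi_eq S hP ht κ
  have hre := s0_re hP ht κ
  rw [hE2] at hs3
  set ε := Real.exp (-t) with hεd
  have hε : 0 < ε := Real.exp_pos _
  have hεn : ‖(ε:ℂ)‖ = ε := by rw [Complex.norm_real, Real.norm_of_nonneg hε.le]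
  have hε0 : (ε:ℂ) ≠ 0 := by exact_mod_cast hε.ne'
  obtain ⟨z, hz⟩ : ∃ z : ℂ, s0 n t κ = ε * z := ⟨s0 n t κ / ε, by field_simp⟩
  rw [hz] at hs hs2 hs3 hR hR' he hp hre
  rw [norm_mul, hεn] at hs hs2 hs3 hR hR'
  rw [Complex.re_ofReal_mul] at hre
  have hz0 : 0 ≤ z.re := nonneg_of_mul_nonneg_right hre hε
  have hκc : (κ:ℂ) = ε ^ 2 * k := by rw [hκd, hE]; push_cast; ring
  refine core (z := z) (r := (eta (n 0) (ε * z) - ε * z + (ε * z) ^ 2 / 2) / ε ^ 2)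
    (r' := (etas (n 0) (ε * z) - 1 + ε * z) / ε) hε ht2 hA hz0 hs ?_ ?_ ?_ ?_ ?_ ?_ hv hv2
  · rw [hκk] at hs3
    have : ε⁻¹ * (ε ^ 2 * |k|) = ε * |k| := by field_simp
    rw [this] at hs3
    exact le_of_mul_le_mul_left hs3 hε
  · rw [hκk] at hs2
    have : ε ^ 2 * ‖z‖ ^ 2 ≤ ε ^ 2 * (8 * |k|) := by nlinarith
    exact le_of_mul_le_mul_left this (by positivity)
  · rw [norm_div, norm_pow, hεn, div_le_iff₀ (by positivity)]
    calc _ ≤ A * (ε * ‖z‖) ^ 3 := hR.trans (by gcongr)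
      _ = _ := by ring
  · rw [norm_div, hεn, div_le_iff₀ (by positivity)]
    calc _ ≤ A * (ε * ‖z‖) ^ 2 := hR'.trans (by gcongr)
      _ = _ := by ring
  · rw [hκc] at he
    push_cast at he
    generalize eta (n 0) (ε * z) = E0 at he ⊢
    field_simp
    linear_combination 2 * he
  · push_cast at hp
    generalize etas (n 0) (ε * z) = E0 at hp ⊢
    field_simp
    linear_combination hp

end
end AK
end

section
open MeasureTheory Set Filter Topology
namespace AK

/-- The Fejer kernel. -/
noncomputable def FK (y : ℝ) : ℝ := ∫ k in (0:ℝ)..1, (1 - k) * Real.cos (k * y)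

lemma FK_cont : Continuous FK := by
  unfold FK
  apply intervalIntegral.continuous_parametric_intervalIntegral_of_continuous'
  fun_prop

lemma FK_mul (y : ℝ) : y ^ 2 * FK y = 1 - Real.cos y := by
  rw [FK, ← intervalIntegral.integral_const_mul]
  have hd : ∀ k ∈ uIcc (0:ℝ) 1, HasDerivAt (fun k : ℝ => y * (1 - k) * Real.sin (k * y) - Real.cos (k * y))
      (y ^ 2 * ((1 - k) * Real.cos (k * y))) k := by
    intro k _
    have a : HasDerivAt (fun k : ℝ => k * y) y k := by simpa using (hasDerivAt_id k).mul_const y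
    have b : HasDerivAt (fun k : ℝ => y * (1 - k)) (-y) k := by
      simpa using ((hasDerivAt_id k).const_sub 1).const_mul y
    refine ((b.mul a.sin).sub a.cos).congr_deriv ?_
    ring
  rw [intervalIntegral.integral_eq_sub_of_hasDerivAt hd
    (Continuous.intervalIntegrable (by fun_prop) _ _)]
  simp; ring

lemma FK_zero : FK 0 = 1 / 2 := by
  simp only [FK, mul_zero, Real.cos_zero, mul_one]
  rw [intervalIntegral.integral_sub (by simp) (by simp)]
  simp; norm_num

lemma FK_nonneg (y : ℝ) : 0 ≤ FK y := by
  rcases eq_or_ne y 0 with rfl | h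
  · rw [FK_zero]; norm_num
  · have h1 := FK_mul y
    have h2 := Real.cos_le_one y
    have h3 : 0 < y ^ 2 := by positivity
    by_contra hc
    push Not at hc
    nlinarith

lemma FK_le_one (y : ℝ) : FK y ≤ 1 := by
  have := intervalIntegral.norm_integral_le_of_norm_le_const (a := (0:ℝ)) (b := 1) (C := 1)
    (f := fun k => (1 - k) * Real.cos (k * y)) (fun k hk => by
      rw [uIoc_of_le zero_le_one] at hk
      rw [norm_mul, Real.norm_eq_abs, Real.norm_eq_abs, abs_of_nonneg (by linarith [hk.2])]
      calc _ ≤ (1 - k) * 1 := by gcongr; linarith [hk.2]; exact Real.abs_cos_le_one _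
        _ ≤ 1 := by linarith [hk.1])
  rw [← FK] at this
  simp at this
  exact (le_abs_self _).trans this

lemma FK_bound (y : ℝ) : FK y ≤ 3 * (1 + y ^ 2)⁻¹ := by
  rw [← div_eq_mul_inv, le_div_iff₀ (by positivity)]
  linarith [FK_mul y, FK_le_one y, Real.neg_one_le_cos y]

lemma FK_int : Integrable FK := by
  refine (integrable_inv_one_add_sq.const_mul 3).mono' FK_cont.aestronglyMeasurable ?_
  filter_upwards with y
  rw [Real.norm_of_nonneg (FK_nonneg y)]
  exact FK_bound y

lemma FK_pos : 0 < ∫ y, FK y := by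
  rw [integral_pos_iff_support_of_nonneg FK_nonneg FK_int]
  refine FK_cont.isOpen_support.measure_pos volume ⟨0, by rw [Function.mem_support, FK_zero]; norm_num⟩

lemma FK_trunc : ∃ a : ℝ, 0 < a ∧ 3 / 4 * (∫ y, FK y) ≤ ∫ y in Icc (-a) a, FK y := by
  have h := intervalIntegral_tendsto_integral FK_int (tendsto_neg_atTop_atBot (G := ℝ)) tendsto_id
  have h2 := h.eventually (lt_mem_nhds (show 3 / 4 * (∫ y, FK y) < ∫ y, FK y by linarith [FK_pos]))
  obtain ⟨a, ha, ha0⟩ := (h2.and (eventually_gt_atTop 0)).exists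
  refine ⟨a, ha0, ?_⟩
  rw [integral_Icc_eq_integral_Ioc, ← intervalIntegral.integral_of_le (by linarith)]
  exact ha.le

/-- integral of the kernel over an interval -/
lemma FK_interval (p q : ℝ) : ∫ y in p..q, FK y
    = ∫ k in (0:ℝ)..1, (1 - k) * ((Real.sin (k * q) - Real.sin (k * p)) / k) := by
  have h1 : ∀ y, FK y = ∫ k in Ioc (0:ℝ) 1, (1 - k) * Real.cos (k * y) := fun y => by
    rw [FK, intervalIntegral.integral_of_le zero_le_one]
  simp only [h1]
  rw [intervalIntegral_integral_swap]
  · rw [intervalIntegral.integral_of_le zero_le_one]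
    apply setIntegral_congr_fun measurableSet_Ioc
    intro k hk
    simp only
    rw [intervalIntegral.integral_const_mul]
    congr 1
    have hk0 : k ≠ 0 := hk.1.ne'
    rw [intervalIntegral.integral_comp_mul_left (fun x => Real.cos x) hk0, integral_cos, smul_eq_mul]
    field_simp
  · rw [Measure.prod_restrict]
    have hc : Continuous (Function.uncurry fun y k : ℝ => (1 - k) * Real.cos (k * y)) := by
      unfold Function.uncurry; fun_prop
    exact (hc.continuousOn.integrableOn_compact (isCompact_uIcc.prod isCompact_Icc)).mono_set
      (prod_mono uIoc_subset_uIcc Ioc_subset_Icc_self)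

end AK
end

section
open MeasureTheory Set Filter Topology
namespace AK

noncomputable def cf (μ : Measure ℝ) (u : ℝ) : ℂ := ∫ z : ℝ, Complex.exp (-((u:ℂ) * Complex.I * (z:ℝ))) ∂μ

noncomputable def Hs (μ : Measure ℝ) (T x : ℝ) : ℝ := ∫ y, μ.real (Iic (x - y / T)) * FK y

lemma Fmeas (μ : Measure ℝ) [IsProbabilityMeasure μ] : Measurable fun x => μ.real (Iic x) :=
  (show Monotone fun x => μ.real (Iic x) from fun a b h =>
    measureReal_mono (Iic_subset_Iic.2 h)).measurable

lemma Hs_int (μ : Measure ℝ) [IsProbabilityMeasure μ] (T x : ℝ) :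
    Integrable fun y => μ.real (Iic (x - y / T)) * FK y := by
  refine FK_int.mono' ?_ ?_
  · exact (((Fmeas μ).comp (by fun_prop : Measurable fun y : ℝ => x - y / T)).mul
      FK_cont.measurable).aestronglyMeasurable
  · filter_upwards with y
    rw [norm_mul, Real.norm_of_nonneg measureReal_nonneg, Real.norm_of_nonneg (FK_nonneg y)]
    exact mul_le_of_le_one_left (FK_nonneg y) measureReal_le_one

lemma Hs_diff1 (μ : Measure ℝ) [IsProbabilityMeasure μ] {T a b : ℝ} (hT : 0 < T) (hab : a ≤ b) :
    Hs μ T b - Hs μ T a = ∫ z, (∫ y in (T * (a - z))..(T * (b - z)), FK y) ∂μ := by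
  set S : Set (ℝ × ℝ) := {p | T * (a - p.2) < p.1 ∧ p.1 ≤ T * (b - p.2)} with hS
  have hSm : MeasurableSet S := by
    have h1 : MeasurableSet {p : ℝ × ℝ | T * (a - p.2) < p.1} :=
      measurableSet_lt (by fun_prop) (by fun_prop)
    have h2 : MeasurableSet {p : ℝ × ℝ | p.1 ≤ T * (b - p.2)} :=
      measurableSet_le (by fun_prop) (by fun_prop)
    exact h1.inter h2
  set f : ℝ → ℝ → ℝ := fun y z => S.indicator (fun p => FK p.1) (y, z) with hf
  have hfi : Integrable (Function.uncurry f) (volume.prod μ) := by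
    have : Function.uncurry f = S.indicator (fun p => FK p.1) := by
      funext p; simp [Function.uncurry, hf]
    rw [this]
    exact (FK_int.comp_fst μ).indicator hSm
  have hsw := integral_integral_swap hfi
  have hl : ∀ y, ∫ z, f y z ∂μ = μ.real (Iic (b - y / T)) * FK y - μ.real (Iic (a - y / T)) * FK y := by
    intro y
    have : (fun z => f y z) = (Ioc (a - y / T) (b - y / T)).indicator (fun _ => FK y) := by
      funext z
      simp only [hf, indicator, hS, mem_ofPred_eq, mem_Ioc]
      have e1 : T * (a - z) < y ↔ a - y / T < z := by
        rw [sub_lt_comm, lt_div_iff₀ hT, mul_comm]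
      have e2 : y ≤ T * (b - z) ↔ z ≤ b - y / T := by
        rw [le_sub_comm, div_le_iff₀ hT, mul_comm]
      simp only [e1, e2]
    rw [this, integral_indicator_const _ measurableSet_Ioc, smul_eq_mul, ← sub_mul]
    congr 1
    have hd : Ioc (a - y / T) (b - y / T) = Iic (b - y / T) \ Iic (a - y / T) := by
      ext x; simp [and_comm]
    rw [hd, measureReal_sdiff (Iic_subset_Iic.2 (by linarith)) measurableSet_Iic]
  have hr : ∀ z, ∫ y, f y z = ∫ y in (T * (a - z))..(T * (b - z)), FK y := by
    intro z
    have : (fun y => f y z) = (Ioc (T * (a - z)) (T * (b - z))).indicator FK := by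
      funext y
      simp only [hf, indicator, hS, mem_ofPred_eq, mem_Ioc]
    rw [this, integral_indicator measurableSet_Ioc, intervalIntegral.integral_of_le (by gcongr)]
  simp only [hl, hr] at hsw
  rw [← hsw, integral_sub (Hs_int μ T b) (Hs_int μ T a)]
  rfl

lemma cf_int (μ : Measure ℝ) [IsProbabilityMeasure μ] (u : ℝ) :
    Integrable (fun z : ℝ => Complex.exp (-((u:ℂ) * Complex.I * (z:ℝ)))) μ := by
  refine Integrable.of_bound (C := 1) (by fun_prop) ?_
  filter_upwards with z
  rw [Complex.norm_exp]
  simp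

lemma sin_int (μ : Measure ℝ) [IsProbabilityMeasure μ] (u b : ℝ) :
    ∫ z, Real.sin (u * (b - z)) ∂μ = (Complex.exp (u * b * Complex.I) * cf μ u).im := by
  rw [cf, ← integral_const_mul]
  have := Complex.imCLM.integral_comp_comm ((cf_int μ u).const_mul (Complex.exp (u * b * Complex.I)))
  simp only [Complex.imCLM_apply] at this
  rw [← this]
  congr 1
  funext z
  rw [← Complex.exp_add]
  have : (u * b * Complex.I + -((u:ℂ) * Complex.I * (z:ℝ))) = ((u * (b - z) : ℝ) : ℂ) * Complex.I := by
    push_cast; ring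
  rw [this, Complex.exp_ofReal_mul_I_im]

noncomputable def gH (μ : Measure ℝ) (T a b k : ℝ) : ℝ := (1 - k) / k *
      ((Complex.exp ((k * T : ℝ) * b * Complex.I) * cf μ (k * T)).im
        - (Complex.exp ((k * T : ℝ) * a * Complex.I) * cf μ (k * T)).im)

lemma Hs_diff (μ : Measure ℝ) [IsProbabilityMeasure μ] {T a b : ℝ} (hT : 0 < T) (hab : a ≤ b) :
    IntervalIntegrable (gH μ T a b) volume 0 1 ∧
    Hs μ T b - Hs μ T a = ∫ k in (0:ℝ)..1, gH μ T a b k := by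
  rw [Hs_diff1 μ hT hab]
  simp only [FK_interval]
  have hb : ∀ k z : ℝ, |(Real.sin (k * (T * (b - z))) - Real.sin (k * (T * (a - z)))) / k| ≤ T * (b - a) := by
    intro k z
    rcases eq_or_ne k 0 with rfl | hk
    · simp; exact mul_nonneg hT.le (by linarith)
    · rw [abs_div, div_le_iff₀ (abs_pos.2 hk)]
      have := Real.abs_sin_sub_sin_le (k * (T * (b - z))) (k * (T * (a - z)))
      refine this.trans (le_of_eq ?_)
      have : k * (T * (b - z)) - k * (T * (a - z)) = T * (b - a) * k := by ring
      rw [this, abs_mul, abs_of_nonneg (mul_nonneg hT.le (by linarith))]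
  have hI : Integrable (Function.uncurry fun k z : ℝ => (1 - k) *
      ((Real.sin (k * (T * (b - z))) - Real.sin (k * (T * (a - z)))) / k))
      ((volume.restrict (uIoc 0 1)).prod μ) := by
    have hi : Integrable (fun k : ℝ => |1 - k| * (T * (b - a))) (volume.restrict (uIoc 0 1)) := by
      have : Continuous (fun k : ℝ => |1 - k| * (T * (b - a))) := by fun_prop
      exact (this.integrableOn_Icc (a := 0) (b := 1)).mono_set (by
        rw [uIoc_of_le zero_le_one]; exact Ioc_subset_Icc_self)
    refine (hi.comp_fst μ).mono' ?_ ?_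
    · apply Measurable.aestronglyMeasurable
      unfold Function.uncurry
      fun_prop
    · filter_upwards with p
      simp only [Function.uncurry]
      rw [norm_mul, Real.norm_eq_abs, Real.norm_eq_abs]
      gcongr
      exact hb _ _
  have hg : ∀ k : ℝ, ∫ z, (1 - k) *
      ((Real.sin (k * (T * (b - z))) - Real.sin (k * (T * (a - z)))) / k) ∂μ = gH μ T a b k := by
    intro k
    have hm : ∀ c : ℝ, Integrable (fun z => Real.sin (k * (T * (c - z)))) μ := fun c =>
      Integrable.of_bound (C := 1) (by fun_prop) (Eventually.of_forall fun z => Real.abs_sin_le_one _)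
    rw [integral_const_mul, integral_div, integral_sub (hm b) (hm a)]
    have e : ∀ c : ℝ, ∫ z, Real.sin (k * (T * (c - z))) ∂μ
        = (Complex.exp ((k * T : ℝ) * c * Complex.I) * cf μ (k * T)).im := fun c => by
      rw [← sin_int]; simp only [mul_assoc]
    rw [e, e, gH]; ring
  constructor
  · rw [intervalIntegrable_iff]
    have := hI.integral_prod_left
    simp only [Function.uncurry, hg] at this
    exact this
  · rw [← intervalIntegral_integral_swap hI]
    simp only [hg]

lemma log_int {T : ℝ} (hT : 0 < T) : ∫ k in (0:ℝ)..1, T / (1 + k * T) = Real.log (1 + T) := by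
  have hd : ∀ k ∈ uIcc (0:ℝ) 1, HasDerivAt (fun k : ℝ => Real.log (1 + k * T)) (T / (1 + k * T)) k := by
    intro k hk
    rw [uIcc_of_le zero_le_one] at hk
    have a : HasDerivAt (fun k : ℝ => 1 + k * T) T k := by
      simpa using ((hasDerivAt_id k).mul_const T).const_add 1
    have : 0 < 1 + k * T := by have := mul_nonneg hk.1 hT.le; linarith
    exact a.log this.ne'
  rw [intervalIntegral.integral_eq_sub_of_hasDerivAt hd]
  · simp
  · apply ContinuousOn.intervalIntegrable
    apply ContinuousOn.div (by fun_prop) (by fun_prop)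
    intro k hk
    rw [uIcc_of_le zero_le_one] at hk
    have := mul_nonneg hk.1 hT.le
    linarith


lemma Hs_atBot (μ : Measure ℝ) [IsProbabilityMeasure μ] {T : ℝ} :
    Tendsto (fun a => Hs μ T a) atBot (𝓝 0) := by
  have := tendsto_integral_filter_of_dominated_convergence (l := (atBot : Filter ℝ)) (μ := volume)
    (F := fun a y => μ.real (Iic (a - y / T)) * FK y) (f := fun _ => (0:ℝ)) FK
    (Eventually.of_forall fun a => (Hs_int μ T a).aestronglyMeasurable)
    (Eventually.of_forall fun a => Eventually.of_forall fun y => by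
      rw [norm_mul, Real.norm_of_nonneg measureReal_nonneg, Real.norm_of_nonneg (FK_nonneg y)]
      exact mul_le_of_le_one_left (FK_nonneg y) measureReal_le_one) FK_int
    (Eventually.of_forall fun y => by
      have h1 : Tendsto (fun x => μ.real (Iic x)) atBot (𝓝 0) := by
        exact (ProbabilityTheory.tendsto_cdf_atBot μ).congr fun x => ProbabilityTheory.cdf_eq_real μ x
      have h4 := (h1.comp (tendsto_atBot_add_const_right atBot (-(y / T)) tendsto_id)).mul_const (FK y)
      simpa [Function.comp_def, sub_eq_add_neg] using h4)
  simpa [Hs] using this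

lemma Hs_bound (μ ν : Measure ℝ) [IsProbabilityMeasure μ] [IsProbabilityMeasure ν] {T D : ℝ} (hT : 0 < T)
    (hD : 0 ≤ D) (h : ∀ u, 0 < u → u ≤ T → ‖cf μ u - cf ν u‖ ≤ D * (u / (1 + u))) (x : ℝ) :
    |Hs μ T x - Hs ν T x| ≤ 2 * D * Real.log (1 + T) := by
  have key : ∀ a, a ≤ x → |(Hs μ T x - Hs ν T x) - (Hs μ T a - Hs ν T a)| ≤ 2 * D * Real.log (1 + T) := by
    intro a ha
    obtain ⟨i1, e1⟩ := Hs_diff μ hT ha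
    obtain ⟨i2, e2⟩ := Hs_diff ν hT ha
    have e3 : (Hs μ T x - Hs ν T x) - (Hs μ T a - Hs ν T a)
        = ∫ k in (0:ℝ)..1, (gH μ T a x k - gH ν T a x k) := by
      rw [intervalIntegral.integral_sub i1 i2, ← e1, ← e2]; ring
    have hTk : ∀ k : ℝ, k ∈ Icc (0:ℝ) 1 → 0 < 1 + k * T := fun k hk => by
      have := mul_nonneg hk.1 hT.le
      linarith
    have hb : ∀ k ∈ Ioc (0:ℝ) 1, ‖gH μ T a x k - gH ν T a x k‖ ≤ 2 * D * (T / (1 + k * T)) := by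
      intro k hk
      have hk0 := hk.1
      have h1 := h (k * T) (mul_pos hk.1 hT) (mul_le_of_le_one_left hT.le hk.2)
      have hpos := hTk k ⟨hk.1.le, hk.2⟩
      have hE : ∀ c : ℝ, |(Complex.exp ((k * T : ℝ) * c * Complex.I) * (cf μ (k * T) - cf ν (k * T))).im|
          ≤ D * ((k * T) / (1 + k * T)) := by
        intro c
        refine (Complex.abs_im_le_norm _).trans ?_
        rw [norm_mul, ← Complex.ofReal_mul, Complex.norm_exp_ofReal_mul_I, one_mul]
        exact h1
      have e : gH μ T a x k - gH ν T a x k = (1 - k) / k *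
          ((Complex.exp ((k * T : ℝ) * x * Complex.I) * (cf μ (k * T) - cf ν (k * T))).im
          - (Complex.exp ((k * T : ℝ) * a * Complex.I) * (cf μ (k * T) - cf ν (k * T))).im) := by
        simp only [gH, mul_sub, Complex.sub_im]; ring
      rw [e, norm_mul, Real.norm_eq_abs, Real.norm_eq_abs, abs_of_nonneg (div_nonneg (by linarith [hk.2]) hk.1.le)]
      calc _ ≤ 1 / k * (D * ((k * T) / (1 + k * T)) + D * ((k * T) / (1 + k * T))) := by
            gcongr
            · linarith
            · exact (abs_sub _ _).trans (add_le_add (hE x) (hE a))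
        _ = _ := by field_simp; ring
    have hci : IntervalIntegrable (fun k : ℝ => 2 * D * (T / (1 + k * T))) volume 0 1 := by
      apply ContinuousOn.intervalIntegrable
      apply ContinuousOn.mul (by fun_prop)
      apply ContinuousOn.div (by fun_prop) (by fun_prop)
      intro k hk
      rw [uIcc_of_le zero_le_one] at hk
      exact (hTk k hk).ne'
    rw [e3, ← Real.norm_eq_abs, ← log_int hT, ← intervalIntegral.integral_const_mul]
    exact intervalIntegral.norm_integral_le_of_norm_le zero_le_one
      (Eventually.of_forall fun k hk => hb k hk) hci
  have hl : Tendsto (fun a => |(Hs μ T x - Hs ν T x) - (Hs μ T a - Hs ν T a)|) atBot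
      (𝓝 |(Hs μ T x - Hs ν T x) - (0 - 0)|) :=
    (tendsto_const_nhds.sub ((Hs_atBot μ).sub (Hs_atBot ν))).abs
  simp only [sub_zero] at hl
  exact le_of_tendsto hl (by filter_upwards [eventually_le_atBot x] with a ha using key a ha)

end AK
end

section
open MeasureTheory Set Filter Topology
namespace AK

lemma FK_low {g : ℝ → ℝ} {a m Δ : ℝ} (hgi : Integrable fun y => g y * FK y)
    (h1 : ∀ y ∈ Icc (-a) a, m ≤ g y) (h2 : ∀ y, -Δ ≤ g y) :
    (m + Δ) * (∫ y in Icc (-a) a, FK y) - Δ * (∫ y, FK y) ≤ ∫ y, g y * FK y := by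
  rw [← integral_indicator measurableSet_Icc, ← integral_const_mul, ← integral_const_mul,
    ← integral_sub ((FK_int.indicator measurableSet_Icc).const_mul _) (FK_int.const_mul _)]
  apply integral_mono (((FK_int.indicator measurableSet_Icc).const_mul _).sub (FK_int.const_mul _)) hgi
  intro y
  have hK := FK_nonneg y
  by_cases hy : y ∈ Icc (-a) a
  · simp only [Pi.sub_apply, indicator_of_mem hy]
    nlinarith [h1 y hy]
  · simp only [Pi.sub_apply, indicator_of_notMem hy]
    nlinarith [h2 y]

lemma esseen : ∃ c a : ℝ, 0 < c ∧ 0 < a ∧ ∀ (μ ν : Measure ℝ) [IsProbabilityMeasure μ]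
    [IsProbabilityMeasure ν] (T D B : ℝ), 0 < T → 0 ≤ D → 0 ≤ B →
    (∀ u, 0 < u → u ≤ T → ‖cf μ u - cf ν u‖ ≤ D * (u / (1 + u))) →
    (∀ x h : ℝ, 0 ≤ h → ν.real (Iic (x + h)) - ν.real (Iic x) ≤ B * √h) →
    ∀ x, |μ.real (Iic x) - ν.real (Iic x)| ≤ c * D * Real.log (1 + T) + 2 * B * √(a / T) := by
  obtain ⟨a, ha, hp⟩ := FK_trunc
  have hc := FK_pos
  set c := ∫ y, FK y with hcd
  set p := ∫ y in Icc (-a) a, FK y with hpd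
  refine ⟨4 / c, 2 * a, by positivity, by positivity, ?_⟩
  intro μ ν _ _ T D B hT hD hB hcf hν
  have hpc : p ≤ c := setIntegral_le_integral FK_int (Eventually.of_forall FK_nonneg)
  set G : ℝ → ℝ := fun x => μ.real (Iic x) - ν.real (Iic x) with hG
  have hG1 : ∀ x, |G x| ≤ 1 := fun x => by
    have h1 : μ.real (Iic x) ≤ 1 := measureReal_le_one
    have h2 : ν.real (Iic x) ≤ 1 := measureReal_le_one
    have h3 : 0 ≤ μ.real (Iic x) := measureReal_nonneg
    have h4 : 0 ≤ ν.real (Iic x) := measureReal_nonneg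
    rw [abs_le]; constructor <;> simp only [hG] <;> linarith
  have hbdd : BddAbove (range fun x => |G x|) := ⟨1, by rintro _ ⟨x, rfl⟩; exact hG1 x⟩
  set Δ := ⨆ x, |G x| with hΔ
  have hle : ∀ x, |G x| ≤ Δ := fun x => le_ciSup hbdd x
  have hΔ0 : 0 ≤ Δ := (abs_nonneg _).trans (hle 0)
  set ω := B * √(2 * a / T) with hω
  set L := 2 * D * Real.log (1 + T) with hL
  have hHs : ∀ x, Integrable (fun y => G (x - y / T) * FK y) ∧
      |∫ y, G (x - y / T) * FK y| ≤ L := by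
    intro x
    have i1 := Hs_int μ T x
    have i2 := Hs_int ν T x
    have e : (fun y => G (x - y / T) * FK y)
        = fun y => μ.real (Iic (x - y / T)) * FK y - ν.real (Iic (x - y / T)) * FK y := by
      funext y; simp only [hG]; ring
    rw [e]
    refine ⟨i1.sub i2, ?_⟩
    rw [integral_sub i1 i2]
    exact Hs_bound μ ν hT hD hcf x
  have hmono : ∀ (ρ : Measure ℝ) [IsProbabilityMeasure ρ] (x y : ℝ), x ≤ y → ρ.real (Iic x) ≤ ρ.real (Iic y) :=
    fun ρ _ x y h => measureReal_mono (Iic_subset_Iic.2 h)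
  have h2a : 0 ≤ 2 * a / T := by positivity
  have hyT : ∀ y ∈ Icc (-a) a, y / T ≤ a / T ∧ -(a / T) ≤ y / T := by
    intro y hy
    constructor
    · gcongr; exact hy.2
    · rw [← neg_div]; gcongr; exact hy.1
  have e2a : 2 * a / T = a / T + a / T := by ring
  have main : ∀ x, |G x| * p ≤ L + ω * p + Δ * (c - p) := by
    intro x
    rcases le_total 0 (G x) with hx | hx
    · rw [abs_of_nonneg hx]
      obtain ⟨i, hb⟩ := hHs (x + a / T)
      have hl := FK_low (a := a) (m := G x - ω) (Δ := Δ) i (by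
        intro y hy
        obtain ⟨y1, y2⟩ := hyT y hy
        have a1 := hmono μ x (x + a / T - y / T) (by linarith)
        have a2 := hmono ν (x + a / T - y / T) (x + 2 * a / T) (by linarith)
        have a3 := hν x _ h2a
        simp only [hG]
        linarith) (fun y => (abs_le.1 (hle _)).1)
      have := (abs_le.1 hb).2
      nlinarith
    · rw [abs_of_nonpos hx]
      obtain ⟨i, hb⟩ := hHs (x - a / T)
      have i' : Integrable (fun y => (-G (x - a / T - y / T)) * FK y) := by
        have := i.neg
        refine this.congr (Eventually.of_forall fun y => ?_)
        simp
      have hl := FK_low (a := a) (m := -G x - ω) (Δ := Δ) i' (by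
        intro y hy
        obtain ⟨y1, y2⟩ := hyT y hy
        have a1 := hmono μ (x - a / T - y / T) x (by linarith)
        have a2 := hmono ν (x - 2 * a / T) (x - a / T - y / T) (by linarith)
        have a3 := hν (x - 2 * a / T) _ h2a
        rw [sub_add_cancel] at a3
        simp only [hG]
        linarith) (fun y => neg_le_neg (abs_le.1 (hle _)).2)
      simp only [neg_mul, integral_neg] at hl
      have := (abs_le.1 hb).1
      nlinarith
  have hp0 : 0 < p := by linarith
  have hsup : Δ ≤ (L + ω * p + Δ * (c - p)) / p :=
    ciSup_le fun x => by rw [le_div_iff₀ hp0]; exact main x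
  rw [le_div_iff₀ hp0] at hsup
  have hω0 : 0 ≤ ω := by positivity
  have hfin : Δ * c ≤ 2 * L + 2 * ω * c := by nlinarith
  intro x
  calc |G x| ≤ Δ := hle x
    _ ≤ (2 * L + 2 * ω * c) / c := by rw [le_div_iff₀ hc]; exact hfin
    _ = _ := by rw [hL, hω]; field_simp; ring
end AK
end

section
open MeasureTheory Set Filter Topology
namespace AK

noncomputable def rho (y : ℝ) : ℝ :=
  (Real.sqrt (2 * Real.pi))⁻¹ * y ^ (-(1 : ℝ) / 2) * Real.exp (-y / 2)

lemma rho_nonneg {y : ℝ} (hy : 0 ≤ y) : 0 ≤ rho y := by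
  unfold rho; positivity

lemma rho_meas : Measurable rho := by
  unfold rho; fun_prop

lemma rho_int : IntegrableOn rho (Ioi 0) := by
  have := (integrableOn_rpow_mul_exp_neg_mul_rpow (p := 1) (s := -(1:ℝ)/2) (b := 1/2)
    (by norm_num) (by norm_num) (by norm_num)).const_mul (Real.sqrt (2 * Real.pi))⁻¹
  refine this.congr (ae_of_all _ fun y => ?_)
  simp only [rho, Real.rpow_one]
  rw [mul_assoc]; congr 3; ring

lemma rho_total : ∫ y in Ioi 0, rho y = 1 := by
  have := Real.integral_rpow_mul_exp_neg_mul_Ioi (a := 1/2) (r := 1/2) (by norm_num) (by norm_num)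
  have e : ∫ y in Ioi 0, rho y = (Real.sqrt (2 * Real.pi))⁻¹ *
      ∫ t : ℝ in Ioi 0, t ^ ((1:ℝ)/2 - 1) * Real.exp (-((1/2) * t)) := by
    rw [← integral_const_mul]
    refine integral_congr_ae (ae_of_all _ fun y => ?_)
    simp only [rho]
    rw [mul_assoc]; congr 3
    · norm_num
    · ring
  rw [e, this, Real.Gamma_one_half_eq, ← Real.sqrt_eq_rpow]
  rw [← Real.sqrt_mul (by norm_num), inv_mul_eq_div, div_eq_one_iff_eq (by positivity)]
  norm_num

noncomputable def nu : Measure ℝ :=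
  (volume.restrict (Ioi 0)).withDensity (fun y => ENNReal.ofReal (rho y))

lemma nu_apply {s : Set ℝ} (hs : MeasurableSet s) :
    nu s = ENNReal.ofReal (∫ y in s ∩ Ioi 0, rho y) := by
  rw [nu, withDensity_apply _ hs, Measure.restrict_restrict hs,
    ofReal_integral_eq_lintegral_ofReal (rho_int.mono_set inter_subset_right)]
  exact (ae_restrict_iff' (hs.inter measurableSet_Ioi)).2 (ae_of_all _ fun y hy => rho_nonneg (le_of_lt hy.2))

lemma nu_real {s : Set ℝ} (hs : MeasurableSet s) :
    nu.real s = ∫ y in s ∩ Ioi 0, rho y := by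
  rw [measureReal_def, nu_apply hs, ENNReal.toReal_ofReal]
  exact setIntegral_nonneg (hs.inter measurableSet_Ioi) fun y hy => rho_nonneg (le_of_lt hy.2)

instance nu_prob : IsProbabilityMeasure nu :=
  ⟨by rw [nu_apply MeasurableSet.univ, univ_inter, rho_total]; simp⟩

lemma nu_Iic {x : ℝ} : nu.real (Iic x) = ∫ y in Ioc 0 x, rho y := by
  rw [nu_real measurableSet_Iic]
  congr 2
  ext y; simp [and_comm]

lemma sqrt_sub_le {a b : ℝ} (ha : 0 ≤ a) (hab : a ≤ b) : √b - √a ≤ √(b - a) := by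
  have := Real.sqrt_nonneg a
  have := Real.sqrt_nonneg (b-a)
  have h1 := Real.sq_sqrt ha
  have h2 := Real.sq_sqrt (sub_nonneg.2 hab)
  have : √b ≤ √a + √(b-a) := by
    apply Real.sqrt_le_iff.2 ⟨by positivity, by nlinarith⟩
  linarith

lemma nu_mod (x h : ℝ) (hh : 0 ≤ h) :
    nu.real (Iic (x+h)) - nu.real (Iic x) ≤ (2 * (Real.sqrt (2 * Real.pi))⁻¹) * √h := by
  have e : nu.real (Iic (x+h)) - nu.real (Iic x) = nu.real (Ioc x (x+h)) := by
    rw [← measureReal_sdiff (Iic_subset_Iic.2 (by linarith)) measurableSet_Iic]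
    congr 1; ext y; simp [and_comm]
  have hab : max x 0 ≤ max (x+h) 0 := max_le_max (by linarith) le_rfl
  have e2 : Ioc x (x+h) ∩ Ioi 0 = Ioc (max x 0) (max (x+h) 0) := by
    ext y; simp only [mem_inter_iff, mem_Ioc, mem_Ioi, max_lt_iff, le_max_iff]
    constructor
    · rintro ⟨⟨h1, h2⟩, h3⟩; exact ⟨⟨h1, h3⟩, Or.inl h2⟩
    · rintro ⟨⟨h1, h3⟩, h2 | h2⟩
      · exact ⟨⟨h1, h2⟩, h3⟩
      · linarith
  rw [e, nu_real measurableSet_Ioc, e2]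
  set a := max x 0 with ha
  set b := max (x+h) 0 with hb
  have ha0 : 0 ≤ a := le_max_right _ _
  have hii : IntervalIntegrable (fun y : ℝ => y ^ (-(1:ℝ)/2)) volume a b :=
    intervalIntegral.intervalIntegrable_rpow' (by norm_num)
  have i1 : IntegrableOn (fun y : ℝ => y ^ (-(1:ℝ)/2)) (Ioc a b) :=
    (intervalIntegrable_iff_integrableOn_Ioc_of_le hab).1 hii
  have le : ∫ y in Ioc a b, rho y ≤ ∫ y in Ioc a b, (Real.sqrt (2 * Real.pi))⁻¹ * y ^ (-(1:ℝ)/2) := by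
    refine setIntegral_mono_on (rho_int.mono_set fun y hy => lt_of_le_of_lt ha0 hy.1)
      (i1.const_mul _) measurableSet_Ioc fun y hy => ?_
    have hy0 : 0 < y := lt_of_le_of_lt ha0 hy.1
    unfold rho
    refine mul_le_of_le_one_right (by positivity) (Real.exp_le_one_iff.2 (by linarith))
  refine le.trans ?_
  rw [integral_const_mul, ← intervalIntegral.integral_of_le hab,
    integral_rpow (Or.inl (by norm_num))]
  have : (-(1:ℝ)/2 + 1) = 1/2 := by norm_num
  rw [this, ← Real.sqrt_eq_rpow, ← Real.sqrt_eq_rpow]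
  have h1 := sqrt_sub_le ha0 hab
  have h2 : √(b - a) ≤ √h := by
    apply Real.sqrt_le_sqrt
    have : b ≤ a + h := max_le (by linarith [le_max_left x 0]) (by linarith)
    linarith
  have : 0 ≤ (Real.sqrt (2 * Real.pi))⁻¹ := by positivity
  have : (Real.sqrt (2 * Real.pi))⁻¹ * (√b - √a) ≤ (Real.sqrt (2 * Real.pi))⁻¹ * √h :=
    mul_le_mul_of_nonneg_left (h1.trans h2) this
  have e3 : (√b - √a) / (1/2) = 2 * (√b - √a) := by ring
  rw [e3]; linarith

lemma cf_nu (k : ℝ) : ∃ v : ℂ, 0 < v.re ∧ v^2 = 1 + 2*k*Complex.I ∧ cf nu k = 1 / v := by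
  set r : ℂ := 1/2 + k * Complex.I with hr
  have hre : 0 < r.re := by simp [hr]
  have hr0 : r ≠ 0 := fun h => by simp [h] at hre
  have key := integral_gaussian_complex_Ioi (b := r) hre
  have sub := integral_comp_rpow_Ioi_of_pos (p := 2)
    (g := fun y : ℝ => ((y ^ (-(1:ℝ)/2) : ℝ) : ℂ) * Complex.exp (-(r * y))) (by norm_num)
  have e0 : ∫ x : ℝ in Ioi 0, ((2:ℝ) * x ^ ((2:ℝ) - 1)) •
      ((((x ^ (2:ℝ)) ^ (-(1:ℝ)/2) : ℝ) : ℂ) * Complex.exp (-(r * ((x ^ (2:ℝ) : ℝ) : ℂ))))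
      = 2 * ∫ x : ℝ in Ioi 0, Complex.exp (-r * (x:ℂ)^2) := by
    rw [← integral_const_mul]
    refine setIntegral_congr_fun measurableSet_Ioi fun y hy => ?_
    have hy : 0 < y := hy
    rw [← Real.rpow_mul hy.le, show (2:ℝ) - 1 = 1 by norm_num, Real.rpow_one,
      show (2:ℝ) * (-1/2) = -1 by norm_num, Real.rpow_neg_one, Complex.real_smul, Real.rpow_two]
    push_cast
    have : (y:ℂ) ≠ 0 := by exact_mod_cast hy.ne'
    rw [neg_mul]
    field_simp
  rw [e0, key] at sub
  have e : cf nu k = ((Real.sqrt (2 * Real.pi) : ℝ) : ℂ)⁻¹ *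
      ∫ y : ℝ in Ioi 0, ((y ^ (-(1:ℝ)/2) : ℝ) : ℂ) * Complex.exp (-(r * y)) := by
    rw [cf, nu, integral_withDensity_eq_integral_toReal_smul
      (by exact rho_meas.ennreal_ofReal) (ae_of_all _ fun y => ENNReal.ofReal_lt_top), ← integral_const_mul]
    refine setIntegral_congr_fun measurableSet_Ioi fun y hy => ?_
    have hy : 0 < y := hy
    beta_reduce
    rw [ENNReal.toReal_ofReal (rho_nonneg hy.le), Complex.real_smul, rho,
      Complex.ofReal_mul, Complex.ofReal_mul, Complex.ofReal_inv, Complex.ofReal_exp,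
      mul_assoc, mul_assoc, ← Complex.exp_add]
    congr 3
    push_cast
    rw [hr]; ring
  have hpi := Real.pi_pos
  have hri : 0 < (Real.pi/r).re := by
    rw [div_eq_mul_inv, Complex.re_ofReal_mul, Complex.inv_re]
    exact mul_pos hpi (div_pos hre (Complex.normSq_pos.2 hr0))
  set w : ℂ := (Real.pi/r) ^ ((1:ℂ)/2) with hw
  have hir : Real.pi/r ≠ 0 := fun h => by simp [h] at hri
  have hw2 : w^2 = Real.pi/r := by
    rw [hw, ← Complex.cpow_nat_mul]; norm_num
  have hwre : 0 < w.re := by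
    rw [hw, Complex.cpow_def_of_ne_zero hir, Complex.exp_re]
    refine mul_pos (Real.exp_pos _) ?_
    have e1 : (Complex.log (Real.pi/r) * (1/2)).im = (Real.pi/r).arg / 2 := by
      rw [show (1/2:ℂ) = ((1/2:ℝ):ℂ) by norm_num, Complex.im_mul_ofReal, Complex.log_im]; ring
    rw [e1]
    apply Real.cos_pos_of_mem_Ioo
    have h1 := Complex.neg_pi_lt_arg (Real.pi/r)
    have h2 := Complex.arg_le_pi (Real.pi/r)
    have h4 : (Real.pi/r).arg < Real.pi := by
      rcases h2.lt_or_eq with h | h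
      · exact h
      · rw [Complex.arg_eq_pi_iff] at h; linarith [h.1]
    constructor <;> linarith
  have hw0 : w ≠ 0 := fun h => by simp [h] at hwre
  have hs2 : ((√(2 * Real.pi) : ℝ) : ℂ)^2 = 2 * Real.pi := by
    rw [← Complex.ofReal_pow, Real.sq_sqrt (by positivity)]; push_cast; rfl
  have hs0 : ((√(2 * Real.pi) : ℝ) : ℂ) ≠ 0 := by
    rw [Complex.ofReal_ne_zero]; positivity
  have hp0 : (Real.pi : ℂ) ≠ 0 := by rw [Complex.ofReal_ne_zero]; positivity
  refine ⟨(√(2 * Real.pi) : ℝ) * w⁻¹, ?_, ?_, ?_⟩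
  · rw [Complex.re_ofReal_mul, Complex.inv_re]
    exact mul_pos (by positivity) (div_pos hwre (Complex.normSq_pos.2 hw0))
  · rw [mul_pow, inv_pow, hw2, hs2, inv_div]
    have : (2 * Real.pi : ℂ) * (r / Real.pi) = 2 * r := by field_simp
    rw [this, hr]; ring
  · rw [e, ← sub]
    field_simp

end AK
end

section
open MeasureTheory Set Filter Topology
namespace AK

noncomputable def mu (m : Measure ℝ) (c : ℝ) : Measure ℝ :=
  (m.withDensity (fun x => ENNReal.ofReal x)).map (fun x => c * x)

lemma mu_prob {m : Measure ℝ} (h : PM m) (c : ℝ) : IsProbabilityMeasure (mu m c) := by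
  refine ⟨?_⟩
  rw [mu, Measure.map_apply (by fun_prop) MeasurableSet.univ, preimage_univ,
    withDensity_apply _ MeasurableSet.univ, Measure.restrict_univ]
  exact h.mass

lemma mu_Iic {m : Measure ℝ} (h : PM m) {c x : ℝ} (hc : 0 < c) :
    (mu m c).real (Iic x) = ∫ y in Ioc 0 (c⁻¹ * x), y ∂m := by
  have e1 : (fun y => c * y) ⁻¹' (Iic x) = Iic (c⁻¹ * x) := by
    ext y; simp only [mem_preimage, mem_Iic]
    rw [inv_mul_eq_div, le_div_iff₀ hc, mul_comm]
  have e2 : (Ioc 0 (c⁻¹ * x) : Set ℝ) =ᵐ[m] Iic (c⁻¹ * x) := by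
    filter_upwards [h.pos] with y hy
    apply propext
    change (0 < y ∧ y ≤ c⁻¹ * x) ↔ y ≤ c⁻¹ * x
    exact ⟨fun h => h.2, fun h => ⟨hy, h⟩⟩
  rw [setIntegral_congr_set e2, measureReal_def, mu, Measure.map_apply (by fun_prop) measurableSet_Iic,
    e1, withDensity_apply _ measurableSet_Iic,
    integral_eq_lintegral_of_nonneg_ae (ae_restrict_of_ae (h.pos.mono fun y hy => hy.le)) (by fun_prop)]

lemma cf_mu {m : Measure ℝ} (h : PM m) (c k : ℝ) :
    cf (mu m c) k = etas m ((c * k : ℝ) * Complex.I) := by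
  rw [cf, mu, integral_map (by fun_prop) (by fun_prop),
    integral_withDensity_eq_integral_toReal_smul (by fun_prop) (ae_of_all _ fun y => ENNReal.ofReal_lt_top),
    etas]
  refine integral_congr_ae ?_
  filter_upwards [h.pos] with y hy
  rw [ENNReal.toReal_ofReal hy.le, Complex.real_smul]
  congr 3
  push_cast; ring

lemma toSol {n : ℝ → Measure ℝ} {J : Set ℕ}
    (h : IsWeakSolution (fun x y => x + y) (Ici 0) n J) : Sol n where
  fin := fun t ht => h.1 t ht
  pos := fun t ht => ae_pos (h.2.1 t ht)
  weak := fun φ hφ t ht => h.2.2.1 φ hφ.smooth hφ.cpt hφ.supp t ht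

lemma toPM {n : ℝ → Measure ℝ} (S : Sol n) (i1 : Integrable (fun x => x) (n 0))
    (m1 : ∫ x, x ∂(n 0) = 1) (t : ℝ) (ht : 0 ≤ t) : PM (n t) := by
  have hp := S.pos t ht
  have hm : mass (n t) = 1 := by
    rw [mass_eq_init S ht, mass_eq (S.pos 0 le_rfl) i1, m1]; simp
  have hm' : mass (n t) ≠ ⊤ := by rw [hm]; simp
  exact ⟨S.fin t ht, hp, integrable_id hp hm', by rw [← M_eq hp hm', M, hm]; simp⟩

lemma final (μ3 : ℝ) :
    ∃ C : ℝ, ∀ (n : ℝ → Measure ℝ), Sol n → 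
      Integrable (fun x => x) (n 0) → (∫ x, x ∂(n 0)) = 1 →
      Integrable (fun x => x ^ 2) (n 0) → (∫ x, x ^ 2 ∂(n 0)) = 1 →
      Integrable (fun x => x ^ 3) (n 0) → (∫ x, x ^ 3 ∂(n 0)) = μ3 →
      ∀ t ≥ (0 : ℝ), ∀ xh > (0 : ℝ),
        |(∫ y in Ioc 0 (Real.exp (2 * t) * xh), y ∂(n t)) - ∫ y in Ioc (0 : ℝ) xh, rho y|
          ≤ C * (1 + t) * Real.exp (-t) := by
  obtain ⟨c, a, hc, ha, hE⟩ := esseen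
  set A := max μ3 1 with hA
  have hA1 : 1 ≤ A := le_max_right _ _
  set B := 2 * (Real.sqrt (2 * Real.pi))⁻¹ with hB
  have hB0 : 0 ≤ B := by positivity
  refine ⟨2 + c * (40*(1+2*A)) * 2 + 2 * B * (64 * A * √a), fun n S i1 m1 i2 m2 i3 m3 t ht xh hx => ?_⟩
  have hP := toPM S i1 m1
  have hPt := hP t ht
  have := mu_prob hPt (Real.exp (-2*t))
  have e1 := mu_Iic hPt (x := xh) (Real.exp_pos (-2*t))
  have e2 : (Real.exp (-2*t))⁻¹ = Real.exp (2*t) := by rw [← Real.exp_neg]; congr 1; ring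
  rw [e2] at e1
  rw [← e1, ← nu_Iic]
  have hX : 0 ≤ c * (40*(1+2*A)) := by positivity
  have hY : 0 ≤ 2 * B * (64 * A * √a) := by positivity
  have het := Real.exp_pos (-t)
  by_cases h2 : Real.exp (-t) ≤ 1/2
  · have hexp2 : (Real.exp t)^2 = Real.exp (2*t) := by rw [← Real.exp_nat_mul]; norm_num
    have := hE (mu (n t) (Real.exp (-2*t))) nu (Real.exp (2*t) / (4096*A^2)) (40*(1+2*A)*Real.exp (-t)) B
      (by positivity) (by positivity) hB0 (fun k hk hkT => by
        obtain ⟨v, hv, hv2, hcf⟩ := cf_nu k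
        have := phi_bound S hP i2 m2 i3 hA1 (m3.le.trans (le_max_left _ _)) ht h2
          (k := k) (by rwa [abs_of_pos hk]) hv hv2
        rw [abs_of_pos hk] at this
        rw [cf_mu hPt, hcf]
        exact this) nu_mod xh
    refine this.trans ?_
    have hlog : Real.log (1 + Real.exp (2*t) / (4096*A^2)) ≤ 2 * (1 + t) := by
      have h1 : 1 ≤ Real.exp (2*t) := Real.one_le_exp (by linarith)
      have h3 : Real.exp (2*t) / (4096*A^2) ≤ Real.exp (2*t) :=
        div_le_self (Real.exp_pos _).le (by nlinarith)
      rw [Real.log_le_iff_le_exp (by positivity), show 2 * (1+t) = 2 + 2*t by ring, Real.exp_add]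
      have h4 : 2 ≤ Real.exp 2 := by linarith [Real.add_one_le_exp (2:ℝ)]
      nlinarith
    have hsq : √(a / (Real.exp (2*t) / (4096*A^2))) = 64 * A * √a * Real.exp (-t) := by
      rw [show a / (Real.exp (2*t) / (4096*A^2)) = a * (64 * A * Real.exp (-t))^2 by
        rw [← hexp2, Real.exp_neg]; field_simp; ring, Real.sqrt_mul ha.le, Real.sqrt_sq (by positivity)]
      ring
    rw [hsq]
    have g1 : c * (40*(1+2*A)*Real.exp (-t)) * Real.log (1 + Real.exp (2*t) / (4096*A^2))
        ≤ c * (40*(1+2*A)*Real.exp (-t)) * (2 * (1+t)) :=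
      mul_le_mul_of_nonneg_left hlog (by positivity)
    have g2 : 0 ≤ 2 * B * (64 * A * √a) * t * Real.exp (-t) := by positivity
    have g3 : 0 ≤ 2 * (1+t) * Real.exp (-t) := by positivity
    linarith
  · have b1 : (mu (n t) (Real.exp (-2*t))).real (Iic xh) ≤ 1 := measureReal_le_one
    have b2 : nu.real (Iic xh) ≤ 1 := measureReal_le_one
    have b3 : 0 ≤ (mu (n t) (Real.exp (-2*t))).real (Iic xh) := measureReal_nonneg
    have b4 : 0 ≤ nu.real (Iic xh) := measureReal_nonneg
    have : |(mu (n t) (Real.exp (-2*t))).real (Iic xh) - nu.real (Iic xh)| ≤ 1 := by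
      rw [abs_le]; constructor <;> linarith
    refine this.trans ?_
    push Not at h2
    have : 2 * Real.exp (-t) ≤ (2 + c * (40*(1+2*A)) * 2 + 2 * B * (64 * A * √a)) * (1 + t) * Real.exp (-t) := by
      apply mul_le_mul_of_nonneg_right _ het.le
      nlinarith
    linarith

end AK
end

/-- Rate of convergence to self-similarity for Smoluchowski's equation with additive
kernel `K = x + y`: if `n₀` has first and second moments equal to `1` and finite third
moment `μ₃`, then the rescaled mass distribution function
`F(t,xh) = ∫_{(0,e^{2t}xh]} y n(t,dy)` satisfies
`sup_{xh>0} |F(t,xh) - F_*(xh)| ≤ C(μ₃)(1+t)e^{-t}` for all `t ≥ 0`, where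
`F_*(xh) = ∫_0^xh (2π)^{-1/2} y^{-1/2} e^{-y/2} dy` and `C` depends only on `μ₃`. -/
theorem additive_kernel_rate (μ3 : ℝ) :
    ∃ C : ℝ, ∀ (n0 : Measure ℝ) (n : ℝ → Measure ℝ),
      n0 (Iic 0) = 0 →
      Integrable (fun x => x) n0 → (∫ x, x ∂n0) = 1 →
      Integrable (fun x => x ^ 2) n0 → (∫ x, x ^ 2 ∂n0) = 1 →
      Integrable (fun x => x ^ 3) n0 → (∫ x, x ^ 3 ∂n0) = μ3 →
      IsWeakSolution (fun x y => x + y) (Ici 0) n {1, 2, 3} →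
      n 0 = n0 →
      ∀ t ≥ (0 : ℝ), ∀ xh > (0 : ℝ),
        |(∫ y in Ioc 0 (Real.exp (2 * t) * xh), y ∂(n t))
            - ∫ y in Ioc (0 : ℝ) xh,
                (Real.sqrt (2 * Real.pi))⁻¹ * y ^ (-(1 : ℝ) / 2) * Real.exp (-y / 2)|
          ≤ C * (1 + t) * Real.exp (-t) := by
  obtain ⟨C, hC⟩ := AK.final μ3
  refine ⟨C, fun n0 n _ i1 m1 i2 m2 i3 m3 hw h0 => ?_⟩
  subst h0
  exact hC n (AK.toSol hw) i1 m1 i2 m2 i3 m3
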